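/- Let k be a number field, V = k⊗_ℚℝ, and let φ: V^× → ℂ be continuous and invariant under multiplication by units of O_k and by nonzero real scalars. For a principal prime ideal 𝔭 = aO_k set φ(𝔭) = φ(a). Then Σ_{N(𝔭^l) ≤ X, 𝔭 principal} φ(𝔭) log N𝔭 = (X/(R_k h_k)) ∫_{I/O_k^×} φ(t) dt + o(X) as X → ∞, where R_k is the regulator, h_k the class number, and I = {v ∈ V : ‖v‖ = 1}. -/

import Mathlib

open NumberField NumberField.InfinitePlace NumberField.mixedEmbedding NumberField.Units
open MeasureTheory Filter Asymptotics
open scoped Classical ENNReal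

variable (K : Type*) [Field K] [NumberField K]

/-- The cone measure on the norm-one hypersurface `I = {v : ‖v‖ = 1}` of the mixed space of a
number field `K` of degree `N`: the pushforward under the radial projection
`v ↦ ‖v‖^{-1/N} • v` of `N` times Lebesgue measure restricted to `{v : 0 < ‖v‖ ≤ 1}`. -/
noncomputable def coneMeasure : Measure (mixedSpace K) :=
  Measure.map
    (fun v : mixedSpace K =>
      (mixedEmbedding.norm v ^ (-(1 : ℝ) / (Module.finrank ℚ K))) • v)
    (((Module.finrank ℚ K : ℝ≥0∞)) •
      (volume.restrict {v : mixedSpace K |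
        0 < mixedEmbedding.norm v ∧ mixedEmbedding.norm v ≤ 1}))

/-- The value of a function `φ` on the mixed space at a principal ideal, via a choice of
generator (well defined when `φ` is invariant under multiplication by units). -/
noncomputable def phiIdeal (φ : mixedSpace K → ℂ) (I : Ideal (𝓞 K)) : ℂ :=
  if h : Submodule.IsPrincipal I then φ (mixedEmbedding K ((h.generator : 𝓞 K) : K)) else 0

section

/-- The Fejér kernel of bandwidth `T`. -/
noncomputable def fejerKernel (T v : ℝ) : ℝ := T * Real.sinc (T * v / 2) ^ 2

theorem fejerKernel_nonneg {T : ℝ} (hT : 0 ≤ T) (v : ℝ) : 0 ≤ fejerKernel T v := by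
  unfold fejerKernel; positivity

theorem continuous_fejerKernel (T : ℝ) : Continuous (fejerKernel T) := by
  unfold fejerKernel
  have := Real.continuous_sinc
  fun_prop

theorem fejerKernel_eq_mul (T v : ℝ) : fejerKernel T v = T * fejerKernel 1 (T * v) := by
  simp [fejerKernel]

theorem fejerKernel_one_le (v : ℝ) : fejerKernel 1 v ≤ 5 * (1 + v ^ 2)⁻¹ := by
  have hpos : 0 < 1 + v ^ 2 := by positivity
  rw [← div_eq_mul_inv, le_div_iff₀ hpos]
  unfold fejerKernel
  have h1 : Real.sinc (v / 2) ^ 2 ≤ 1 := by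
    rw [sq_le_one_iff_abs_le_one]; exact Real.abs_sinc_le_one _
  have h2 : Real.sinc (v / 2) ^ 2 * v ^ 2 ≤ 4 := by
    rcases eq_or_ne v 0 with rfl | hv
    · norm_num
    · rw [Real.sinc_of_ne_zero (by positivity)]
      have : (Real.sin (v / 2) / (v / 2)) ^ 2 * v ^ 2 = 4 * Real.sin (v / 2) ^ 2 := by
        field_simp
        ring
      rw [this]
      nlinarith [Real.sin_sq_le_one (v / 2)]
  simp only [one_mul]
  nlinarith

theorem integrable_fejerKernel_one : Integrable (fejerKernel 1) := by
  refine (integrable_inv_one_add_sq.const_mul 5).mono'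
    (continuous_fejerKernel 1).aestronglyMeasurable (Eventually.of_forall fun v => ?_)
  rw [Real.norm_of_nonneg (fejerKernel_nonneg zero_le_one v)]
  exact fejerKernel_one_le v

theorem integrable_fejerKernel {T : ℝ} (hT : 0 < T) : Integrable (fejerKernel T) := by
  have : fejerKernel T = fun v => T * fejerKernel 1 (T * v) := funext (fejerKernel_eq_mul T)
  rw [this]
  exact (integrable_fejerKernel_one.comp_mul_left' hT.ne').const_mul T

theorem integral_fejerKernel {T : ℝ} (hT : 0 < T) :
    ∫ v, fejerKernel T v = ∫ v, fejerKernel 1 v := by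
  simp_rw [fejerKernel_eq_mul T]
  rw [integral_const_mul, Measure.integral_comp_mul_left, abs_of_pos (inv_pos.mpr hT), smul_eq_mul,
    mul_inv_cancel_left₀ hT.ne']

theorem integral_fejerKernel_one_pos : 0 < ∫ v, fejerKernel 1 v := by
  refine integral_pos_of_integrable_nonneg_nonzero (continuous_fejerKernel 1)
    integrable_fejerKernel_one (fejerKernel_nonneg zero_le_one) (x := 0) ?_
  simp [fejerKernel]

theorem integral_fejerKernel_Icc {T δ : ℝ} (hT : 0 < T) :
    ∫ v in Set.Icc (-δ) δ, fejerKernel T v = ∫ v in Set.Icc (-(T * δ)) (T * δ), fejerKernel 1 v := by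
  simp_rw [← integral_indicator measurableSet_Icc]
  have : ∀ v, (Set.Icc (-δ) δ).indicator (fejerKernel T) v =
      T * (Set.Icc (-(T * δ)) (T * δ)).indicator (fejerKernel 1) (T * v) := by
    intro v
    have : T * v ∈ Set.Icc (-(T * δ)) (T * δ) ↔ v ∈ Set.Icc (-δ) δ := by
      simp only [Set.mem_Icc, ← mul_neg, mul_le_mul_iff_right₀ hT]
    simp only [Set.indicator_apply, this, fejerKernel_eq_mul T v, mul_ite, mul_zero]
  simp_rw [this]
  rw [integral_const_mul, Measure.integral_comp_mul_left, abs_of_pos (inv_pos.mpr hT), smul_eq_mul,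
    mul_inv_cancel_left₀ hT.ne']

theorem integral_triangle_mul_exp {T : ℝ} (hT : 0 < T) (v : ℝ) :
    ∫ y in (-T)..T, ((1 - |y| / T : ℝ) : ℂ) * Complex.exp (Complex.I * y * v) =
      (fejerKernel T v : ℂ) := by
  have hc : Continuous fun y : ℝ =>
      ((1 - |y| / T : ℝ) : ℂ) * Complex.exp (Complex.I * y * v) := by fun_prop
  rw [← intervalIntegral.integral_add_adjacent_intervals
    (hc.intervalIntegrable (-T) 0) (hc.intervalIntegrable 0 T)]
  have hneg : ∫ y in (-T)..0, ((1 - |y| / T : ℝ) : ℂ) * Complex.exp (Complex.I * y * v) =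
      ∫ y in (0 : ℝ)..T, ((1 - |y| / T : ℝ) : ℂ) * Complex.exp (Complex.I * y * (-v : ℝ)) := by
    have := intervalIntegral.integral_comp_neg (a := -T) (b := 0) fun y : ℝ =>
      ((1 - |y| / T : ℝ) : ℂ) * Complex.exp (Complex.I * y * (-v : ℝ))
    rw [neg_zero, neg_neg] at this
    rw [← this]
    refine intervalIntegral.integral_congr fun y _ => ?_
    simp only [abs_neg]
    congr 2
    push_cast
    ring
  rw [hneg]
  have key : ∀ w : ℝ, w ≠ 0 →
      ∫ y in (0 : ℝ)..T, ((1 - |y| / T : ℝ) : ℂ) * Complex.exp (Complex.I * y * w) =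
        Complex.exp (Complex.I * T * w) / (T * (Complex.I * w) ^ 2) -
          (1 / (Complex.I * w) + 1 / (T * (Complex.I * w) ^ 2)) := by
    intro w hw
    have hw' : (w : ℂ) ≠ 0 := by exact_mod_cast hw
    have hT' : (T : ℂ) ≠ 0 := by exact_mod_cast hT.ne'
    have hd : ∀ y ∈ Set.uIcc 0 T, HasDerivAt (fun y : ℝ =>
        (1 - (y : ℂ) / T) * Complex.exp (Complex.I * y * w) / (Complex.I * w) +
          Complex.exp (Complex.I * y * w) / (T * (Complex.I * w) ^ 2))
        (((1 - |y| / T : ℝ) : ℂ) * Complex.exp (Complex.I * y * w)) y := by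
      intro y hy
      rw [Set.uIcc_of_le hT.le] at hy
      rw [abs_of_nonneg hy.1]
      have h0 : HasDerivAt (fun y : ℝ => (y : ℂ)) 1 y := Complex.ofRealCLM.hasDerivAt
      have he : HasDerivAt (fun y : ℝ => Complex.exp (Complex.I * y * w))
          (Complex.exp (Complex.I * y * w) * (Complex.I * 1 * w)) y :=
        ((h0.const_mul Complex.I).mul_const (w : ℂ)).cexp
      have := ((((h0.div_const (T : ℂ)).const_sub 1).mul he).div_const (Complex.I * w)).add
        (he.div_const (T * (Complex.I * w) ^ 2))
      refine this.congr_deriv ?_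
      push_cast
      field_simp
      ring
    rw [intervalIntegral.integral_eq_sub_of_hasDerivAt hd
      ((by fun_prop : Continuous _).intervalIntegrable _ _)]
    simp [div_self hT']
  rcases eq_or_ne v 0 with rfl | hv
  · simp only [neg_zero, Complex.ofReal_zero, mul_zero, Complex.exp_zero, mul_one]
    have : ∫ y in (0 : ℝ)..T, ((1 - |y| / T : ℝ) : ℂ) = ((T / 2 : ℝ) : ℂ) := by
      rw [intervalIntegral.integral_ofReal]
      congr 1
      have : ∫ y in (0 : ℝ)..T, (1 - |y| / T) = ∫ y in (0 : ℝ)..T, (1 - y / T) := by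
        refine intervalIntegral.integral_congr fun y hy => ?_
        rw [Set.uIcc_of_le hT.le] at hy
        simp [abs_of_nonneg hy.1]
      rw [this, intervalIntegral.integral_sub (by simp) ((by fun_prop : Continuous _).intervalIntegrable _ _)]
      simp only [intervalIntegral.integral_const, intervalIntegral.integral_div, integral_id]
      field_simp
      ring
    rw [this]
    simp [fejerKernel]
  · rw [key v hv, key (-v) (neg_ne_zero.mpr hv)]
    unfold fejerKernel
    rw [Real.sinc_of_ne_zero (by positivity)]
    have hv' : (v : ℂ) ≠ 0 := by exact_mod_cast hv
    have hT' : (T : ℂ) ≠ 0 := by exact_mod_cast hT.ne'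
    have h1 : Complex.exp (Complex.I * T * v) + Complex.exp (Complex.I * T * ((-v : ℝ) : ℂ)) =
        2 - 4 * (Complex.sin (T * v / 2)) ^ 2 := by
      have h2 : Complex.exp (Complex.I * T * v) = Complex.exp ((T * v : ℂ) * Complex.I) := by
        congr 1; ring
      have h3 : Complex.exp (Complex.I * T * ((-v : ℝ) : ℂ)) =
          Complex.exp (-(T * v : ℂ) * Complex.I) := by
        congr 1; push_cast; ring
      rw [h2, h3, ← Complex.two_cos]
      have : (T * v : ℂ) = 2 * (T * v / 2) := by ring
      rw [this, Complex.cos_two_mul, Complex.cos_sq']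
      ring_nf
    have h4 : Complex.exp (Complex.I * T * ((-v : ℝ) : ℂ)) =
      2 - 4 * (Complex.sin (T * v / 2)) ^ 2 - Complex.exp (Complex.I * T * v) := by
      rw [← h1]; ring
    rw [h4]
    push_cast
    have hI : Complex.I ^ 2 = -1 := Complex.I_sq
    field_simp
    simp only [hI]
    ring

end

section

open Topology

theorem integral_mul_fejerKernel_eq {D : ℝ → ℝ} (hDm : Measurable D) {ε T : ℝ} (hT : 0 < T)
    (hD : IntegrableOn (fun t => D t * Real.exp (-(ε * t))) (Set.Ioi 0)) (u : ℝ) :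
    ((∫ t in Set.Ioi 0, D t * Real.exp (-(ε * t)) * fejerKernel T (u - t) : ℝ) : ℂ) =
      ∫ y in (-T)..T, ((1 - |y| / T : ℝ) : ℂ) * Complex.exp (Complex.I * y * u) *
        ∫ t in Set.Ioi 0, (D t : ℂ) * Complex.exp (-((ε + y * Complex.I : ℂ) * t)) := by
  rw [← integral_complex_ofReal]
  have hTT : -T ≤ T := by linarith
  have h1 : ∀ t : ℝ, ((D t * Real.exp (-(ε * t)) * fejerKernel T (u - t) : ℝ) : ℂ) =
      ∫ y in Set.Ioc (-T) T, ((D t * Real.exp (-(ε * t)) : ℝ) : ℂ) * (((1 - |y| / T : ℝ) : ℂ) *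
        Complex.exp (Complex.I * y * (u - t : ℝ))) := by
    intro t
    rw [integral_const_mul, ← intervalIntegral.integral_of_le hTT, integral_triangle_mul_exp hT]
    push_cast; ring
  simp_rw [h1]
  rw [integral_integral_swap, ← intervalIntegral.integral_of_le hTT]
  · refine intervalIntegral.integral_congr fun y _ => ?_
    rw [← integral_const_mul]
    refine integral_congr_ae (Eventually.of_forall fun t => ?_)
    simp only
    have : Complex.exp (Complex.I * y * (u - t : ℝ)) * ((Real.exp (-(ε * t)) : ℝ) : ℂ) =
        Complex.exp (Complex.I * y * u) * Complex.exp (-((ε + y * Complex.I : ℂ) * t)) := by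
      rw [Complex.ofReal_exp, ← Complex.exp_add, ← Complex.exp_add]
      congr 1
      push_cast
      ring
    push_cast at this ⊢
    linear_combination (D t : ℂ) * (1 - ((|y| : ℝ) : ℂ) / T) * this
  · have hb : Integrable (fun y : ℝ => (1 : ℂ)) (volume.restrict (Set.Ioc (-T) T)) := by
      simp
    have hp := (hD.ofReal (𝕜 := ℂ)).mul_prod hb
    have hc : Continuous fun p : ℝ × ℝ => ((1 - |p.2| / T : ℝ) : ℂ) *
        Complex.exp (Complex.I * p.2 * (u - p.1 : ℝ)) := by fun_prop
    refine Integrable.mono' (hp.norm) ?_ ?_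
    · refine AEStronglyMeasurable.mul ?_ hc.aestronglyMeasurable
      have : Measurable fun p : ℝ × ℝ => ((D p.1 * Real.exp (-(ε * p.1)) : ℝ) : ℂ) := by fun_prop
      exact this.aestronglyMeasurable
    · rw [Measure.prod_restrict]
      refine (ae_restrict_iff' (measurableSet_Ioi.prod measurableSet_Ioc)).mpr
        (Eventually.of_forall fun p hp => ?_)
      simp only [Function.uncurry, norm_mul, mul_one]
      have e1 : ‖Complex.exp (Complex.I * p.2 * (u - p.1 : ℝ))‖ = 1 := by
        have := Complex.norm_exp_ofReal_mul_I (p.2 * (u - p.1))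
        rw [← this]; congr 2; push_cast; ring
      have hp2 : |p.2| ≤ T := abs_le.mpr ⟨hp.2.1.le, hp.2.2⟩
      have e2 : ‖((1 - |p.2| / T : ℝ) : ℂ)‖ ≤ 1 := by
        rw [Complex.norm_real, Real.norm_eq_abs, abs_le]
        have : |p.2| / T ≤ 1 := (div_le_one hT).mpr hp2
        have : 0 ≤ |p.2| / T := by positivity
        constructor <;> linarith
      rw [e1, mul_one]
      simpa using mul_le_mul_of_nonneg_left e2 (norm_nonneg (((D p.1 * Real.exp (-(ε * p.1)) : ℝ) : ℂ)))

theorem tendsto_integral_exp_mul_cexp (T : ℝ) (h : ℝ → ℂ) :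
    Tendsto (fun u : ℝ => ∫ y in (-T)..T, h y * Complex.exp (Complex.I * y * u)) atTop (𝓝 0) := by
  rcases le_total T 0 with hT | hT
  all_goals
    have key : ∀ S : Set ℝ, MeasurableSet S →
        Tendsto (fun u : ℝ => ∫ y in S, h y * Complex.exp (Complex.I * y * u)) atTop (𝓝 0) := by
      intro S hS
      have := Real.tendsto_integral_exp_smul_cocompact (S.indicator h)
      have h2 : Tendsto (fun u : ℝ => -(2 * Real.pi)⁻¹ * u) atTop (cocompact ℝ) := by
        refine Tendsto.mono_right ?_ atBot_le_cocompact
        refine Tendsto.const_mul_atTop_of_neg ?_ tendsto_id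
        have := Real.pi_pos
        simpa using this
      refine (this.comp h2).congr fun u => ?_
      simp only [Function.comp]
      rw [← integral_indicator hS]
      refine integral_congr_ae (Eventually.of_forall fun y => ?_)
      simp only [Set.indicator_apply]
      split_ifs
      · rw [Circle.smul_def, Real.fourierChar_apply, smul_eq_mul, mul_comm]
        congr 2
        have := Real.pi_pos.ne'
        push_cast
        have : (Real.pi : ℂ) ≠ 0 := by exact_mod_cast this
        field_simp
      · simp
  · simp_rw [intervalIntegral.integral_of_ge (show T ≤ -T by linarith)]
    simpa using (key _ measurableSet_Ioc).neg
  · simp_rw [intervalIntegral.integral_of_le (show -T ≤ T by linarith)]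
    exact key _ measurableSet_Ioc

theorem tendsto_integral_mul_fejerKernel {W : ℝ → ℝ} (hWm : Measurable W) (hW0 : ∀ t, 0 ≤ W t)
    (hWi : ∀ ε : ℝ, 0 < ε → IntegrableOn (fun t => W t * Real.exp (-(ε * t))) (Set.Ioi 0))
    {H : ℂ → ℂ} (hH : ContinuousOn H {s | 0 ≤ s.re})
    (hlap : ∀ s : ℂ, 0 < s.re →
      ∫ t in Set.Ioi (0 : ℝ), (W t : ℂ) * Complex.exp (-(s * t)) = 1 / s + H s)
    {T : ℝ} (hT : 0 < T) :
    (∀ u, IntegrableOn (fun t => W t * fejerKernel T (u - t)) (Set.Ioi 0)) ∧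
      Tendsto (fun u => ∫ t in Set.Ioi 0, W t * fejerKernel T (u - t)) atTop
        (𝓝 (∫ v, fejerKernel 1 v)) := by
  have hTT : -T ≤ T := by linarith
  have hk0 : ∀ v, 0 ≤ fejerKernel T v := fejerKernel_nonneg hT.le
  have hkm : ∀ u, Measurable fun t => fejerKernel T (u - t) := fun u =>
    ((continuous_fejerKernel T).comp (continuous_const.sub continuous_id)).measurable
  have hki : ∀ u, Integrable fun t => fejerKernel T (u - t) := fun u =>
    (integrable_fejerKernel hT).comp_sub_left u
  have hei : ∀ ε : ℝ, 0 < ε → IntegrableOn (fun t => 1 * Real.exp (-(ε * t))) (Set.Ioi 0) := by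
    intro ε hε
    simpa using integrableOn_exp_mul_Ioi (neg_neg_of_pos hε) 0
  have he1 : ∀ ε : ℝ, 0 < ε → ∀ t ∈ Set.Ioi (0 : ℝ), Real.exp (-(ε * t)) ≤ 1 := by
    intro ε hε t ht
    rw [Real.exp_le_one_iff]
    have := mul_pos hε ht
    linarith
  have hbd : ∀ {D : ℝ → ℝ}, Measurable D →
      (∀ ε : ℝ, 0 < ε → IntegrableOn (fun t => D t * Real.exp (-(ε * t))) (Set.Ioi 0)) →
      ∀ ε : ℝ, 0 < ε → ∀ u, IntegrableOn (fun t => D t * Real.exp (-(ε * t)) * fejerKernel T (u - t))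
        (Set.Ioi 0) := by
    intro D hDm hDi ε hε u
    refine Integrable.mono' ((hDi ε hε).norm.const_mul T) ?_ (Eventually.of_forall fun t => ?_)
    · exact (hDi ε hε).aestronglyMeasurable.mul (hkm u).aestronglyMeasurable
    · rw [norm_mul, mul_comm, Real.norm_of_nonneg (hk0 _)]
      gcongr
      unfold fejerKernel
      have : Real.sinc (T * (u - t) / 2) ^ 2 ≤ 1 := by
        rw [sq_le_one_iff_abs_le_one]; exact Real.abs_sinc_le_one _
      nlinarith
  -- The error term and its limits.
  set R : ℝ → ℝ → ℂ := fun ε u => ∫ y in (-T)..T, ((1 - |y| / T : ℝ) : ℂ) *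
    Complex.exp (Complex.I * y * u) * H (ε + y * Complex.I) with hR
  have hHc : ∀ ε : ℝ, 0 ≤ ε → Continuous fun y : ℝ => H (ε + y * Complex.I) := by
    intro ε hε
    refine hH.comp_continuous (by fun_prop) fun y => ?_
    simpa using hε
  have hid : ∀ ε : ℝ, 0 < ε → ∀ u,
      ((∫ t in Set.Ioi 0, W t * Real.exp (-(ε * t)) * fejerKernel T (u - t) : ℝ) : ℂ) =
      ((∫ t in Set.Ioi 0, 1 * Real.exp (-(ε * t)) * fejerKernel T (u - t) : ℝ) : ℂ) + R ε u := by
    intro ε hε u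
    rw [← sub_eq_iff_eq_add', ← Complex.ofReal_sub, ← integral_sub (hbd hWm hWi ε hε u)
      (hbd measurable_const hei ε hε u)]
    have hsub : IntegrableOn (fun t => (W t - 1) * Real.exp (-(ε * t))) (Set.Ioi 0) := by
      refine ((hWi ε hε).sub (hei ε hε)).congr (Eventually.of_forall fun t => ?_)
      simp only [Pi.sub_apply]; ring
    have := integral_mul_fejerKernel_eq (D := fun t => W t - 1) (hWm.sub_const 1) hT hsub u
    simp_rw [← sub_mul]
    rw [this]
    refine intervalIntegral.integral_congr fun y _ => ?_
    congr 1
    have hs : 0 < (ε + y * Complex.I : ℂ).re := by simpa using hε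
    have hs0 : (ε + y * Complex.I : ℂ) ≠ 0 := fun h => by rw [h] at hs; simp at hs
    have i1 := integral_exp_mul_complex_Ioi (a := -(ε + y * Complex.I : ℂ)) (by simpa using hε) 0
    have i2 := hlap _ hs
    have hexp : ∀ t : ℝ, Complex.exp (-((ε + y * Complex.I : ℂ) * t)) =
        ((Real.exp (-(ε * t)) : ℝ) : ℂ) * Complex.exp (-(y * t * Complex.I)) := by
      intro t
      rw [Complex.ofReal_exp, ← Complex.exp_add]
      congr 1; push_cast; ring
    have hnorm : ∀ t : ℝ, ‖Complex.exp (-(y * t * Complex.I))‖ = 1 := by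
      intro t
      have := Complex.norm_exp_ofReal_mul_I (-(y * t))
      rw [← this]; congr 2; push_cast; ring
    have hcint : ∀ {D : ℝ → ℝ}, IntegrableOn (fun t => D t * Real.exp (-(ε * t))) (Set.Ioi 0) →
        IntegrableOn (fun t => (D t : ℂ) * Complex.exp (-((ε + y * Complex.I : ℂ) * t)))
          (Set.Ioi 0) := by
      intro D hD
      have hc : Continuous fun t : ℝ => Complex.exp (-(y * t * Complex.I)) := by fun_prop
      refine Integrable.mono' hD.norm ((hD.ofReal (𝕜 := ℂ)).aestronglyMeasurable.mul
        hc.aestronglyMeasurable |>.congr (Eventually.of_forall fun t => ?_))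
        (Eventually.of_forall fun t => ?_)
      · change ((D t * Real.exp (-(ε * t)) : ℝ) : ℂ) * Complex.exp (-(y * t * Complex.I)) =
          (D t : ℂ) * Complex.exp (-((ε + y * Complex.I : ℂ) * t))
        rw [hexp, Complex.ofReal_mul]; ring
      · rw [hexp, ← mul_assoc, norm_mul, hnorm, mul_one, norm_mul, norm_mul, Complex.norm_real,
          Complex.norm_real]
    have i3 : ∫ t in Set.Ioi (0 : ℝ), ((1 : ℝ) : ℂ) * Complex.exp (-((ε + y * Complex.I : ℂ) * t)) =
        1 / (ε + y * Complex.I : ℂ) := by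
      simp only [neg_mul, Complex.ofReal_zero, mul_zero, neg_zero, Complex.exp_zero] at i1
      simp only [Complex.ofReal_one, one_mul, i1]
      rw [neg_div_neg_eq]
    calc ∫ t in Set.Ioi (0 : ℝ), ((W t - 1 : ℝ) : ℂ) *
          Complex.exp (-((ε + y * Complex.I : ℂ) * t))
        = ∫ t in Set.Ioi (0 : ℝ), ((W t : ℂ) * Complex.exp (-((ε + y * Complex.I : ℂ) * t)) -
          ((1 : ℝ) : ℂ) * Complex.exp (-((ε + y * Complex.I : ℂ) * t))) := by
          refine integral_congr_ae (Eventually.of_forall fun t => ?_)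
          simp only; push_cast; ring
      _ = _ := by
          rw [integral_sub (hcint (hWi ε hε)) (hcint (hei ε hε)), i2, i3]
          ring
  have hR0 : ∀ u, Tendsto (fun n : ℕ => R (1 / ((n : ℝ) + 1)) u) atTop (𝓝 (R 0 u)) := by
    intro u
    have hcomp : IsCompact ((fun p : ℝ × ℝ => (p.1 + p.2 * Complex.I : ℂ)) ''
        (Set.Icc 0 1 ×ˢ Set.Icc (-T) T)) :=
      (isCompact_Icc.prod isCompact_Icc).image (by fun_prop)
    obtain ⟨M, hM⟩ := hcomp.exists_bound_of_continuousOn (f := H) (hH.mono (by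
      rintro _ ⟨p, hp, rfl⟩
      simpa using hp.1.1))
    refine intervalIntegral.tendsto_integral_filter_of_dominated_convergence (fun _ => M)
      (Eventually.of_forall fun n => ?_) (Eventually.of_forall fun n => Eventually.of_forall
        fun y hy => ?_) (by simp) (Eventually.of_forall fun y hy => ?_)
    · have := hHc (1 / ((n : ℝ) + 1)) (by positivity)
      have hc : Continuous fun y : ℝ => ((1 - |y| / T : ℝ) : ℂ) *
        Complex.exp (Complex.I * y * u) := by fun_prop
      exact (hc.mul this).aestronglyMeasurable
    · rw [Set.uIoc_of_le hTT] at hy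
      have hy2 : |y| ≤ T := abs_le.mpr ⟨hy.1.le, hy.2⟩
      have e1 : ‖Complex.exp (Complex.I * y * u)‖ = 1 := by
        have := Complex.norm_exp_ofReal_mul_I (y * u)
        rw [← this]; congr 2; push_cast; ring
      have e2 : ‖((1 - |y| / T : ℝ) : ℂ)‖ ≤ 1 := by
        rw [Complex.norm_real, Real.norm_eq_abs, abs_le]
        have : |y| / T ≤ 1 := (div_le_one hT).mpr hy2
        have : 0 ≤ |y| / T := by positivity
        constructor <;> linarith
      have e3 : ‖H ((1 / ((n : ℝ) + 1) : ℝ) + y * Complex.I)‖ ≤ M := by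
        refine hM _ ⟨(1 / ((n : ℝ) + 1), y), ⟨⟨by positivity, ?_⟩, ⟨hy.1.le, hy.2⟩⟩, rfl⟩
        rw [div_le_one (by positivity)]
        have : (0 : ℝ) ≤ n := by positivity
        linarith
      rw [norm_mul, norm_mul, e1, mul_one]
      calc _ ≤ 1 * M := by gcongr
        _ = M := one_mul M
    · refine Tendsto.const_mul _ ?_
      have h0 : ContinuousWithinAt H {s | 0 ≤ s.re} ((0 : ℝ) + y * Complex.I) :=
        hH _ (by simp)
      refine h0.tendsto.comp (tendsto_nhdsWithin_iff.mpr ⟨?_, Eventually.of_forall fun n => ?_⟩)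
      · refine Tendsto.add_const _ ?_
        exact (Complex.continuous_ofReal.tendsto 0).comp tendsto_one_div_add_atTop_nhds_zero_nat
      · have : (0 : ℝ) ≤ 1 / ((n : ℝ) + 1) := by positivity
        rw [Set.mem_setOf_eq, Complex.add_re, Complex.ofReal_re, Complex.re_ofReal_mul,
          Complex.I_re, mul_zero, add_zero]
        exact this
  have hRu : Tendsto (fun u => R 0 u) atTop (𝓝 0) := by
    refine (tendsto_integral_exp_mul_cexp T
      (fun y => ((1 - |y| / T : ℝ) : ℂ) * H ((0 : ℝ) + y * Complex.I))).congr fun u => ?_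
    refine intervalIntegral.integral_congr fun y _ => ?_
    ring
  -- Letting `ε` tend to zero.
  have hdom : ∀ {D : ℝ → ℝ}, Measurable D → (∀ t, 0 ≤ D t) → ∀ u,
      IntegrableOn (fun t => D t * fejerKernel T (u - t)) (Set.Ioi 0) →
      Tendsto (fun n : ℕ => ∫ t in Set.Ioi 0, D t * Real.exp (-((1 / ((n : ℝ) + 1)) * t)) *
        fejerKernel T (u - t)) atTop (𝓝 (∫ t in Set.Ioi 0, D t * fejerKernel T (u - t))) := by
    intro D hDm hD0 u hDi
    refine tendsto_integral_of_dominated_convergence _ (fun n => ?_) hDi (fun n => ?_) ?_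
    · have := hkm u
      exact Measurable.aestronglyMeasurable (by fun_prop)
    · refine (ae_restrict_iff' measurableSet_Ioi).mpr (Eventually.of_forall fun t ht => ?_)
      have h1 := he1 (1 / ((n : ℝ) + 1)) (by positivity) t ht
      rw [Real.norm_of_nonneg (mul_nonneg (mul_nonneg (hD0 t) (Real.exp_nonneg _)) (hk0 _))]
      exact mul_le_mul_of_nonneg_right (mul_le_of_le_one_right (hD0 t) h1) (hk0 _)
    · refine Eventually.of_forall fun t => ?_
      have : Tendsto (fun n : ℕ => Real.exp (-((1 / ((n : ℝ) + 1)) * t))) atTop (𝓝 1) := by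
        have h := (tendsto_one_div_add_atTop_nhds_zero_nat (𝕜 := ℝ)).mul_const t
        have := (Real.continuous_exp.tendsto _).comp h.neg
        simpa [Function.comp_def] using this
      simpa using (this.const_mul (D t)).mul_const (fejerKernel T (u - t))
  have h1lim : ∀ u, Tendsto (fun n : ℕ => ∫ t in Set.Ioi 0,
      1 * Real.exp (-((1 / ((n : ℝ) + 1)) * t)) * fejerKernel T (u - t)) atTop
        (𝓝 (∫ t in Set.Ioi 0, fejerKernel T (u - t))) := by
    intro u
    have := hdom (D := fun _ => 1) measurable_const (fun _ => zero_le_one) u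
      (by simpa using (hki u).integrableOn)
    simpa using this
  have hWlim : ∀ u, Tendsto (fun n : ℕ => ∫ t in Set.Ioi 0,
      W t * Real.exp (-((1 / ((n : ℝ) + 1)) * t)) * fejerKernel T (u - t)) atTop
        (𝓝 ((∫ t in Set.Ioi 0, fejerKernel T (u - t)) + (R 0 u).re)) := by
    intro u
    have h := (Complex.continuous_re.tendsto _).comp
      (((Complex.continuous_ofReal.tendsto _).comp (h1lim u)).add (hR0 u))
    simp only [Complex.add_re, Complex.ofReal_re] at h
    refine h.congr fun n => ?_
    have := congrArg Complex.re (hid (1 / ((n : ℝ) + 1)) (by positivity) u)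
    simp only [Complex.add_re, Complex.ofReal_re] at this
    simp only [Function.comp]
    exact this.symm
  have hWint : ∀ u, IntegrableOn (fun t => W t * fejerKernel T (u - t)) (Set.Ioi 0) := by
    intro u
    have hm : Measurable fun t => W t * fejerKernel T (u - t) := hWm.mul (hkm u)
    refine ⟨hm.aestronglyMeasurable, ?_⟩
    rw [hasFiniteIntegral_iff_ofReal (Eventually.of_forall fun t => mul_nonneg (hW0 t) (hk0 _))]
    have hfatou := lintegral_liminf_le (μ := volume.restrict (Set.Ioi (0 : ℝ))) (u := atTop)
      (f := fun (n : ℕ) t => ENNReal.ofReal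
        (W t * Real.exp (-((1 / ((n : ℝ) + 1)) * t)) * fejerKernel T (u - t))) (fun n => by
          have := hkm u
          fun_prop)
    have hl : ∀ t, liminf (fun n : ℕ => ENNReal.ofReal
        (W t * Real.exp (-((1 / ((n : ℝ) + 1)) * t)) * fejerKernel T (u - t))) atTop =
        ENNReal.ofReal (W t * fejerKernel T (u - t)) := by
      intro t
      refine Tendsto.liminf_eq (ENNReal.tendsto_ofReal ?_)
      have : Tendsto (fun n : ℕ => Real.exp (-((1 / ((n : ℝ) + 1)) * t))) atTop (𝓝 1) := by
        have h := (tendsto_one_div_add_atTop_nhds_zero_nat (𝕜 := ℝ)).mul_const t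
        have := (Real.continuous_exp.tendsto _).comp h.neg
        simpa [Function.comp_def] using this
      simpa using (this.const_mul (W t)).mul_const (fejerKernel T (u - t))
    simp_rw [hl] at hfatou
    refine hfatou.trans_lt ?_
    have : ∀ n : ℕ, ∫⁻ t in Set.Ioi 0, ENNReal.ofReal
        (W t * Real.exp (-((1 / ((n : ℝ) + 1)) * t)) * fejerKernel T (u - t)) =
        ENNReal.ofReal (∫ t in Set.Ioi 0,
          W t * Real.exp (-((1 / ((n : ℝ) + 1)) * t)) * fejerKernel T (u - t)) := by
      intro n
      rw [ofReal_integral_eq_lintegral_ofReal (hbd hWm hWi _ (by positivity) u)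
        (Eventually.of_forall fun t =>
          mul_nonneg (mul_nonneg (hW0 t) (Real.exp_nonneg _)) (hk0 _))]
    simp_rw [this]
    rw [(ENNReal.tendsto_ofReal (hWlim u)).liminf_eq]
    exact ENNReal.ofReal_lt_top
  refine ⟨hWint, ?_⟩
  have heq : ∀ u, ∫ t in Set.Ioi 0, W t * fejerKernel T (u - t) =
      (∫ t in Set.Ioi 0, fejerKernel T (u - t)) + (R 0 u).re := fun u =>
    tendsto_nhds_unique (hdom hWm hW0 u (hWint u)) (hWlim u)
  simp_rw [heq]
  have hmain : Tendsto (fun u : ℝ => ∫ t in Set.Ioi 0, fejerKernel T (u - t)) atTop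
      (𝓝 (∫ v, fejerKernel 1 v)) := by
    rw [← integral_fejerKernel hT]
    have h1 : ∀ u : ℝ, ∫ t in Set.Ioi 0, fejerKernel T (u - t) =
        ∫ v in Set.Iic u, fejerKernel T v := by
      intro u
      rw [integral_Iic_eq_integral_Iio, ← integral_indicator measurableSet_Ioi,
        ← integral_indicator measurableSet_Iio,
        ← integral_sub_left_eq_self (fun v => (Set.Iio u).indicator (fejerKernel T) v) volume u]
      refine integral_congr_ae (Eventually.of_forall fun t => ?_)
      simp [Set.indicator_apply]
    simp_rw [h1]
    have := (aecover_Iic (μ := volume) (tendsto_id (α := ℝ) (x := atTop))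
      ).integral_tendsto_of_countably_generated (integrable_fejerKernel hT)
    simpa using this
  simpa using hmain.add ((Complex.continuous_re.tendsto _).comp hRu)

end

section

open Topology

theorem tendsto_one_of_tendsto_integral_mul_fejerKernel {W : ℝ → ℝ}
    (hW0 : ∀ t, 0 ≤ W t)
    (hWd : ∀ u u' : ℝ, u ≤ u' → W u * Real.exp (-(u' - u)) ≤ W u')
    (hInt : ∀ T : ℝ, 0 < T → ∀ u, IntegrableOn (fun t => W t * fejerKernel T (u - t)) (Set.Ioi 0))
    (hlim : ∀ T : ℝ, 0 < T → Tendsto (fun u => ∫ t in Set.Ioi 0, W t * fejerKernel T (u - t)) atTop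
        (𝓝 (∫ v, fejerKernel 1 v))) :
    Tendsto W atTop (𝓝 1) := by
  set A := ∫ v, fejerKernel 1 v with hA
  have hApos : 0 < A := integral_fejerKernel_one_pos
  set c : ℝ → ℝ := fun x => ∫ v in Set.Icc (-x) x, fejerKernel 1 v with hc
  have hk0 : ∀ T : ℝ, 0 < T → ∀ v, 0 ≤ fejerKernel T v := fun T hT => fejerKernel_nonneg hT.le
  have hclim : Tendsto (fun n : ℕ => c n) atTop (𝓝 A) := by
    have h1 : Tendsto (fun n : ℕ => (n : ℝ)) atTop atTop := tendsto_natCast_atTop_atTop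
    exact (aecover_Icc (μ := volume) (tendsto_neg_atTop_atBot.comp h1) h1
      ).integral_tendsto_of_countably_generated integrable_fejerKernel_one
  have hki : ∀ T : ℝ, 0 < T → ∀ u, Integrable fun t => fejerKernel T (u - t) := fun T hT u =>
    (integrable_fejerKernel hT).comp_sub_left u
  -- the mass of the kernel near its centre
  have hmid : ∀ T δ x : ℝ, 0 < T → ∫ t in Set.Icc (x - δ) (x + δ), fejerKernel T (x - t) =
      c (T * δ) := by
    intro T δ x hT
    rw [hc]
    simp only
    rw [← integral_fejerKernel_Icc hT, ← integral_indicator measurableSet_Icc,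
      ← integral_indicator measurableSet_Icc,
      ← integral_sub_left_eq_self (fun v => (Set.Icc (-δ) δ).indicator (fejerKernel T) v) volume x]
    refine integral_congr_ae (Eventually.of_forall fun t => ?_)
    have : t ∈ Set.Icc (x - δ) (x + δ) ↔ x - t ∈ Set.Icc (-δ) δ := by
      simp only [Set.mem_Icc]; constructor <;> rintro ⟨h1, h2⟩ <;> constructor <;> linarith
    simp only [Set.indicator_apply, this]
  have hupper : ∀ T δ u : ℝ, 0 < T → 0 < δ → 0 < u →
      W u * Real.exp (-(2 * δ)) * c (T * δ) ≤
        ∫ t in Set.Ioi 0, W t * fejerKernel T (u + δ - t) := by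
    intro T δ u hT hδ hu
    rw [← hmid T δ (u + δ) hT, ← integral_const_mul]
    have hsub : Set.Icc (u + δ - δ) (u + δ + δ) ⊆ Set.Ioi 0 := fun t ht => by
      have := ht.1; simp only [Set.mem_Ioi]; linarith
    refine le_trans (setIntegral_mono_on ((hki T hT _).integrableOn.const_mul _)
      ((hInt T hT _).mono_set hsub) measurableSet_Icc fun t ht => ?_)
      (setIntegral_mono_set (hInt T hT _)
        (Eventually.of_forall fun t => mul_nonneg (hW0 t) (hk0 T hT _)) hsub.eventuallyLE)
    refine mul_le_mul_of_nonneg_right ?_ (hk0 T hT _)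
    refine le_trans (mul_le_mul_of_nonneg_left (Real.exp_le_exp.mpr ?_) (hW0 u))
      (hWd u t (by linarith [ht.1]))
    linarith [ht.2]
  have hshift : ∀ δ : ℝ, Tendsto (fun u : ℝ => u + δ) atTop atTop := fun δ =>
    tendsto_atTop_add_const_right _ _ tendsto_id
  have hub : ∀ q : ℝ, 1 < q → ∀ᶠ u in atTop, W u < q := by
    intro q hq
    have hlim2 : Tendsto (fun n : ℕ => q * Real.exp (-(2 * (1 / (n : ℝ)))) * c n) atTop
        (𝓝 (q * 1 * A)) := by
      refine (Tendsto.const_mul _ ?_).mul hclim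
      have h := (tendsto_one_div_atTop_nhds_zero_nat (𝕜 := ℝ)).const_mul 2
      have := (Real.continuous_exp.tendsto _).comp h.neg
      simpa [Function.comp_def] using this
    obtain ⟨n, hn, hn0, hcn⟩ := ((hlim2.eventually_const_lt (u := A) (by nlinarith)).and
      ((eventually_gt_atTop 0).and (hclim.eventually_const_lt hApos))).exists
    have hn0' : (0 : ℝ) < n := by exact_mod_cast hn0
    have hT : (0 : ℝ) < (n : ℝ) ^ 2 := by positivity
    have hδ : (0 : ℝ) < 1 / (n : ℝ) := by positivity
    have hTδ : (n : ℝ) ^ 2 * (1 / n) = n := by field_simp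
    filter_upwards [((hlim _ hT).comp (hshift (1 / n))).eventually_lt_const hn,
      eventually_gt_atTop 0] with u h1 hu
    have h2 := hupper _ _ u hT hδ hu
    rw [hTδ] at h2
    have h3 := h2.trans_lt h1
    have h4 : 0 < Real.exp (-(2 * (1 / (n : ℝ)))) * c n := mul_pos (Real.exp_pos _) hcn
    rw [mul_assoc, mul_assoc] at h3
    exact lt_of_mul_lt_mul_right h3 h4.le
  obtain ⟨M, hM0, hM⟩ : ∃ M : ℝ, 0 ≤ M ∧ ∀ t : ℝ, 0 < t → W t ≤ M := by
    obtain ⟨u0, hu0⟩ := eventually_atTop.mp (hub 2 (by norm_num))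
    refine ⟨max 2 (W (max u0 0) * Real.exp (max u0 0)), le_max_of_le_left (by norm_num),
      fun t ht => ?_⟩
    rcases le_total u0 t with h | h
    · exact le_max_of_le_left (hu0 t h).le
    · refine le_max_of_le_right ?_
      have h1 := hWd t (max u0 0) (le_max_of_le_left h)
      have h2 : W t = W t * Real.exp (-(max u0 0 - t)) * Real.exp (max u0 0 - t) := by
        rw [mul_assoc, ← Real.exp_add]; simp
      rw [h2]
      exact mul_le_mul h1 (Real.exp_le_exp.mpr (by linarith)) (Real.exp_nonneg _) (hW0 _)
  have hlower : ∀ T δ u : ℝ, 0 < T → 0 < δ → 2 * δ < u →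
      ∫ t in Set.Ioi 0, W t * fejerKernel T (u - δ - t) ≤
        W u * Real.exp (2 * δ) * c (T * δ) + M * (A - c (T * δ)) := by
    intro T δ u hT hδ hu
    set x := u - δ with hx
    set B := Set.Icc (x - δ) (x + δ) with hB
    have hsub : B ⊆ Set.Ioi 0 := fun t ht => by
      have := ht.1; simp only [Set.mem_Ioi]; linarith
    have htot : ∫ t, fejerKernel T (x - t) = A := by
      rw [integral_sub_left_eq_self (fejerKernel T) volume x, integral_fejerKernel hT]
    rw [← integral_inter_add_diff (s := Set.Ioi 0) (t := B) measurableSet_Icc (hInt T hT x),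
      Set.inter_eq_right.mpr hsub]
    refine add_le_add ?_ ?_
    · rw [← hmid T δ x hT, ← integral_const_mul]
      refine setIntegral_mono_on ((hInt T hT _).mono_set hsub)
        ((hki T hT _).integrableOn.const_mul _) measurableSet_Icc fun t ht => ?_
      refine mul_le_mul_of_nonneg_right ?_ (hk0 T hT _)
      have h1 := hWd t u (by linarith [ht.2])
      have h2 : W t = W t * Real.exp (-(u - t)) * Real.exp (u - t) := by
        rw [mul_assoc, ← Real.exp_add]; simp
      rw [h2]
      exact mul_le_mul h1 (Real.exp_le_exp.mpr (by linarith [ht.1])) (Real.exp_nonneg _) (hW0 _)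
    · have h1 : A - c (T * δ) = ∫ t in Bᶜ, fejerKernel T (x - t) := by
        rw [← hmid T δ x hT, ← htot, ← integral_add_compl measurableSet_Icc (hki T hT x),
          add_sub_cancel_left]
      rw [h1, ← integral_const_mul]
      refine le_trans (setIntegral_mono_on (g := fun t => M * fejerKernel T (x - t))
        ((hInt T hT _).mono_set Set.diff_subset)
        ((hki T hT _).integrableOn.const_mul _) (measurableSet_Ioi.diff measurableSet_Icc)
        fun t ht => ?_)
        (setIntegral_mono_set ((hki T hT _).integrableOn.const_mul _)
          (Eventually.of_forall fun t => mul_nonneg hM0 (hk0 T hT _))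
          (Set.diff_subset_compl _ _).eventuallyLE)
      exact mul_le_mul_of_nonneg_right (hM t ht.1) (hk0 T hT _)
  have hlb : ∀ q : ℝ, q < 1 → ∀ᶠ u in atTop, q < W u := by
    intro q hq
    have hlim2 : Tendsto (fun n : ℕ => q * Real.exp (2 * (1 / (n : ℝ))) * c n + M * (A - c n)) atTop
        (𝓝 (q * 1 * A + M * (A - A))) := by
      refine ((Tendsto.const_mul _ ?_).mul hclim).add ((hclim.const_sub A).const_mul M)
      have h := (tendsto_one_div_atTop_nhds_zero_nat (𝕜 := ℝ)).const_mul 2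
      have := (Real.continuous_exp.tendsto _).comp h
      simpa [Function.comp_def] using this
    obtain ⟨n, hn, hn0, hcn⟩ := ((hlim2.eventually_lt_const (u := A) (by nlinarith)).and
      ((eventually_gt_atTop 0).and (hclim.eventually_const_lt hApos))).exists
    have hn0' : (0 : ℝ) < n := by exact_mod_cast hn0
    have hT : (0 : ℝ) < (n : ℝ) ^ 2 := by positivity
    have hδ : (0 : ℝ) < 1 / (n : ℝ) := by positivity
    have hTδ : (n : ℝ) ^ 2 * (1 / n) = n := by field_simp
    filter_upwards [((hlim _ hT).comp (hshift (-(1 / n)))).eventually_const_lt hn,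
      eventually_gt_atTop (2 * (1 / (n : ℝ)))] with u h1 hu
    have h2 := hlower _ _ u hT hδ hu
    rw [hTδ] at h2
    simp only [Function.comp, ← sub_eq_add_neg] at h1
    have h3 := h1.trans_le h2
    have h4 : 0 < Real.exp (2 * (1 / (n : ℝ))) * c n := mul_pos (Real.exp_pos _) hcn
    rw [add_lt_add_iff_right, mul_assoc, mul_assoc] at h3
    exact lt_of_mul_lt_mul_right h3 h4.le
  rw [tendsto_order]
  exact ⟨hlb, hub⟩

theorem tendsto_sum_le_div_of_dirichletSeries {ι : Type*} [Countable ι] {a N : ι → ℝ}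
    (ha : ∀ i, 0 ≤ a i) (hN : ∀ i, 1 ≤ N i)
    (hs : ∀ σ : ℝ, 1 < σ → Summable fun i => a i * N i ^ (-σ))
    {G : ℂ → ℂ} (hG : ContinuousOn G {s | 1 ≤ s.re})
    (hGs : ∀ s : ℂ, 1 < s.re → ∑' i, (a i : ℂ) * (N i : ℂ) ^ (-s) = 1 / (s - 1) + G s) :
    Tendsto (fun X : ℝ => (∑' i, if N i ≤ X then a i else 0) / X) atTop (𝓝 1) := by
  have hN0 : ∀ i, 0 < N i := fun i => zero_lt_one.trans_le (hN i)
  have hle : ∀ σ : ℝ, 1 < σ → ∀ X : ℝ, 0 < X → ∀ i,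
      (if N i ≤ X then a i else 0) ≤ a i * N i ^ (-σ) * X ^ σ := by
    intro σ hσ X hX i
    split_ifs with h
    · rw [mul_assoc, Real.rpow_neg (hN0 i).le]
      refine le_mul_of_one_le_right (ha i) ?_
      rw [← div_eq_inv_mul, one_le_div (Real.rpow_pos_of_pos (hN0 i) _)]
      exact Real.rpow_le_rpow (hN0 i).le h (by linarith)
    · exact mul_nonneg (mul_nonneg (ha i) (Real.rpow_nonneg (hN0 i).le _))
        (Real.rpow_nonneg hX.le _)
  have hnn : ∀ X : ℝ, ∀ i, 0 ≤ (if N i ≤ X then a i else 0) := by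
    intro X i; split_ifs; exacts [ha i, le_rfl]
  have hsum : ∀ X : ℝ, 0 < X → Summable fun i => if N i ≤ X then a i else 0 := fun X hX =>
    Summable.of_nonneg_of_le (hnn X) (hle 2 (by norm_num) X hX)
      ((hs 2 (by norm_num)).mul_right _)
  set S : ℝ → ℝ := fun X => ∑' i, if N i ≤ X then a i else 0 with hS
  have hSmono : ∀ X Y : ℝ, 0 < X → X ≤ Y → S X ≤ S Y := by
    intro X Y hX hXY
    refine (hsum X hX).tsum_le_tsum (fun i => ?_) (hsum Y (hX.trans_le hXY))
    by_cases h : N i ≤ X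
    · rw [if_pos h, if_pos (h.trans hXY)]
    · rw [if_neg h]; exact hnn Y i
  have hS0 : ∀ X, 0 ≤ S X := fun X => tsum_nonneg (hnn X)
  set W : ℝ → ℝ := fun t => S (Real.exp t) * Real.exp (-t) with hW
  have hWm : Measurable W := by
    have : Monotone fun t => S (Real.exp t) := fun x y hxy =>
      hSmono _ _ (Real.exp_pos _) (Real.exp_le_exp.mpr hxy)
    exact this.measurable.mul (by fun_prop)
  have hW0 : ∀ t, 0 ≤ W t := fun t => mul_nonneg (hS0 _) (Real.exp_nonneg _)
  have hWd : ∀ u u' : ℝ, u ≤ u' → W u * Real.exp (-(u' - u)) ≤ W u' := by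
    intro u u' h
    rw [hW]
    simp only
    rw [mul_assoc, ← Real.exp_add, show -u + -(u' - u) = -u' by ring]
    exact mul_le_mul_of_nonneg_right
      (hSmono _ _ (Real.exp_pos _) (Real.exp_le_exp.mpr h)) (Real.exp_nonneg _)
  have hWi : ∀ ε : ℝ, 0 < ε →
      IntegrableOn (fun t => W t * Real.exp (-(ε * t))) (Set.Ioi 0) := by
    intro ε hε
    set σ := 1 + ε / 2 with hσ
    have hσ1 : 1 < σ := by linarith
    refine Integrable.mono' (g := fun t => (∑' i, a i * N i ^ (-σ)) * Real.exp (-(ε / 2) * t))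
      ((integrableOn_exp_mul_Ioi (by linarith) 0).const_mul _)
      (hWm.mul (by fun_prop)).aestronglyMeasurable (Eventually.of_forall fun t => ?_)
    rw [Real.norm_of_nonneg (mul_nonneg (hW0 t) (Real.exp_nonneg _))]
    have h1 : S (Real.exp t) ≤ (∑' i, a i * N i ^ (-σ)) * Real.exp t ^ σ := by
      rw [← tsum_mul_right]
      exact (hsum _ (Real.exp_pos t)).tsum_le_tsum (hle σ hσ1 _ (Real.exp_pos t))
        ((hs σ hσ1).mul_right _)
    calc W t * Real.exp (-(ε * t))
        ≤ (∑' i, a i * N i ^ (-σ)) * Real.exp t ^ σ * Real.exp (-t) * Real.exp (-(ε * t)) := by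
          rw [hW]; simp only; gcongr
      _ = _ := by
          rw [← Real.exp_mul, mul_assoc, mul_assoc, ← Real.exp_add, ← Real.exp_add]
          congr 2; rw [hσ]; ring
  have hlap : ∀ s : ℂ, 0 < s.re → ∫ t in Set.Ioi (0 : ℝ), (W t : ℂ) * Complex.exp (-(s * t)) =
      1 / s + (G (1 + s) - 1) / (1 + s) := by
    intro s hsr
    have hs1 : (1 + s) ≠ 0 := fun h => by
      have := congrArg Complex.re h; simp at this; linarith
    have hs0 : s ≠ 0 := fun h => by rw [h] at hsr; simp at hsr
    have hre : (-(1 + s)).re < 0 := by simp; linarith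
    set f : ι → ℝ → ℂ := fun i t =>
      (Set.Ioi (Real.log (N i))).indicator (fun t : ℝ => (a i : ℂ) * Complex.exp (-(1 + s) * t)) t
      with hf
    have hlog : ∀ i, 0 ≤ Real.log (N i) := fun i => Real.log_nonneg (hN i)
    have hinter : ∀ i, Set.Ioi (0 : ℝ) ∩ Set.Ioi (Real.log (N i)) = Set.Ioi (Real.log (N i)) :=
      fun i => Set.inter_eq_right.mpr (Set.Ioi_subset_Ioi (hlog i))
    have hfi : ∀ i, IntegrableOn (f i) (Set.Ioi 0) := fun i => by
      refine Integrable.integrableOn ?_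
      exact (integrable_indicator_iff measurableSet_Ioi).mpr
        ((integrableOn_exp_mul_complex_Ioi hre _).const_mul _)
    have hfint : ∀ i, ∫ t in Set.Ioi (0 : ℝ), f i t =
        (a i : ℂ) * (N i : ℂ) ^ (-(1 + s)) / (1 + s) := by
      intro i
      rw [hf]
      simp only
      rw [setIntegral_indicator measurableSet_Ioi, hinter, integral_const_mul,
        integral_exp_mul_complex_Ioi hre, Complex.cpow_def_of_ne_zero
          (by exact_mod_cast (hN0 i).ne'), Complex.ofReal_log (hN0 i).le, neg_div_neg_eq,
        mul_comm (-(1 + s)), mul_div_assoc]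
    have hfnorm : ∀ i, ∫ t in Set.Ioi (0 : ℝ), ‖f i t‖ =
        a i * N i ^ (-(1 + s.re)) / (1 + s.re) := by
      intro i
      have : ∀ t, ‖f i t‖ = (Set.Ioi (Real.log (N i))).indicator
          (fun t : ℝ => a i * Real.exp (-(1 + s.re) * t)) t := by
        intro t
        rw [hf]
        simp only
        rw [norm_indicator_eq_indicator_norm]
        congr 1
        ext t
        rw [norm_mul, Complex.norm_real, Real.norm_of_nonneg (ha i), Complex.norm_exp]
        simp
      simp_rw [this]
      rw [setIntegral_indicator measurableSet_Ioi, hinter, integral_const_mul,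
        integral_exp_mul_Ioi (by linarith), neg_div_neg_eq, Real.rpow_def_of_pos (hN0 i),
        mul_comm (-(1 + s.re)), mul_div_assoc]
    have hsumm : Summable fun i => ∫ t in Set.Ioi (0 : ℝ), ‖f i t‖ := by
      simp_rw [hfnorm]
      exact (hs _ (by linarith)).div_const _
    have key := hasSum_integral_of_summable_integral_norm hfi hsumm
    simp_rw [hfint] at key
    have h1 : ∫ t in Set.Ioi (0 : ℝ), ∑' i, f i t =
        ∫ t in Set.Ioi (0 : ℝ), (W t : ℂ) * Complex.exp (-(s * t)) := by
      have hcount : ∀ᵐ t : ℝ, t ∉ Set.range fun i => Real.log (N i) :=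
        (Set.countable_range _).ae_notMem _
      refine integral_congr_ae (ae_restrict_of_ae (hcount.mono fun t ht => ?_))
      simp only
      rw [hW, hS]
      simp only
      rw [Complex.ofReal_mul, Complex.ofReal_tsum, mul_assoc, ← tsum_mul_right]
      refine tsum_congr fun i => ?_
      rw [hf]
      simp only [Set.indicator_apply, Set.mem_Ioi]
      have hne : Real.log (N i) ≠ t := fun h => ht ⟨i, h⟩
      have hiff : N i ≤ Real.exp t ↔ Real.log (N i) < t := by
        rw [← Real.log_le_iff_le_exp (hN0 i)]
        exact ⟨fun h => lt_of_le_of_ne h hne, le_of_lt⟩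
      simp only [hiff]
      split_ifs
      · rw [Complex.ofReal_exp, ← Complex.exp_add]
        congr 2; push_cast; ring
      · simp
    rw [← h1, ← key.tsum_eq, tsum_div_const, hGs (1 + s) (by simp; linarith)]
    rw [add_sub_cancel_left]
    field_simp
    ring
  have hH : ContinuousOn (fun s : ℂ => (G (1 + s) - 1) / (1 + s)) {s | 0 ≤ s.re} := by
    have hm : Set.MapsTo (fun s : ℂ => 1 + s) {s | 0 ≤ s.re} {s | 1 ≤ s.re} := fun s hs => by
      simp only [Set.mem_setOf_eq, Complex.add_re, Complex.one_re] at hs ⊢; linarith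
    have h1 : ContinuousOn (fun s : ℂ => 1 + s) {s | 0 ≤ s.re} := by fun_prop
    refine ((hG.comp h1 hm).sub continuousOn_const).div h1 fun s hs h => ?_
    have := hm hs
    simp only [Set.mem_setOf_eq] at this
    rw [h] at this; simp at this; linarith
  have hWlim := tendsto_one_of_tendsto_integral_mul_fejerKernel hW0 hWd
    (fun T hT => (tendsto_integral_mul_fejerKernel hWm hW0 hWi hH hlap hT).1)
    (fun T hT => (tendsto_integral_mul_fejerKernel hWm hW0 hWi hH hlap hT).2)
  refine (hWlim.comp Real.tendsto_log_atTop).congr' ?_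
  filter_upwards [eventually_gt_atTop 0] with X hX
  simp only [Function.comp, hW]
  rw [Real.exp_neg, Real.exp_log hX, div_eq_mul_inv]

end

section

open Topology

section Lattice

variable {E ι : Type*} [NormedAddCommGroup E] [NormedSpace ℝ E] [FiniteDimensional ℝ E]
  [MeasurableSpace E] [BorelSpace E] [Fintype ι] (μ : Measure E) [μ.IsAddHaarMeasure]
  (b : Module.Basis ι ℝ E)

theorem finite_span_int_mem {s : Set E} (hs : Bornology.IsBounded s) :
    {l : Submodule.span ℤ (Set.range b) | (l : E) ∈ s}.Finite := by
  have : ProperSpace E := FiniteDimensional.proper ℝ E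
  refine ((ZSpan.setFinite_inter b hs).preimage (f := fun l : Submodule.span ℤ (Set.range b) =>
    (l : E)) Subtype.val_injective.injOn).subset fun l hl => ⟨hl, l.2⟩

theorem finite_span_int_smul_add_mem {R r x : ℝ} (hx : 0 < x) :
    {l : Submodule.span ℤ (Set.range b) | ∃ z : E, ‖z‖ ≤ r ∧ ‖x • (z + l)‖ ≤ R}.Finite := by
  refine (finite_span_int_mem b (s := Metric.closedBall 0 (R / x + r))
    Metric.isBounded_closedBall).subset ?_
  rintro l ⟨z, hz, hl⟩

  rw [_root_.norm_smul, Real.norm_of_nonneg hx.le, mul_comm, ← le_div_iff₀ hx] at hl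
  simp only [Set.mem_setOf_eq, mem_closedBall_zero_iff]
  calc ‖(l : E)‖ = ‖(z + l) - z‖ := by simp
    _ ≤ ‖z + l‖ + ‖z‖ := norm_sub_le _ _
    _ ≤ _ := by linarith

/-- The deviation of a lattice sum of a scaled function from its expected value. -/
noncomputable def latticeError (f : E → ℂ) (x : ℝ) (z : E) : ℂ :=
  (x : ℂ) ^ Module.finrank ℝ E * (∑' l : Submodule.span ℤ (Set.range b), f (x • (z + l))) -
    (∫ v, f v ∂μ) / (μ.real (ZSpan.fundamentalDomain b) : ℂ)

theorem exists_norm_latticeSum_le (μ : Measure E) [μ.IsAddHaarMeasure] {f : E → ℂ} (hf : Continuous f) (hfc : HasCompactSupport f) :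
    ∃ C : ℝ, ∀ x : ℝ, 0 < x → x ≤ 1 → ∀ z : E, ‖(x : ℂ) ^ Module.finrank ℝ E *
      ∑' l : Submodule.span ℤ (Set.range b), f (x • (z + l))‖ ≤ C := by
  obtain ⟨M, hM⟩ := hf.bounded_above_of_compact_support hfc
  obtain ⟨R, hR⟩ := hfc.isCompact.isBounded.subset_closedBall (0 : E)
  obtain ⟨r, hr⟩ := (ZSpan.fundamentalDomain_isBounded b).subset_closedBall (0 : E)
  have hinv : VAddInvariantMeasure (Submodule.span ℤ (Set.range b)) E μ :=
    inferInstanceAs <| VAddInvariantMeasure (Submodule.span ℤ (Set.range b)).toAddSubgroup E μ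
  set D := ZSpan.fundamentalDomain b with hD
  have hD0 : 0 < μ.real D := by
    refine ENNReal.toReal_pos (ZSpan.measure_fundamentalDomain_ne_zero b) ?_
    exact ((ZSpan.fundamentalDomain_isBounded b).measure_lt_top).ne
  have hDtop : μ D ≠ ⊤ := ((ZSpan.fundamentalDomain_isBounded b).measure_lt_top).ne
  have : ProperSpace E := FiniteDimensional.proper ℝ E
  have hBtop : μ (Metric.closedBall 0 (R + r)) ≠ ⊤ := measure_closedBall_lt_top.ne
  have hM0 : 0 ≤ M := (norm_nonneg _).trans (hM 0)
  refine ⟨M * (μ.real (Metric.closedBall 0 (R + r)) / μ.real D), fun x hx hx1 z => ?_⟩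
  have hfin : {l : Submodule.span ℤ (Set.range b) | ‖x • (z + (l : E))‖ ≤ R}.Finite :=
    (finite_span_int_smul_add_mem b (R := R) (r := ‖z‖) hx).subset fun l hl => ⟨z, le_rfl, hl⟩
  set S := hfin.toFinset with hS
  have hsum : ∑' l : Submodule.span ℤ (Set.range b), f (x • (z + l)) =
      ∑ l ∈ S, f (x • (z + l)) := by
    refine tsum_eq_sum fun l hl => image_eq_zero_of_notMem_tsupport fun h => hl ?_
    simpa [hS] using hR h
  have hcount : x ^ Module.finrank ℝ E * (S.card * μ.real D) ≤
      μ.real (Metric.closedBall 0 (R + r)) := by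
    have h1 : ∑ l ∈ S, μ D ≤ ∫⁻ y, (Metric.closedBall (0 : E) (R + r)).indicator 1
        (x • (z + y)) ∂μ := by
      rw [(ZSpan.isAddFundamentalDomain b μ).lintegral_eq_tsum'']
      refine le_trans (Finset.sum_le_sum fun l hl => ?_) (ENNReal.sum_le_tsum S)
      rw [← setLIntegral_one]
      refine setLIntegral_mono' (ZSpan.fundamentalDomain_measurableSet b) fun d hd => ?_
      rw [Set.indicator_of_mem]
      · rfl
      · have hl' : ‖x • (z + (l : E))‖ ≤ R := by simpa [hS] using hl
        have hd' : ‖d‖ ≤ r := by simpa using hr hd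
        rw [mem_closedBall_zero_iff]
        have : x • (z + (l +ᵥ d)) = x • (z + (l : E)) + x • d := by
          rw [← smul_add, add_assoc]; rfl
        rw [this]
        refine (norm_add_le _ _).trans (add_le_add hl' ?_)
        rw [_root_.norm_smul, Real.norm_of_nonneg hx.le]
        exact (mul_le_of_le_one_left (norm_nonneg _) hx1).trans hd'
    have h2 : ∫⁻ y, (Metric.closedBall (0 : E) (R + r)).indicator 1 (x • (z + y)) ∂μ =
        ENNReal.ofReal ((x ^ Module.finrank ℝ E)⁻¹) * μ (Metric.closedBall 0 (R + r)) := by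
      rw [lintegral_add_left_eq_self (μ := μ)
        (fun y => (Metric.closedBall (0 : E) (R + r)).indicator 1 (x • y)) z]
      have : ∀ y, (Metric.closedBall (0 : E) (R + r)).indicator (1 : E → ℝ≥0∞) (x • y) =
          ((fun y => x • y) ⁻¹' (Metric.closedBall (0 : E) (R + r))).indicator 1 y := by
        intro y; simp [Set.indicator_apply]
      simp_rw [this]
      rw [lintegral_indicator_one, Measure.addHaar_preimage_smul _ hx.ne', abs_of_pos (by positivity)]
      exact measurableSet_closedBall.preimage (measurable_const_smul x)
    rw [h2, Finset.sum_const] at h1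
    have h3 := ENNReal.toReal_mono (ENNReal.mul_ne_top ENNReal.ofReal_ne_top hBtop) h1
    rw [ENNReal.toReal_mul, ENNReal.toReal_ofReal (by positivity), nsmul_eq_mul,
      ENNReal.toReal_mul, ENNReal.toReal_natCast, ← div_eq_inv_mul, le_div_iff₀ (by positivity),
      mul_comm] at h3
    exact h3
  rw [hsum, norm_mul, norm_pow, Complex.norm_real, Real.norm_of_nonneg hx.le]
  calc x ^ Module.finrank ℝ E * ‖∑ l ∈ S, f (x • (z + l))‖
      ≤ x ^ Module.finrank ℝ E * (S.card * M) := by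
        gcongr
        refine (norm_sum_le _ _).trans ((Finset.sum_le_sum fun l _ => hM _).trans ?_)
        simp
    _ = M * ((x ^ Module.finrank ℝ E * (S.card * μ.real D)) / μ.real D) := by
        field_simp
    _ ≤ _ := by gcongr

theorem integral_latticeError {f : E → ℂ} (hf : Continuous f) (hfc : HasCompactSupport f)
    {x : ℝ} (hx : 0 < x) :
    ∫ z in ZSpan.fundamentalDomain b, latticeError μ b f x z ∂μ = 0 ∧
      IntegrableOn (latticeError μ b f x) (ZSpan.fundamentalDomain b) μ ∧
      Continuous (latticeError μ b f x) := by
  obtain ⟨R, hR⟩ := hfc.isCompact.isBounded.subset_closedBall (0 : E)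
  obtain ⟨r, hr⟩ := (ZSpan.fundamentalDomain_isBounded b).subset_closedBall (0 : E)
  have hinv : VAddInvariantMeasure (Submodule.span ℤ (Set.range b)) E μ :=
    inferInstanceAs <| VAddInvariantMeasure (Submodule.span ℤ (Set.range b)).toAddSubgroup E μ
  set D := ZSpan.fundamentalDomain b with hD
  have hDtop : μ D ≠ ⊤ := ((ZSpan.fundamentalDomain_isBounded b).measure_lt_top).ne
  have hD0 : 0 < μ.real D :=
    ENNReal.toReal_pos (ZSpan.measure_fundamentalDomain_ne_zero b) hDtop
  have : ProperSpace E := FiniteDimensional.proper ℝ E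
  have hcont : Continuous (latticeError μ b f x) := by
    rw [continuous_iff_continuousAt]
    intro z0
    set S := (finite_span_int_smul_add_mem b (R := R) (r := ‖z0‖ + 1) hx).toFinset with hS
    have : latticeError μ b f x =ᶠ[𝓝 z0] fun z => (x : ℂ) ^ Module.finrank ℝ E *
        (∑ l ∈ S, f (x • (z + l))) - (∫ v, f v ∂μ) / (μ.real D : ℂ) := by
      filter_upwards [Metric.ball_mem_nhds z0 one_pos] with z hz
      unfold latticeError
      congr 2
      refine tsum_eq_sum fun l hl => image_eq_zero_of_notMem_tsupport fun h => hl ?_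
      simp only [hS, Set.Finite.mem_toFinset, Set.mem_setOf_eq]
      refine ⟨z, ?_, by simpa using hR h⟩
      have := norm_sub_norm_le z z0
      rw [mem_ball_iff_norm] at hz
      linarith
    refine ContinuousAt.congr ?_ this.symm
    refine Continuous.continuousAt ?_
    fun_prop
  have hInt : IntegrableOn (latticeError μ b f x) D μ :=
    (hcont.continuousOn.integrableOn_compact (isCompact_closedBall 0 r)).mono_set hr
  refine ⟨?_, hInt, hcont⟩
  set S := (finite_span_int_smul_add_mem b (R := R) (r := r) hx).toFinset with hS
  have hzero : ∀ l ∉ S, ∀ z ∈ D, f (x • (z + (l : E))) = 0 := by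
    intro l hl z hz
    refine image_eq_zero_of_notMem_tsupport fun h => hl ?_
    simp only [hS, Set.Finite.mem_toFinset, Set.mem_setOf_eq]
    exact ⟨z, by simpa using hr hz, by simpa using hR h⟩
  have hmain : ∫ z in D, (∑' l : Submodule.span ℤ (Set.range b), f (x • (z + l))) ∂μ =
      ((x : ℂ) ^ Module.finrank ℝ E)⁻¹ * ∫ v, f v ∂μ := by
    have h1 : ∫ z in D, (∑' l : Submodule.span ℤ (Set.range b), f (x • (z + l))) ∂μ =
        ∫ z in D, (∑ l ∈ S, f (x • (z + l))) ∂μ :=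
      setIntegral_congr_fun (ZSpan.fundamentalDomain_measurableSet b) fun z hz =>
        tsum_eq_sum fun l hl => hzero l hl z hz
    rw [h1, integral_finset_sum]
    · have h2 : ∫ v, f (x • v) ∂μ = ∑' l : Submodule.span ℤ (Set.range b),
          ∫ z in D, f (x • (l +ᵥ z)) ∂μ := by
        refine (ZSpan.isAddFundamentalDomain b μ).integral_eq_tsum'' _ ?_
        exact (integrable_comp_smul_iff μ f hx.ne').mpr (hf.integrable_of_hasCompactSupport hfc)
      rw [Measure.integral_comp_smul_of_nonneg μ f x (hR := hx.le)] at h2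
      rw [Complex.real_smul] at h2
      push_cast at h2
      rw [h2, tsum_eq_sum (s := S)]
      · refine Finset.sum_congr rfl fun l _ => ?_
        refine integral_congr_ae (Eventually.of_forall fun z => ?_)
        change f (x • (z + (l : E))) = f (x • ((l : E) + z))
        rw [add_comm]
      · intro l hl
        refine setIntegral_eq_zero_of_forall_eq_zero fun z hz => ?_
        change f (x • ((l : E) + z)) = 0
        rw [add_comm]
        exact hzero l hl z hz
    · intro l _
      exact (show Continuous fun z => f (x • (z + (l : E))) by fun_prop
        ).continuousOn.integrableOn_compact (isCompact_closedBall 0 r) |>.mono_set hr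
  have hx0 : (x : ℂ) ^ Module.finrank ℝ E ≠ 0 := pow_ne_zero _ (by exact_mod_cast hx.ne')
  have hD0' : (μ.real D : ℂ) ≠ 0 := by exact_mod_cast hD0.ne'
  have hconst : IntegrableOn (fun _ : E => (∫ v, f v ∂μ) / (μ.real D : ℂ)) D μ :=
    integrableOn_const hDtop
  have hint2 : IntegrableOn (fun z => (x : ℂ) ^ Module.finrank ℝ E *
      (∑' l : Submodule.span ℤ (Set.range b), f (x • (z + l)))) D μ := by
    refine (hInt.add hconst).congr (Eventually.of_forall fun z => ?_)
    simp [latticeError, hD]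
  unfold latticeError
  rw [integral_sub hint2 hconst, integral_const_mul, hmain, mul_inv_cancel_left₀ hx0,
    setIntegral_const, Complex.real_smul, mul_div_cancel₀ _ hD0', sub_self]

theorem integral_fderiv_apply_eq_zero [FiniteDimensional ℝ E] {f : E → ℂ} (hf : ContDiff ℝ (⊤ : ℕ∞) f)
    (hfc : HasCompactSupport f) (v : E) : ∫ y, fderiv ℝ f y v ∂μ = 0 := by
  have hd : Continuous fun y => fderiv ℝ f y v :=
    (hf.continuous_fderiv (by simp)).clm_apply continuous_const
  have hdc : HasCompactSupport fun y => fderiv ℝ f y v :=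
    hfc.fderiv_apply ℝ v
  have := integral_mul_fderiv_eq_neg_fderiv_mul_of_integrable (μ := μ) (f := fun _ : E => (1 : ℂ))
    (g := f) (v := v) (by simp)
    (by simpa using hd.integrable_of_hasCompactSupport hdc)
    (by simpa using hf.continuous.integrable_of_hasCompactSupport hfc)
    (fun x _ => by fun_prop) (fun x _ => hf.differentiable (by simp) x)
  simpa using this

theorem exists_norm_latticeError_le (m : ℕ) : ∀ {f : E → ℂ}, ContDiff ℝ (⊤ : ℕ∞) f → HasCompactSupport f →
    ∃ C : ℝ, ∀ x : ℝ, 0 < x → x ≤ 1 → ∀ z : E, ‖latticeError μ b f x z‖ ≤ C * x ^ m := by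
  induction m with
  | zero =>
    intro f hf hfc
    obtain ⟨C, hC⟩ := exists_norm_latticeSum_le b μ hf.continuous hfc
    refine ⟨C + ‖(∫ v, f v ∂μ) / (μ.real (ZSpan.fundamentalDomain b) : ℂ)‖, fun x hx hx1 z => ?_⟩
    rw [pow_zero, mul_one]
    exact (norm_sub_le _ _).trans (by linarith [hC x hx hx1 z])
  | succ m ih =>
    intro f hf hfc
    have hdf : ∀ i, ContDiff ℝ (⊤ : ℕ∞) fun y => fderiv ℝ f y (b i) := fun i =>
      (hf.fderiv_right (by simp)).clm_apply contDiff_const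
    have hdc : ∀ i, HasCompactSupport fun y => fderiv ℝ f y (b i) := fun i =>
      hfc.fderiv_apply ℝ (b i)
    choose C hC using fun i => ih (hdf i) (hdc i)
    obtain ⟨B, hB0, hB⟩ := b.exists_opNorm_le (F := ℂ)
    obtain ⟨R, hR⟩ := hfc.isCompact.isBounded.subset_closedBall (0 : E)
    obtain ⟨r, hr⟩ := (ZSpan.fundamentalDomain_isBounded b).subset_closedBall (0 : E)
    set D := ZSpan.fundamentalDomain b with hD
    have hDtop : μ D ≠ ⊤ := ((ZSpan.fundamentalDomain_isBounded b).measure_lt_top).ne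
    have hD0 : 0 < μ.real D :=
      ENNReal.toReal_pos (ZSpan.measure_fundamentalDomain_ne_zero b) hDtop
    refine ⟨B * (∑ i, |C i|) * (2 * r), fun x hx hx1 => ?_⟩
    -- derivative bound
    have hderiv : ∀ z0 : E, ∃ L : E →L[ℝ] ℂ, HasFDerivAt (latticeError μ b f x) L z0 ∧
        ‖L‖ ≤ B * ((∑ i, |C i|) * x ^ (m + 1)) := by
      intro z0
      set S := (finite_span_int_smul_add_mem b (R := R) (r := ‖z0‖ + 1) hx).toFinset with hS
      have hnot : ∀ l ∉ S, ∀ z ∈ Metric.ball z0 1, x • (z + (l : E)) ∉ tsupport f := by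
        intro l hl z hz h
        refine hl ?_
        simp only [hS, Set.Finite.mem_toFinset, Set.mem_setOf_eq]
        refine ⟨z, ?_, by simpa using hR h⟩
        have := norm_sub_norm_le z z0
        rw [mem_ball_iff_norm] at hz
        linarith
      have heq : latticeError μ b f x =ᶠ[𝓝 z0] fun z => (x : ℂ) ^ Module.finrank ℝ E *
          (∑ l ∈ S, f (x • (z + l))) - (∫ v, f v ∂μ) / (μ.real D : ℂ) := by
        filter_upwards [Metric.ball_mem_nhds z0 one_pos] with z hz
        unfold latticeError
        congr 2
        exact tsum_eq_sum fun l hl => image_eq_zero_of_notMem_tsupport (hnot l hl z hz)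
      set L : E →L[ℝ] ℂ := ((x : ℂ) ^ Module.finrank ℝ E) •
        ∑ l ∈ S, x • fderiv ℝ f (x • (z0 + (l : E))) with hL
      have hLd : HasFDerivAt (fun z => (x : ℂ) ^ Module.finrank ℝ E *
          (∑ l ∈ S, f (x • (z + l))) - (∫ v, f v ∂μ) / (μ.real D : ℂ)) L z0 := by
        refine HasFDerivAt.sub_const _ (HasFDerivAt.const_mul (HasFDerivAt.fun_sum fun l _ => ?_) _)
        have h1 : HasFDerivAt (fun z : E => x • (z + (l : E))) (x • ContinuousLinearMap.id ℝ E) z0 :=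
          ((hasFDerivAt_id z0).add_const _).const_smul x
        have h2 := (hf.differentiable (by simp) (x • (z0 + (l : E)))).hasFDerivAt.comp z0 h1
        refine h2.congr_fderiv ?_
        rw [ContinuousLinearMap.comp_smul, ContinuousLinearMap.comp_id]
      refine ⟨L, hLd.congr_of_eventuallyEq heq, ?_⟩
      refine hB (mul_nonneg (Finset.sum_nonneg fun i _ => abs_nonneg _) (by positivity)) fun i => ?_
      have hLi : L (b i) = x * latticeError μ b (fun y => fderiv ℝ f y (b i)) x z0 := by
        unfold latticeError
        rw [integral_fderiv_apply_eq_zero μ hf hfc, zero_div, sub_zero, tsum_eq_sum (s := S)]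
        · rw [hL]
          simp only [FunLike.coe_smul, Pi.smul_apply, ContinuousLinearMap.sum_apply, smul_eq_mul,
            Complex.real_smul]
          rw [← Finset.mul_sum]
          ring
        · intro l hl
          simp only
          rw [fderiv_of_notMem_tsupport ℝ (hnot l hl z0 (Metric.mem_ball_self one_pos))]
          rfl
      rw [hLi, norm_mul, Complex.norm_real, Real.norm_of_nonneg hx.le, pow_succ, mul_comm,
        ← mul_assoc]
      gcongr
      refine (hC i x hx hx1 z0).trans ?_
      gcongr
      exact (le_abs_self _).trans (Finset.single_le_sum (f := fun i => |C i|)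
        (fun i _ => abs_nonneg _) (Finset.mem_univ i))
    set K := B * ((∑ i, |C i|) * x ^ (m + 1)) with hK
    obtain ⟨hInt0, hInt, hcont⟩ := integral_latticeError μ b hf.continuous hfc hx
    have hlip : ∀ z z' : E, ‖latticeError μ b f x z - latticeError μ b f x z'‖ ≤ K * ‖z - z'‖ := by
      intro z z'
      choose L hL hLK using hderiv
      exact convex_univ.norm_image_sub_le_of_norm_hasFDerivWithin_le
        (fun y _ => (hL y).hasFDerivWithinAt) (fun y _ => hLK y) (Set.mem_univ z') (Set.mem_univ z)
    have hK0 : 0 ≤ K := by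
      rw [hK]
      exact mul_nonneg hB0.le (mul_nonneg (Finset.sum_nonneg fun i _ => abs_nonneg _)
        (by positivity))
    have hmem : ∀ z ∈ D, ‖latticeError μ b f x z‖ ≤ K * (2 * r) := by
      intro z hz
      have h1 : (μ.real D : ℂ) * latticeError μ b f x z =
          ∫ y in D, (latticeError μ b f x z - latticeError μ b f x y) ∂μ := by
        rw [integral_sub (f := fun _ => latticeError μ b f x z) (integrableOn_const hDtop) hInt, hInt0, sub_zero, setIntegral_const,
          Complex.real_smul]
      have h2 : ‖(μ.real D : ℂ) * latticeError μ b f x z‖ ≤ (K * (2 * r)) * μ.real D := by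
        rw [h1]
        refine norm_setIntegral_le_of_norm_le_const (lt_top_iff_ne_top.mpr hDtop) fun y hy => ?_
        refine (hlip z y).trans ?_
        gcongr
        have h3 := norm_sub_le z y
        have h4 : ‖z‖ ≤ r := by simpa using hr hz
        have h5 : ‖y‖ ≤ r := by simpa using hr hy
        linarith
      rw [norm_mul, Complex.norm_real, Real.norm_of_nonneg hD0.le, mul_comm] at h2
      exact le_of_mul_le_mul_right h2 hD0
    intro z
    have hper : latticeError μ b f x z = latticeError μ b f x (ZSpan.fract b z) := by
      unfold latticeError
      congr 2
      rw [← (Equiv.addLeft (-ZSpan.floor b z)).tsum_eq]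
      refine tsum_congr fun l => ?_
      rw [ZSpan.fract_apply]
      congr 2
      simp only [Equiv.coe_addLeft, Submodule.coe_add, NegMemClass.coe_neg]
      abel
    rw [hper]
    refine (hmem _ (ZSpan.fract_mem_fundamentalDomain b z)).trans (le_of_eq ?_)
    rw [hK]; ring

end Lattice

end

section

open Topology

section Bump

/-- A smooth nonnegative function on the line supported in `[0, 2]` whose integer translates sum
to one. -/
noncomputable def unitBump (t : ℝ) : ℝ :=
  Real.smoothTransition t - Real.smoothTransition (t - 1)

theorem unitBump_nonneg (t : ℝ) : 0 ≤ unitBump t :=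
  sub_nonneg.2 (Real.smoothTransition.monotone (by linarith))

theorem unitBump_le_one (t : ℝ) : unitBump t ≤ 1 := by
  have h1 := Real.smoothTransition.le_one t
  have h2 := Real.smoothTransition.nonneg (t - 1)
  unfold unitBump; linarith

theorem unitBump_eq_zero_of_le {t : ℝ} (h : t ≤ 0) : unitBump t = 0 := by
  rw [unitBump, Real.smoothTransition.zero_of_nonpos h,
    Real.smoothTransition.zero_of_nonpos (by linarith), sub_zero]

theorem unitBump_eq_zero_of_ge {t : ℝ} (h : 2 ≤ t) : unitBump t = 0 := by
  rw [unitBump, Real.smoothTransition.one_of_one_le (by linarith),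
    Real.smoothTransition.one_of_one_le (by linarith), sub_self]

theorem contDiff_unitBump : ContDiff ℝ (⊤ : ℕ∞) unitBump :=
  Real.smoothTransition.contDiff.sub
    (Real.smoothTransition.contDiff.comp (contDiff_id.sub contDiff_const))

theorem unitBump_sum_translates (t : ℝ) :
    ∑ m ∈ ({-⌊t⌋, -⌊t⌋ + 1} : Finset ℤ), unitBump (t + m) = 1 := by
  have h1 := Int.floor_le t
  have h2 := Int.lt_floor_add_one t
  rw [Finset.sum_pair (by omega)]
  simp only [unitBump]
  push_cast
  rw [Real.smoothTransition.zero_of_nonpos (x := t + -(⌊t⌋ : ℝ) - 1) (by linarith),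
    Real.smoothTransition.one_of_one_le (x := t + (-(⌊t⌋ : ℝ) + 1)) (by linarith)]
  ring_nf

theorem unitBump_eq_zero_of_notMem {t : ℝ} {m : ℤ}
    (hm : m ∉ ({-⌊t⌋, -⌊t⌋ + 1} : Finset ℤ)) : unitBump (t + m) = 0 := by
  have h1 := Int.floor_le t
  have h2 := Int.lt_floor_add_one t
  simp only [Finset.mem_insert, Finset.mem_singleton, not_or] at hm
  rcases lt_or_gt_of_ne hm.1 with h | h
  · apply unitBump_eq_zero_of_le
    have : (m : ℝ) ≤ -⌊t⌋ - 1 := by exact_mod_cast (by omega : m ≤ -⌊t⌋ - 1)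
    linarith
  · apply unitBump_eq_zero_of_ge
    have : (-⌊t⌋ + 2 : ℝ) ≤ m := by exact_mod_cast (by omega : -⌊t⌋ + 2 ≤ m)
    linarith

theorem hasSum_prod_unitBump {ι : Type*} [Fintype ι] (t : ι → ℝ) :
    HasSum (fun n : ι → ℤ => ∏ i, unitBump (t i + n i)) 1 := by
  have h : ∑ n ∈ Fintype.piFinset (fun i => ({-⌊t i⌋, -⌊t i⌋ + 1} : Finset ℤ)),
      ∏ i, unitBump (t i + n i) = 1 := by
    have h2 := Finset.prod_univ_sum (fun i => ({-⌊t i⌋, -⌊t i⌋ + 1} : Finset ℤ))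
      (fun i (m : ℤ) => unitBump (t i + m))
    rw [← h2]
    exact Finset.prod_eq_one fun i _ => unitBump_sum_translates (t i)
  rw [← h]
  refine hasSum_sum_of_ne_finset_zero fun n hn => ?_
  rw [Fintype.mem_piFinset] at hn
  push Not at hn
  obtain ⟨i, hi⟩ := hn
  exact Finset.prod_eq_zero (Finset.mem_univ i) (unitBump_eq_zero_of_notMem hi)

end Bump

section UnitCoord

variable {K}

/-- The coordinates of the logarithmic image of `v` with respect to the system of fundamental
units. -/
noncomputable def unitCoord (v : mixedSpace K) (j : Fin (rank K)) : ℝ :=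
  ((basisUnitLattice K).ofZLatticeBasis ℝ (unitLattice K)).repr (logMap v) j

theorem unitCoord_mul {x y : mixedSpace K} (hx : mixedEmbedding.norm x ≠ 0)
    (hy : mixedEmbedding.norm y ≠ 0) : unitCoord (x * y) = unitCoord x + unitCoord y := by
  ext j; simp [unitCoord, logMap_mul hx hy]

theorem unitCoord_smul {x : mixedSpace K} (hx : mixedEmbedding.norm x ≠ 0) {c : ℝ} (hc : c ≠ 0) :
    unitCoord (c • x) = unitCoord x := by
  ext j; simp [unitCoord, logMap_real_smul hx hc]

theorem norm_mixedEmbedding_unit (u : (𝓞 K)ˣ) :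
    mixedEmbedding.norm (mixedEmbedding K ((u : 𝓞 K) : K)) = 1 :=
  norm_unit u

theorem norm_unit_mul (u : (𝓞 K)ˣ) (v : mixedSpace K) :
    mixedEmbedding.norm (mixedEmbedding K ((u : 𝓞 K) : K) * v) = mixedEmbedding.norm v := by
  rw [map_mul, norm_mixedEmbedding_unit, one_mul]

theorem unitCoord_torsion (ζ : torsion K) :
    unitCoord (mixedEmbedding K (((ζ : (𝓞 K)ˣ) : 𝓞 K) : K)) = 0 := by
  ext j
  have : logEmbedding K (Additive.ofMul (ζ : (𝓞 K)ˣ)) = 0 := by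
    rw [dirichletUnitTheorem.logEmbedding_eq_zero_iff]; exact ζ.2
  simp [unitCoord, logMap_eq_logEmbedding, this]

theorem unitCoord_fundSystem (i : Fin (rank K)) :
    unitCoord (mixedEmbedding K (((fundSystem K i : (𝓞 K)ˣ) : 𝓞 K) : K)) = Pi.single i 1 := by
  ext j
  rw [unitCoord, logMap_eq_logEmbedding, logEmbedding_fundSystem,
    Module.Basis.ofZLatticeBasis_repr_apply]
  simp [Finsupp.single_apply, Pi.single_apply, eq_comm]

/-- The additive version of `unitCoord` on units. -/
noncomputable def unitCoordHom : (𝓞 K)ˣ →* Multiplicative (Fin (rank K) → ℝ) where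
  toFun u := Multiplicative.ofAdd (unitCoord (mixedEmbedding K ((u : 𝓞 K) : K)))
  map_one' := by
    ext j; simp [unitCoord]
  map_mul' u v := by
    rw [← ofAdd_add, ← unitCoord_mul (by simp [norm_mixedEmbedding_unit])
      (by simp [norm_mixedEmbedding_unit])]
    simp

theorem unitCoord_eq (u : (𝓞 K)ˣ) :
    unitCoord (mixedEmbedding K ((u : 𝓞 K) : K)) = Multiplicative.toAdd (unitCoordHom u) := rfl

theorem unitCoord_unit (ζ : torsion K) (n : Fin (rank K) → ℤ) :
    unitCoord (mixedEmbedding K ((((ζ : (𝓞 K)ˣ) * ∏ i, fundSystem K i ^ n i : (𝓞 K)ˣ) : 𝓞 K) : K))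
      = fun j => (n j : ℝ) := by
  rw [unitCoord_eq, map_mul, map_prod, toAdd_mul, ← unitCoord_eq, unitCoord_torsion, zero_add,
    toAdd_prod]
  ext j
  rw [Finset.sum_apply, Finset.sum_eq_single j]
  · rw [map_zpow, toAdd_zpow, ← unitCoord_eq, unitCoord_fundSystem]; simp
  · intro i _ hi
    rw [map_zpow, toAdd_zpow, ← unitCoord_eq, unitCoord_fundSystem]; simp [hi.symm]
  · simp

/-- The parametrization of units by Dirichlet's unit theorem. -/
noncomputable def unitsEquiv : torsion K × (Fin (rank K) → ℤ) ≃ (𝓞 K)ˣ :=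
  Equiv.ofBijective (fun p => (p.1 : (𝓞 K)ˣ) * ∏ i, fundSystem K i ^ p.2 i) <| by
    rw [Function.bijective_iff_existsUnique]
    intro u
    obtain ⟨p, hp, hp'⟩ := exist_unique_eq_mul_prod K u
    exact ⟨p, hp.symm, fun q hq => hp' q hq.symm⟩

theorem unitsEquiv_apply (p : torsion K × (Fin (rank K) → ℤ)) :
    unitsEquiv p = (p.1 : (𝓞 K)ˣ) * ∏ i, fundSystem K i ^ p.2 i := rfl

/-- A weight on the mixed space whose translates under the units sum to one. -/
noncomputable def unitWeight (v : mixedSpace K) : ℝ :=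
  (torsionOrder K : ℝ)⁻¹ * ∏ j, unitBump (unitCoord v j)

theorem unitWeight_nonneg (v : mixedSpace K) : 0 ≤ unitWeight v :=
  mul_nonneg (by positivity) (Finset.prod_nonneg fun _ _ => unitBump_nonneg _)

theorem unitWeight_le_one (v : mixedSpace K) : unitWeight v ≤ 1 := by
  refine mul_le_one₀ ?_ (Finset.prod_nonneg fun _ _ => unitBump_nonneg _)
    (Finset.prod_le_one (fun _ _ => unitBump_nonneg _) fun _ _ => unitBump_le_one _)
  exact inv_le_one_of_one_le₀ (by exact_mod_cast Nat.one_le_iff_ne_zero.2 (torsionOrder_ne_zero K))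

theorem unitWeight_smul {v : mixedSpace K} (hv : mixedEmbedding.norm v ≠ 0) {c : ℝ} (hc : c ≠ 0) :
    unitWeight (c • v) = unitWeight v := by
  rw [unitWeight, unitCoord_smul hv hc, unitWeight]

theorem sum_inv_torsionOrder [Fintype (torsion K)] :
    (∑ _b : torsion K, (torsionOrder K : ℝ)⁻¹) = 1 := by
  have h : (torsionOrder K : ℝ) ≠ 0 := by exact_mod_cast torsionOrder_ne_zero K
  rw [Finset.sum_const, Finset.card_univ, nsmul_eq_mul]
  rw [torsionOrder, Nat.card_eq_fintype_card] at *
  exact mul_inv_cancel₀ h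

theorem hasSum_unitWeight {v : mixedSpace K} (hv : mixedEmbedding.norm v ≠ 0) :
    HasSum (fun u : (𝓞 K)ˣ => unitWeight (mixedEmbedding K ((u : 𝓞 K) : K) * v)) 1 := by
  have := Fintype.ofFinite (torsion K)
  have h1 : HasSum (fun _ : torsion K => (torsionOrder K : ℝ)⁻¹) 1 := by
    rw [← sum_inv_torsionOrder (K := K)]; exact hasSum_fintype _
  have h2 := hasSum_prod_unitBump (unitCoord v)
  have h3 := h1.summable.mul_of_nonneg h2.summable (fun _ => by positivity)
    (fun _ => Finset.prod_nonneg fun _ _ => unitBump_nonneg _)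
  have h := h1.mul h2 h3
  rw [mul_one] at h
  refine (Equiv.hasSum_iff unitsEquiv).1 (h.congr_fun ?_)
  rintro ⟨ζ, n⟩
  rw [Function.comp_apply, unitsEquiv_apply, unitWeight,
    unitCoord_mul (by simp [norm_mixedEmbedding_unit]) hv, unitCoord_unit]
  simp [add_comm]

end UnitCoord

end

section

open Topology

section Smooth

variable {K}

theorem contDiffAt_normAtPlace {v : mixedSpace K} {w : InfinitePlace K}
    (hv : normAtPlace w v ≠ 0) : ContDiffAt ℝ (⊤ : ℕ∞) (normAtPlace w) v := by
  rcases isReal_or_isComplex w with hw | hw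
  · have h : (normAtPlace w : mixedSpace K → ℝ) = fun x => ‖x.1 ⟨w, hw⟩‖ := by
      ext x; exact normAtPlace_apply_of_isReal hw x
    rw [h] at hv ⊢
    refine ContDiffAt.norm ℝ ?_ (norm_ne_zero_iff.1 hv)
    exact ((contDiff_apply ℝ ℝ (⟨w, hw⟩ : {w : InfinitePlace K // IsReal w})).comp
      contDiff_fst).contDiffAt
  · have h : (normAtPlace w : mixedSpace K → ℝ) = fun x => ‖x.2 ⟨w, hw⟩‖ := by
      ext x; exact normAtPlace_apply_of_isComplex hw x
    rw [h] at hv ⊢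
    refine ContDiffAt.norm ℝ ?_ (norm_ne_zero_iff.1 hv)
    exact ((contDiff_apply ℝ ℂ (⟨w, hw⟩ : {w : InfinitePlace K // IsComplex w})).comp
      contDiff_snd).contDiffAt

theorem contDiffAt_mixedEmbedding_norm {v : mixedSpace K} (hv : mixedEmbedding.norm v ≠ 0) :
    ContDiffAt ℝ (⊤ : ℕ∞) (mixedEmbedding.norm : mixedSpace K → ℝ) v := by
  have h : (mixedEmbedding.norm : mixedSpace K → ℝ)
      = fun x => ∏ w, (normAtPlace w x) ^ (mult w) := by
    ext x; exact mixedEmbedding.norm_apply x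
  rw [h]
  exact contDiffAt_prod fun w _ =>
    (contDiffAt_normAtPlace (mixedEmbedding.norm_ne_zero_iff.1 hv w)).pow _

theorem contDiffAt_logMap {v : mixedSpace K} (hv : mixedEmbedding.norm v ≠ 0) :
    ContDiffAt ℝ (⊤ : ℕ∞) (logMap : mixedSpace K → _) v := by
  rw [contDiffAt_pi]
  intro w
  simp only [logMap_apply]
  have hw := mixedEmbedding.norm_ne_zero_iff.1 hv w.val
  exact contDiffAt_const.mul (((contDiffAt_normAtPlace hw).log hw).sub
    (((contDiffAt_mixedEmbedding_norm hv).log hv).mul contDiffAt_const))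

theorem contDiffAt_unitCoord {v : mixedSpace K} (hv : mixedEmbedding.norm v ≠ 0)
    (j : Fin (rank K)) : ContDiffAt ℝ (⊤ : ℕ∞) (fun v => unitCoord v j) v := by
  have h := (((basisUnitLattice K).ofZLatticeBasis ℝ (unitLattice K)).coord
    j).toContinuousLinearMap.contDiff (n := (⊤ : ℕ∞))
  exact h.contDiffAt.comp v (contDiffAt_logMap hv)

theorem contDiffAt_unitWeight {v : mixedSpace K} (hv : mixedEmbedding.norm v ≠ 0) :
    ContDiffAt ℝ (⊤ : ℕ∞) (unitWeight : mixedSpace K → ℝ) v := by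
  unfold unitWeight
  exact contDiffAt_const.mul (contDiffAt_prod fun j _ =>
    contDiff_unitBump.contDiffAt.comp v (contDiffAt_unitCoord hv j))

theorem exists_abs_logMap_le (r : ℝ) : ∃ M, 0 ≤ M ∧ ∀ v : mixedSpace K,
    (∀ j, |unitCoord v j| ≤ r) → ∀ w, |logMap v w| ≤ M := by
  set b := (basisUnitLattice K).ofZLatticeBasis ℝ (unitLattice K)
  refine ⟨∑ j, |r| * ‖b j‖, Finset.sum_nonneg fun _ _ => by positivity, fun v hv w => ?_⟩
  have h : logMap v = ∑ j, unitCoord v j • b j := (b.sum_repr (logMap v)).symm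
  calc |logMap v w| ≤ ‖logMap v‖ := norm_le_pi_norm (logMap v) w
    _ ≤ ∑ j, ‖unitCoord v j • b j‖ := by rw [h]; exact norm_sum_le _ _
    _ ≤ ∑ j, |r| * ‖b j‖ := by
        refine Finset.sum_le_sum fun j _ => ?_
        rw [_root_.norm_smul]
        exact mul_le_mul_of_nonneg_right ((hv j).trans (le_abs_self r)) (norm_nonneg _)

theorem sum_mult_mul_log_normAtPlace {v : mixedSpace K} (hv : mixedEmbedding.norm v ≠ 0) :
    ∑ w : InfinitePlace K, (mult w : ℝ) * (Real.log (normAtPlace w v) -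
      Real.log (mixedEmbedding.norm v) * (Module.finrank ℚ K : ℝ)⁻¹) = 0 := by
  have hn : (Module.finrank ℚ K : ℝ) ≠ 0 := Nat.cast_ne_zero.2 Module.finrank_pos.ne'
  have h : Real.log (mixedEmbedding.norm v)
      = ∑ w : InfinitePlace K, (mult w : ℝ) * Real.log (normAtPlace w v) := by
    rw [mixedEmbedding.norm_apply, Real.log_prod]
    · simp
    · exact fun w _ => pow_ne_zero _ (mixedEmbedding.norm_ne_zero_iff.1 hv w)
  simp only [mul_sub, Finset.sum_sub_distrib]
  rw [← h, ← Finset.sum_mul]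
  have h2 : ∑ w : InfinitePlace K, (mult w : ℝ) = Module.finrank ℚ K := by
    exact_mod_cast InfinitePlace.sum_mult_eq (K := K)
  rw [h2]; field_simp; ring

theorem exists_abs_log_normAtPlace_le (r : ℝ) : ∃ M, 0 ≤ M ∧ ∀ v : mixedSpace K,
    mixedEmbedding.norm v ≠ 0 → (∀ j, |unitCoord v j| ≤ r) → ∀ w,
    |Real.log (normAtPlace w v) -
      Real.log (mixedEmbedding.norm v) * (Module.finrank ℚ K : ℝ)⁻¹| ≤ M := by
  obtain ⟨M, hM0, hM⟩ := exists_abs_logMap_le (K := K) r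
  have hmult : ∀ w : InfinitePlace K, (1 : ℝ) ≤ mult w := fun w => by
    exact_mod_cast Nat.one_le_iff_ne_zero.2 (mult_ne_zero (w := w))
  have key : ∀ (w : InfinitePlace K) (x B : ℝ), |(mult w : ℝ) * x| ≤ B → |x| ≤ B := by
    intro w x B h
    rw [abs_mul, abs_of_nonneg (by linarith [hmult w])] at h
    nlinarith [abs_nonneg x, hmult w]
  have hcard : (0 : ℝ) ≤ Fintype.card (InfinitePlace K) := by positivity
  refine ⟨Fintype.card (InfinitePlace K) * M + M, by positivity, fun v hv ht w => ?_⟩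
  have h1 := hM v ht
  by_cases hw : w = dirichletUnitTheorem.w₀
  · apply key w
    have h2 := sum_mult_mul_log_normAtPlace hv
    rw [← Finset.add_sum_erase _ _ (Finset.mem_univ w)] at h2
    rw [eq_neg_of_add_eq_zero_left h2, abs_neg]
    refine (Finset.abs_sum_le_sum_abs _ _).trans ?_
    calc _ ≤ ∑ _i ∈ Finset.univ.erase w, M := Finset.sum_le_sum fun i hi => by
            have hi' : i ≠ dirichletUnitTheorem.w₀ := hw ▸ Finset.ne_of_mem_erase hi
            exact h1 ⟨i, hi'⟩
      _ ≤ ∑ _i : InfinitePlace K, M :=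
            Finset.sum_le_sum_of_subset_of_nonneg (Finset.erase_subset _ _) fun _ _ _ => hM0
      _ ≤ _ := by simp [hM0]
  · apply key w
    have := h1 ⟨w, hw⟩
    rw [logMap_apply] at this
    exact this.trans (by nlinarith)

theorem exists_normAtPlace_le (r : ℝ) : ∃ B, 0 < B ∧ ∀ v : mixedSpace K,
    mixedEmbedding.norm v ≠ 0 → (∀ j, |unitCoord v j| ≤ r) → ∀ w,
    normAtPlace w v ≤ B * mixedEmbedding.norm v ^ ((Module.finrank ℚ K : ℝ)⁻¹) := by
  obtain ⟨M, hM0, hM⟩ := exists_abs_log_normAtPlace_le (K := K) r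
  refine ⟨Real.exp M, Real.exp_pos _, fun v hv ht w => ?_⟩
  have h := (abs_le.1 (hM v hv ht w)).2
  have hN : 0 < mixedEmbedding.norm v := lt_of_le_of_ne (mixedEmbedding.norm_nonneg v) hv.symm
  have hw : 0 < normAtPlace w v :=
    lt_of_le_of_ne (normAtPlace_nonneg w v) (mixedEmbedding.norm_ne_zero_iff.1 hv w).symm
  rw [Real.rpow_def_of_pos hN, ← Real.exp_add, ← Real.log_le_iff_le_exp hw]
  linarith

theorem unitWeight_eq_zero {v : mixedSpace K} (h : ¬ ∀ j, |unitCoord v j| ≤ 2) :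
    unitWeight v = 0 := by
  push Not at h
  obtain ⟨j, hj⟩ := h
  rw [unitWeight, Finset.prod_eq_zero (Finset.mem_univ j), mul_zero]
  rcases lt_abs.1 hj with h | h
  · exact unitBump_eq_zero_of_ge h.le
  · exact unitBump_eq_zero_of_le (by linarith)

theorem exists_norm_le_of_unitWeight_ne_zero : ∃ B, 0 < B ∧ ∀ v : mixedSpace K,
    mixedEmbedding.norm v ≠ 0 → unitWeight v ≠ 0 →
    ‖v‖ ≤ B * mixedEmbedding.norm v ^ ((Module.finrank ℚ K : ℝ)⁻¹) := by
  obtain ⟨B, hB, h⟩ := exists_normAtPlace_le (K := K) 2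
  refine ⟨B, hB, fun v hv ht => ?_⟩
  rw [norm_eq_sup'_normAtPlace]
  exact Finset.sup'_le _ _ fun w _ => h v hv (not_not.1 (mt unitWeight_eq_zero ht)) w

/-- Multiplying a smooth function on the nonzero locus by the unit weight and a cutoff in the norm
yields a smooth compactly supported function. -/
noncomputable def cutoffFun (χ : mixedSpace K → ℂ) (η : ℝ → ℂ) (v : mixedSpace K) : ℂ :=
  χ v * unitWeight v * η (mixedEmbedding.norm v)

theorem contDiff_cutoffFun {χ : mixedSpace K → ℂ} {η : ℝ → ℂ}
    (hχ : ∀ v, mixedEmbedding.norm v ≠ 0 → ContDiffAt ℝ (⊤ : ℕ∞) χ v)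
    (hη : ContDiff ℝ (⊤ : ℕ∞) η) {ε : ℝ} (hε : 0 < ε) (hη0 : ∀ x ≤ ε, η x = 0) :
    ContDiff ℝ (⊤ : ℕ∞) (cutoffFun χ η) := by
  rw [contDiff_iff_contDiffAt]
  intro v
  by_cases hv : mixedEmbedding.norm v = 0
  · have : cutoffFun χ η =ᶠ[𝓝 v] fun _ => 0 := by
      have := (mixedEmbedding.continuous_norm K).continuousAt (x := v) |>.eventually
        (Iio_mem_nhds (hv.trans_lt hε))
      filter_upwards [this] with x hx
      rw [cutoffFun, hη0 _ (le_of_lt hx), mul_zero]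
    exact contDiffAt_const.congr_of_eventuallyEq this
  · refine ((hχ v hv).mul ?_).mul (hη.contDiffAt.comp v (contDiffAt_mixedEmbedding_norm hv))
    exact Complex.ofRealCLM.contDiff.contDiffAt.comp v (contDiffAt_unitWeight hv)

theorem hasCompactSupport_cutoffFun (χ : mixedSpace K → ℂ) {η : ℝ → ℂ}
    (hη0 : η 0 = 0) {R : ℝ} (hηR : ∀ x, R ≤ x → η x = 0) :
    HasCompactSupport (cutoffFun χ η) := by
  obtain ⟨B, hB, h⟩ := exists_norm_le_of_unitWeight_ne_zero (K := K)
  refine HasCompactSupport.intro (isCompact_closedBall (0 : mixedSpace K)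
    (B * |R| ^ ((Module.finrank ℚ K : ℝ)⁻¹))) fun v hv => ?_
  by_contra hc
  have h1 : η (mixedEmbedding.norm v) ≠ 0 := right_ne_zero_of_mul hc
  have h2 : unitWeight v ≠ 0 := by
    have := right_ne_zero_of_mul (left_ne_zero_of_mul hc)
    exact_mod_cast this
  have h3 : mixedEmbedding.norm v ≠ 0 := fun h => h1 (h ▸ hη0)
  have h4 : mixedEmbedding.norm v < R := not_le.1 fun h => h1 (hηR _ h)
  apply hv
  rw [mem_closedBall_zero_iff]
  refine (h v h3 h2).trans (mul_le_mul_of_nonneg_left ?_ hB.le)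
  exact Real.rpow_le_rpow (mixedEmbedding.norm_nonneg v) (h4.le.trans (le_abs_self R))
    (by positivity)

end Smooth

end

section

open Topology

/-- An unramified Hecke character of a number field: a smooth unitary character of the norm-nonzero
part of the mixed space, trivial on real scalars, together with a compatible unitary character of
the monoid of ideals. -/
structure HeckeChar where
  /-- The component at infinity. -/
  toFun : mixedSpace K → ℂ
  /-- The character on ideals. -/
  onIdeal : Ideal (𝓞 K) →*₀ ℂ
  map_mul' : ∀ x y, mixedEmbedding.norm x ≠ 0 → mixedEmbedding.norm y ≠ 0 →
    toFun (x * y) = toFun x * toFun y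
  norm_toFun' : ∀ x, mixedEmbedding.norm x ≠ 0 → ‖toFun x‖ = 1
  contDiffAt' : ∀ x, mixedEmbedding.norm x ≠ 0 → ContDiffAt ℝ (⊤ : ℕ∞) toFun x
  map_smul' : ∀ (c : ℝ) x, c ≠ 0 → mixedEmbedding.norm x ≠ 0 → toFun (c • x) = toFun x
  norm_onIdeal' : ∀ I, I ≠ ⊥ → ‖onIdeal I‖ = 1
  onIdeal_span' : ∀ a : 𝓞 K, a ≠ 0 → onIdeal (Ideal.span {a}) = toFun (mixedEmbedding K (a : K))

variable {K}

theorem norm_mixedEmbedding_int (a : 𝓞 K) :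
    mixedEmbedding.norm (mixedEmbedding K (a : K)) = Ideal.absNorm (Ideal.span {a}) := by
  rw [mixedEmbedding.norm_eq_norm, Ideal.absNorm_span_singleton, Nat.cast_natAbs,
    ← Rat.cast_intCast, Int.cast_abs, Algebra.coe_norm_int]

theorem norm_mixedEmbedding_int_ne_zero {a : 𝓞 K} (ha : a ≠ 0) :
    mixedEmbedding.norm (mixedEmbedding K (a : K)) ≠ 0 := by
  rw [norm_mixedEmbedding_int]
  simpa [Ideal.absNorm_eq_zero_iff] using ha

theorem mem_span_idealBasis_iff (J : (Ideal (𝓞 K))) (hJ : J ≠ ⊥) (x : mixedSpace K) :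
    x ∈ Submodule.span ℤ (Set.range (fractionalIdealLatticeBasis K
      (FractionalIdeal.mk0 K ⟨J, mem_nonZeroDivisors_of_ne_zero hJ⟩))) ↔
      ∃ a ∈ J, mixedEmbedding K ((a : 𝓞 K) : K) = x := by
  rw [mem_span_fractionalIdealLatticeBasis]
  simp [FractionalIdeal.mem_coeIdeal]

/-- Elements of an ideal correspond to points of its lattice. -/
noncomputable def idealLatticeEquiv (J : Ideal (𝓞 K)) (hJ : J ≠ ⊥) :
    J ≃ Submodule.span ℤ (Set.range (fractionalIdealLatticeBasis K
      (FractionalIdeal.mk0 K ⟨J, mem_nonZeroDivisors_of_ne_zero hJ⟩))) :=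
  Equiv.ofBijective (fun a => ⟨mixedEmbedding K (((a : 𝓞 K)) : K),
    (mem_span_idealBasis_iff J hJ _).2 ⟨a, a.2, rfl⟩⟩) <| by
    constructor
    · intro a b h
      have := congrArg Subtype.val h
      exact Subtype.ext (RingOfIntegers.ext (mixedEmbedding_injective K this))
    · rintro ⟨x, hx⟩
      obtain ⟨a, ha, rfl⟩ := (mem_span_idealBasis_iff J hJ x).1 hx
      exact ⟨⟨a, ha⟩, rfl⟩

theorem idealLatticeEquiv_apply (J : Ideal (𝓞 K)) (hJ : J ≠ ⊥) (a : J) :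
    (idealLatticeEquiv J hJ a : mixedSpace K) = mixedEmbedding K (((a : 𝓞 K)) : K) := rfl

/-- Ideals in the class inverse to that of `J`. -/
abbrev InvClass (J : Ideal (𝓞 K)) := {I : Ideal (𝓞 K) // I ≠ ⊥ ∧ Submodule.IsPrincipal (I * J)}

/-- A generator of `I * J` for `I` in the inverse class of `J`. -/
noncomputable def InvClass.gen {J : Ideal (𝓞 K)} (I : InvClass J) : 𝓞 K :=
  I.2.2.generator

theorem InvClass.span_gen {J : Ideal (𝓞 K)} (I : InvClass J) :
    Ideal.span {I.gen} = I.1 * J :=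
  haveI := I.2.2
  Ideal.span_singleton_generator (I.1 * J)

theorem InvClass.gen_ne_zero {J : Ideal (𝓞 K)} (hJ : J ≠ ⊥) (I : InvClass J) : I.gen ≠ 0 := by
  intro h
  have := I.span_gen
  rw [h, Ideal.span_singleton_eq_bot.2 rfl] at this
  exact mul_ne_zero I.2.1 hJ this.symm

theorem InvClass.gen_mem {J : Ideal (𝓞 K)} (I : InvClass J) : I.gen ∈ J := by
  have h : I.gen ∈ I.1 * J := by
    rw [← I.span_gen]; exact Ideal.mem_span_singleton_self _
  have h' : I.1 * J ≤ J := Ideal.mul_le_right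
  exact h' h

theorem InvClass.eq_of_mul_gen_eq {J : Ideal (𝓞 K)} (hJ : J ≠ ⊥) {I I' : InvClass J}
    {u u' : (𝓞 K)ˣ} (h1 : (u : 𝓞 K) * I.gen = u' * I'.gen) : I = I' ∧ u = u' := by
  have h2 : Ideal.span {I.gen} = Ideal.span {I'.gen} := by
    rw [Ideal.span_singleton_eq_span_singleton]
    refine ⟨u * u'⁻¹, ?_⟩
    rw [Units.val_mul, ← mul_assoc, mul_comm I.gen, h1, mul_right_comm, Units.mul_inv, one_mul]
  rw [I.span_gen, I'.span_gen] at h2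
  have h3 : I = I' := Subtype.ext (mul_right_cancel₀ hJ h2)
  subst h3
  exact ⟨rfl, Units.ext (mul_right_cancel₀ (I.gen_ne_zero hJ) h1)⟩

theorem InvClass.exists_mul_gen_eq {J : Ideal (𝓞 K)} {a : 𝓞 K} (ha : a ∈ J) (ha0 : a ≠ 0) :
    ∃ (I : InvClass J) (u : (𝓞 K)ˣ), (u : 𝓞 K) * I.gen = a := by
  obtain ⟨I, hI⟩ : J ∣ Ideal.span {a} := by
    rw [Ideal.dvd_span_singleton]; exact ha
  have hI0 : I ≠ ⊥ := by
    rintro rfl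
    simp only [Ideal.mul_bot, Ideal.span_singleton_eq_bot] at hI
    exact ha0 hI
  have hIJ : Submodule.IsPrincipal (I * J) := ⟨a, by rw [mul_comm, ← hI]⟩
  have h2 : Ideal.span {InvClass.gen ⟨I, hI0, hIJ⟩} = Ideal.span {a} := by
    rw [InvClass.span_gen, hI, mul_comm]
  rw [Ideal.span_singleton_eq_span_singleton] at h2
  obtain ⟨u, hu⟩ := h2
  exact ⟨⟨I, hI0, hIJ⟩, u, by rw [← hu, mul_comm]⟩

/-- The element of `J` attached to an ideal in the inverse class of `J` and a unit. -/
noncomputable def invClassMap (J : Ideal (𝓞 K)) (hJ : J ≠ ⊥) (p : InvClass J × (𝓞 K)ˣ) :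
    {a : J // (a : 𝓞 K) ≠ 0} :=
  ⟨⟨(p.2 : 𝓞 K) * p.1.gen, J.mul_mem_left _ p.1.gen_mem⟩,
    mul_ne_zero p.2.ne_zero (p.1.gen_ne_zero hJ)⟩

theorem bijective_invClassMap (J : Ideal (𝓞 K)) (hJ : J ≠ ⊥) :
    Function.Bijective (invClassMap J hJ) := by
  constructor
  · intro p q h
    have h1 : (p.2 : 𝓞 K) * p.1.gen = q.2 * q.1.gen :=
      congrArg (fun a : {a : J // (a : 𝓞 K) ≠ 0} => ((a.1 : J) : 𝓞 K)) h
    exact Prod.ext (InvClass.eq_of_mul_gen_eq hJ h1).1 (InvClass.eq_of_mul_gen_eq hJ h1).2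
  · intro a
    obtain ⟨I, u, h⟩ := InvClass.exists_mul_gen_eq a.1.2 a.2
    exact ⟨(I, u), Subtype.ext (Subtype.ext h)⟩

/-- Pairs consisting of an ideal in the inverse class of `J` and a unit correspond to nonzero
elements of `J`. -/
noncomputable def invClassEquiv (J : Ideal (𝓞 K)) (hJ : J ≠ ⊥) :
    InvClass J × (𝓞 K)ˣ ≃ {a : J // (a : 𝓞 K) ≠ 0} :=
  Equiv.ofBijective (invClassMap J hJ) (bijective_invClassMap J hJ)

theorem invClassEquiv_apply (J : Ideal (𝓞 K)) (hJ : J ≠ ⊥) (p : InvClass J × (𝓞 K)ˣ) :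
    (((invClassEquiv J hJ p).1 : J) : 𝓞 K) = p.2 * p.1.gen := rfl

namespace HeckeChar

variable (H : HeckeChar K)

theorem toFun_unit (u : (𝓞 K)ˣ) : H.toFun (mixedEmbedding K ((u : 𝓞 K) : K)) = 1 := by
  rw [← H.onIdeal_span' _ u.ne_zero, Ideal.span_singleton_eq_top.2 u.isUnit, ← Ideal.one_eq_top,
    map_one]

theorem toFun_unit_mul (u : (𝓞 K)ˣ) {v : mixedSpace K} (hv : mixedEmbedding.norm v ≠ 0) :
    H.toFun (mixedEmbedding K ((u : 𝓞 K) : K) * v) = H.toFun v := by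
  rw [H.map_mul' _ _ (by simp [norm_mixedEmbedding_unit]) hv, toFun_unit, one_mul]

theorem cutoffFun_smul {η : ℝ → ℂ} {y : ℝ} (hy : 0 < y) {v : mixedSpace K}
    (hv : mixedEmbedding.norm v ≠ 0) :
    cutoffFun H.toFun η (y • v) =
      H.toFun v * unitWeight v * η (y ^ Module.finrank ℚ K * mixedEmbedding.norm v) := by
  rw [cutoffFun, H.map_smul' _ _ hy.ne' hv, unitWeight_smul hv hy.ne', mixedEmbedding.norm_smul,
    abs_of_pos hy]

theorem hasSum_invClass {J : Ideal (𝓞 K)} (hJ : J ≠ ⊥) {η : ℝ → ℂ} (hη0 : η 0 = 0)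
    (hηc : HasCompactSupport (cutoffFun H.toFun η)) {y : ℝ} (hy : 0 < y) :
    HasSum (fun I : InvClass J => H.onIdeal I.1 * H.onIdeal J *
      η (y ^ Module.finrank ℚ K * (Ideal.absNorm I.1 * Ideal.absNorm J)))
      (∑' l : Submodule.span ℤ (Set.range (fractionalIdealLatticeBasis K
      (FractionalIdeal.mk0 K ⟨J, mem_nonZeroDivisors_of_ne_zero hJ⟩))),
        cutoffFun H.toFun η (y • (0 + (l : mixedSpace K)))) := by
  set b := fractionalIdealLatticeBasis K
      (FractionalIdeal.mk0 K ⟨J, mem_nonZeroDivisors_of_ne_zero hJ⟩) with hb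
  have hs : Summable (fun l : Submodule.span ℤ (Set.range b) =>
      cutoffFun H.toFun η (y • (0 + (l : mixedSpace K)))) := by
    refine summable_of_finite_support ?_
    have hK : Bornology.IsBounded ((fun v : mixedSpace K => y⁻¹ • v) ''
        tsupport (cutoffFun H.toFun η)) :=
      (hηc.isCompact.image (continuous_const_smul _)).isBounded
    obtain ⟨R, hR⟩ := hK.subset_closedBall 0
    have hfin := ZSpan.setFinite_inter b (Metric.isBounded_closedBall (x := (0 : mixedSpace K))
      (r := R))
    refine Set.Finite.of_finite_image (f := Subtype.val) (hfin.subset ?_)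
      Subtype.val_injective.injOn
    rintro _ ⟨l, hl, rfl⟩
    refine ⟨hR ⟨y • (l : mixedSpace K), subset_tsupport _ (by simpa [Function.mem_support] using! hl), ?_⟩, l.2⟩
    simp [smul_smul, hy.ne']
  have h0 : cutoffFun H.toFun η (y • (0 + 0)) = 0 := by simp [cutoffFun, hη0]
  have h1 := hs.hasSum
  rw [← (idealLatticeEquiv J hJ).hasSum_iff] at h1
  have h2 : HasSum (fun a : {a : J // (a : 𝓞 K) ≠ 0} => cutoffFun H.toFun η
      (y • mixedEmbedding K (((a.1 : J) : 𝓞 K) : K)))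
      (∑' l : Submodule.span ℤ (Set.range b),
        cutoffFun H.toFun η (y • (0 + (l : mixedSpace K)))) := by
    refine (hasSum_subtype_iff_of_support_subset (s := {a : J | (a : 𝓞 K) ≠ 0})
      (f := fun a : J => cutoffFun H.toFun η (y • mixedEmbedding K ((a : 𝓞 K) : K))) ?_).2 ?_
    · intro a ha h
      apply ha
      have h' : (a : 𝓞 K) = 0 := h
      simp only [h']
      simpa using h0
    · refine h1.congr_fun fun a => ?_
      simp only [Function.comp_apply, zero_add]
      rfl
  rw [← (invClassEquiv J hJ).hasSum_iff] at h2
  refine h2.prod_fiberwise fun I => ?_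
  have hg := norm_mixedEmbedding_int_ne_zero (I.gen_ne_zero hJ)
  have h3 := (hasSum_unitWeight hg).mapL Complex.ofRealCLM
  have h4 := (h3.mul_left (H.toFun (mixedEmbedding K (I.gen : K)))).mul_right
    (η (y ^ Module.finrank ℚ K * mixedEmbedding.norm (mixedEmbedding K (I.gen : K))))
  have e : H.toFun (mixedEmbedding K (I.gen : K)) * Complex.ofRealCLM 1 *
      η (y ^ Module.finrank ℚ K * mixedEmbedding.norm (mixedEmbedding K (I.gen : K))) =
      H.onIdeal I.1 * H.onIdeal J *
      η (y ^ Module.finrank ℚ K * (Ideal.absNorm I.1 * Ideal.absNorm J)) := by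
    rw [← H.onIdeal_span' _ (I.gen_ne_zero hJ), I.span_gen, map_mul, norm_mixedEmbedding_int,
      I.span_gen, map_mul]
    simp
  rw [e] at h4
  refine h4.congr_fun fun u => ?_
  simp only [Function.comp_apply, invClassEquiv_apply, map_mul]
  rw [H.cutoffFun_smul hy, norm_unit_mul, H.toFun_unit_mul u hg]
  · rfl
  · rw [norm_unit_mul]; exact hg

end HeckeChar

end

section

open Topology

variable {K}

/-- An ideal representing a given class. -/
noncomputable def classRep (C : ClassGroup (𝓞 K)) : Ideal (𝓞 K) :=
  (ClassGroup.mk0_surjective C).choose.1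

theorem classRep_ne_bot (C : ClassGroup (𝓞 K)) : classRep C ≠ ⊥ :=
  nonZeroDivisors.ne_zero (ClassGroup.mk0_surjective C).choose.2

theorem mk0_classRep (C : ClassGroup (𝓞 K)) {h : classRep C ∈ nonZeroDivisors (Ideal (𝓞 K))} :
    ClassGroup.mk0 ⟨classRep C, h⟩ = C :=
  (ClassGroup.mk0_surjective C).choose_spec

theorem isPrincipal_mul_classRep_iff {I : Ideal (𝓞 K)} (hI : I ≠ ⊥) (C : ClassGroup (𝓞 K)) :
    Submodule.IsPrincipal (I * classRep C) ↔
      C = (ClassGroup.mk0 ⟨I, mem_nonZeroDivisors_of_ne_zero hI⟩)⁻¹ := by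
  have h := mem_nonZeroDivisors_of_ne_zero (classRep_ne_bot C)
  have hI' := mem_nonZeroDivisors_of_ne_zero hI
  rw [← ClassGroup.mk0_eq_one_iff (mul_mem hI' h), eq_inv_iff_mul_eq_one, mul_comm C]
  have e : ClassGroup.mk0 ⟨I, hI'⟩ * C =
      ClassGroup.mk0 ⟨I * classRep C, mul_mem hI' h⟩ := by
    conv_lhs => rw [← mk0_classRep C (h := h)]
    rw [← map_mul]; rfl
  rw [e]

variable (K) in
/-- The covolume of the ring of integers in the mixed space. -/
noncomputable def integerCovol : ℝ :=
  volume.real (ZSpan.fundamentalDomain (latticeBasis K))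

theorem integerCovol_pos : 0 < integerCovol K := by
  refine ENNReal.toReal_pos (ZSpan.measure_fundamentalDomain_ne_zero _) ?_
  exact (ZSpan.fundamentalDomain_isBounded _).measure_lt_top.ne

theorem volume_real_idealBasis {J : Ideal (𝓞 K)} (hJ : J ≠ ⊥) :
    volume.real (ZSpan.fundamentalDomain (fractionalIdealLatticeBasis K
      (FractionalIdeal.mk0 K ⟨J, mem_nonZeroDivisors_of_ne_zero hJ⟩))) =
      Ideal.absNorm J * integerCovol K := by
  rw [measureReal_def, volume_fundamentalDomain_fractionalIdealLatticeBasis, ENNReal.toReal_mul,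
    integerCovol, measureReal_def, ENNReal.toReal_ofReal (by
      exact_mod_cast FractionalIdeal.absNorm_nonneg _)]
  simp [FractionalIdeal.coeIdeal_absNorm]

namespace HeckeChar

variable (H : HeckeChar K)

/-- The smoothly weighted sum of a Hecke character over ideals. -/
noncomputable def smoothSum (η : ℝ → ℂ) (x : ℝ) : ℂ :=
  ∑' I : Ideal (𝓞 K), H.onIdeal I * η (x * Ideal.absNorm I)

/-- The leading coefficient in the asymptotics of `smoothSum`. -/
noncomputable def leadingCoeff (η : ℝ → ℂ) : ℂ :=
  (∑ C : ClassGroup (𝓞 K), (H.onIdeal (classRep C))⁻¹) *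
    ((∫ v, cutoffFun H.toFun η v) / integerCovol K)

theorem onIdeal_ne_zero {I : Ideal (𝓞 K)} (hI : I ≠ ⊥) : H.onIdeal I ≠ 0 := by
  intro h; have := H.norm_onIdeal' I hI; simp [h] at this

theorem onIdeal_bot : H.onIdeal ⊥ = 0 := map_zero _

theorem hasSum_smoothSum {η : ℝ → ℂ} (hη0 : η 0 = 0)
    (hηc : HasCompactSupport (cutoffFun H.toFun η)) {x : ℝ} (hx : 0 < x) :
    HasSum (fun I : Ideal (𝓞 K) => H.onIdeal I * η (x * Ideal.absNorm I))
      (∑ C : ClassGroup (𝓞 K), (H.onIdeal (classRep C))⁻¹ *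
        ∑' l : Submodule.span ℤ (Set.range (fractionalIdealLatticeBasis K
      (FractionalIdeal.mk0 K ⟨classRep C, mem_nonZeroDivisors_of_ne_zero (classRep_ne_bot C)⟩))),
        cutoffFun H.toFun η (((x / Ideal.absNorm (classRep C)) ^ ((Module.finrank ℚ K : ℝ)⁻¹)) •
          (0 + (l : mixedSpace K)))) := by
  have h1 : ∀ C : ClassGroup (𝓞 K), HasSum
      ({I : Ideal (𝓞 K) | I ≠ ⊥ ∧ Submodule.IsPrincipal (I * classRep C)}.indicator
        (fun I => H.onIdeal I * η (x * Ideal.absNorm I))) ((H.onIdeal (classRep C))⁻¹ *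
        ∑' l : Submodule.span ℤ (Set.range (fractionalIdealLatticeBasis K
      (FractionalIdeal.mk0 K ⟨classRep C, mem_nonZeroDivisors_of_ne_zero (classRep_ne_bot C)⟩))),
        cutoffFun H.toFun η (((x / Ideal.absNorm (classRep C)) ^ ((Module.finrank ℚ K : ℝ)⁻¹)) •
          (0 + (l : mixedSpace K)))) := by
    intro C
    have hJ := classRep_ne_bot C
    have hJN : (0 : ℝ) < Ideal.absNorm (classRep C) := by
      exact_mod_cast Nat.pos_of_ne_zero (by rwa [Ne, Ideal.absNorm_eq_zero_iff])
    rw [← hasSum_subtype_iff_indicator]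
    have h := (H.hasSum_invClass hJ hη0 hηc (y := (x / Ideal.absNorm (classRep C)) ^
      ((Module.finrank ℚ K : ℝ)⁻¹)) (by positivity)).mul_left (H.onIdeal (classRep C))⁻¹
    refine h.congr_fun fun I => ?_
    have h2 : ((x / Ideal.absNorm (classRep C)) ^ ((Module.finrank ℚ K : ℝ)⁻¹)) ^
        Module.finrank ℚ K = x / Ideal.absNorm (classRep C) :=
      Real.rpow_inv_natCast_pow (by positivity) Module.finrank_pos.ne'
    rw [h2]
    have h3 : x / Ideal.absNorm (classRep C) * (Ideal.absNorm I.1 * Ideal.absNorm (classRep C)) =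
      x * Ideal.absNorm I.1 := by field_simp
    rw [h3]
    have h4 := H.onIdeal_ne_zero hJ
    simp only [Function.comp_apply]
    field_simp
  refine (hasSum_sum fun C _ => h1 C).congr_fun fun I => ?_
  by_cases hI : I = ⊥
  · subst hI
    rw [onIdeal_bot, zero_mul, Finset.sum_eq_zero]
    intro C _
    simp
  · rw [Finset.sum_eq_single ((ClassGroup.mk0 ⟨I, mem_nonZeroDivisors_of_ne_zero hI⟩)⁻¹)]
    · rw [Set.indicator_of_mem]
      exact ⟨hI, (isPrincipal_mul_classRep_iff hI _).2 rfl⟩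
    · intro C _ hC
      rw [Set.indicator_of_notMem]
      exact fun h => hC ((isPrincipal_mul_classRep_iff hI C).1 h.2)
    · simp

theorem exists_norm_smoothSum_le {η : ℝ → ℂ} (hη : ContDiff ℝ (⊤ : ℕ∞) η) {ε R : ℝ} (hε : 0 < ε)
    (hη0 : ∀ x ≤ ε, η x = 0) (hηR : ∀ x, R ≤ x → η x = 0) (m : ℕ) :
    ∃ C, ∀ x : ℝ, 0 < x → x ≤ 1 → ‖x * H.smoothSum η x - H.leadingCoeff η‖ ≤ C * x ^ m := by
  have hf := contDiff_cutoffFun H.contDiffAt' hη hε hη0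
  have hfc := hasCompactSupport_cutoffFun H.toFun (hη0 0 hε.le) hηR
  have hJN : ∀ C : ClassGroup (𝓞 K), (1 : ℝ) ≤ Ideal.absNorm (classRep C) := fun C => by
    exact_mod_cast Nat.pos_of_ne_zero (by
      rw [Ne, Ideal.absNorm_eq_zero_iff]; exact classRep_ne_bot C)
  choose B hB using fun C : ClassGroup (𝓞 K) => exists_norm_latticeError_le
    (volume : Measure (mixedSpace K)) (fractionalIdealLatticeBasis K (FractionalIdeal.mk0 K
      ⟨classRep C, mem_nonZeroDivisors_of_ne_zero (classRep_ne_bot C)⟩))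
    (Module.finrank ℚ K * m) hf hfc
  refine ⟨∑ C, Ideal.absNorm (classRep C) * |B C|, fun x hx hx1 => ?_⟩
  rw [smoothSum, (H.hasSum_smoothSum (hη0 0 hε.le) hfc hx).tsum_eq, leadingCoeff, Finset.sum_mul,
    Finset.mul_sum, ← Finset.sum_sub_distrib, Finset.sum_mul]
  refine (norm_sum_le _ _).trans (Finset.sum_le_sum fun C _ => ?_)
  set N : ℝ := (Ideal.absNorm (classRep C) : ℝ) with hN
  have hN1 : 1 ≤ N := hJN C
  set y : ℝ := (x / N) ^ ((Module.finrank ℚ K : ℝ)⁻¹) with hy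
  have hxN : x / N ≤ 1 := (div_le_one (by linarith)).2 (hx1.trans hN1)
  have hy0 : 0 < y := by positivity
  have hy1 : y ≤ 1 := Real.rpow_le_one (by positivity) hxN (by positivity)
  have hyn : y ^ Module.finrank ℚ K = x / N :=
    Real.rpow_inv_natCast_pow (by positivity) Module.finrank_pos.ne'
  have h := hB C y hy0 hy1 0
  rw [latticeError, volume_real_idealBasis (classRep_ne_bot C), mixedEmbedding.finrank,
    ← Complex.ofReal_pow, hyn, pow_mul, hyn] at h
  set L := ∑' l : Submodule.span ℤ (Set.range (fractionalIdealLatticeBasis K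
      (FractionalIdeal.mk0 K ⟨classRep C, mem_nonZeroDivisors_of_ne_zero (classRep_ne_bot C)⟩))),
        cutoffFun H.toFun η (y • (0 + (l : mixedSpace K)))
  have hψ := H.norm_onIdeal' _ (classRep_ne_bot C)
  have hv := integerCovol_pos (K := K)
  have e : x * ((H.onIdeal (classRep C))⁻¹ * L) - (H.onIdeal (classRep C))⁻¹ *
      ((∫ v, cutoffFun H.toFun η v) / integerCovol K) = (H.onIdeal (classRep C))⁻¹ * (N *
      (((x / N : ℝ) : ℂ) * L - (∫ v, cutoffFun H.toFun η v) / ((N * integerCovol K : ℝ) : ℂ))) := by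
    have h1 : (N : ℂ) ≠ 0 := by exact_mod_cast (by linarith : N ≠ 0)
    have h2 : (integerCovol K : ℂ) ≠ 0 := by exact_mod_cast hv.ne'
    push_cast
    field_simp
  rw [e, norm_mul, norm_mul, norm_inv, hψ, inv_one, one_mul, Complex.norm_real, Real.norm_eq_abs,
    abs_of_nonneg (by linarith), mul_assoc]
  refine mul_le_mul_of_nonneg_left (h.trans ?_) (by linarith)
  refine mul_le_mul (le_abs_self _) ?_ (by positivity) (by positivity)
  exact pow_le_pow_left₀ (by positivity) (div_le_self hx.le hN1) m

end HeckeChar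

end

section

open Topology

variable {K}

section Measure

theorem abs_det_mulLeft (v : mixedSpace K) :
    |LinearMap.det (LinearMap.mulLeft ℝ v)| = mixedEmbedding.norm v := by
  have h : LinearMap.mulLeft ℝ v = LinearMap.prodMap
      (LinearMap.pi fun w => (LinearMap.mulLeft ℝ (v.1 w)) ∘ₗ LinearMap.proj w)
      (LinearMap.pi fun w => (LinearMap.mulLeft ℝ (v.2 w)) ∘ₗ LinearMap.proj w) := by
    ext x <;> simp
  have hc : ∀ z : ℂ, LinearMap.det (LinearMap.mulLeft ℝ z) = ‖z‖ ^ 2 := by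
    intro z
    have h1 := Algebra.norm_complex_apply z
    rw [Algebra.norm_apply] at h1
    rw [← Complex.normSq_eq_norm_sq, ← h1]
    rfl
  rw [h, LinearMap.det_prodMap, LinearMap.det_pi, LinearMap.det_pi]
  simp only [hc, LinearMap.det_mulLeft]
  rw [abs_mul, Finset.abs_prod, Finset.abs_prod, mixedEmbedding.norm_apply, prod_eq_prod_mul_prod]
  congr 1
  · exact Finset.prod_congr rfl fun w _ => by
      rw [mult_isReal, pow_one, normAtPlace_apply_of_isReal w.2, Real.norm_eq_abs]
  · exact Finset.prod_congr rfl fun w _ => by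
      rw [mult_isComplex, normAtPlace_apply_of_isComplex w.2, abs_of_nonneg (by positivity)]

theorem map_mul_volume {v : mixedSpace K} (hv : mixedEmbedding.norm v ≠ 0) :
    Measure.map (fun x => v * x) (volume : Measure (mixedSpace K)) =
      ENNReal.ofReal (mixedEmbedding.norm v)⁻¹ • volume := by
  have h1 := abs_det_mulLeft v
  have h0 : LinearMap.det (LinearMap.mulLeft ℝ v) ≠ 0 := by
    intro h; rw [h, abs_zero] at h1; exact hv h1.symm
  have h2 := Measure.map_linearMap_addHaar_eq_smul_addHaar
    (volume : Measure (mixedSpace K)) h0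
  rw [abs_inv, h1] at h2
  exact h2

theorem measurePreserving_mul {v : mixedSpace K} (hv : mixedEmbedding.norm v = 1) :
    MeasurePreserving (fun x => v * x) (volume : Measure (mixedSpace K)) volume := by
  refine ⟨by fun_prop, ?_⟩
  rw [map_mul_volume (by simp [hv]), hv]
  simp

/-- The inverse of an element of the mixed space of nonzero norm. -/
theorem exists_mul_eq_one {v : mixedSpace K} (hv : mixedEmbedding.norm v ≠ 0) :
    ∃ w, v * w = 1 := by
  have h := mixedEmbedding.norm_ne_zero_iff.1 hv
  refine ⟨(fun w => (v.1 w)⁻¹, fun w => (v.2 w)⁻¹), ?_⟩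
  ext w
  · have h1 : v.1 w ≠ 0 := fun h2 => h w.1 (by
      rw [normAtPlace_apply_of_isReal w.2]; simp [h2])
    simp [h1]
  · have h1 : v.2 w ≠ 0 := fun h2 => h w.1 (by
      rw [normAtPlace_apply_of_isComplex w.2]; simp [h2])
    simp [h1]

theorem integral_mul_left_eq {v : mixedSpace K} (hv : mixedEmbedding.norm v = 1)
    (f : mixedSpace K → ℂ) : ∫ x, f (v * x) = ∫ x, f x := by
  obtain ⟨w, hw⟩ := exists_mul_eq_one (v := v) (by simp [hv])
  have hm : MeasurableEmbedding (fun x : mixedSpace K => v * x) := by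
    refine Topology.IsClosedEmbedding.measurableEmbedding ?_
    refine Homeomorph.isClosedEmbedding (X := mixedSpace K) (Y := mixedSpace K)
      { toFun := fun x => v * x
        invFun := fun x => w * x
        left_inv := fun x => ?_
        right_inv := fun x => ?_
        continuous_toFun := by fun_prop
        continuous_invFun := by fun_prop }
    · change w * (v * x) = x
      rw [← mul_assoc, mul_comm w, hw, one_mul]
    · change v * (w * x) = x
      rw [← mul_assoc, hw, one_mul]
  exact (measurePreserving_mul hv).integral_comp hm f

theorem volume_norm_eq_zero : volume {v : mixedSpace K | mixedEmbedding.norm v = 0} = 0 := by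
  have h : {v : mixedSpace K | mixedEmbedding.norm v = 0} =
      ⋃ w : InfinitePlace K, {v | normAtPlace w v = 0} := by
    ext v; simp [mixedEmbedding.norm_eq_zero_iff]
  rw [h, measure_iUnion_null_iff]
  intro w
  obtain hw | hw := isReal_or_isComplex w
  · have h1 : {v : mixedSpace K | normAtPlace w v = 0} = (LinearMap.ker
        ((LinearMap.proj (R := ℝ) (φ := fun _ : {w : InfinitePlace K // w.IsReal} => ℝ)
          ⟨w, hw⟩) ∘ₗ LinearMap.fst ℝ _ ({w : InfinitePlace K // w.IsComplex} → ℂ)) :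
          Submodule ℝ (mixedSpace K)) := by
      ext v; simp [normAtPlace_apply_of_isReal hw]
    rw [h1]
    refine Measure.addHaar_submodule _ _ fun ht => ?_
    have h2 : (1 : mixedSpace K) ∈ (⊤ : Submodule ℝ (mixedSpace K)) := trivial
    rw [← ht] at h2
    simp at h2
  · have h1 : {v : mixedSpace K | normAtPlace w v = 0} = (LinearMap.ker
        ((LinearMap.proj (R := ℝ) (φ := fun _ : {w : InfinitePlace K // w.IsComplex} => ℂ)
          ⟨w, hw⟩) ∘ₗ LinearMap.snd ℝ ({w : InfinitePlace K // w.IsReal} → ℝ) _) :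
          Submodule ℝ (mixedSpace K)) := by
      ext v; simp [normAtPlace_apply_of_isComplex hw]
    rw [h1]
    refine Measure.addHaar_submodule _ _ fun ht => ?_
    have h2 : (1 : mixedSpace K) ∈ (⊤ : Submodule ℝ (mixedSpace K)) := trivial
    rw [← ht] at h2
    simp at h2

theorem ae_norm_ne_zero : ∀ᵐ v : mixedSpace K, mixedEmbedding.norm v ≠ 0 := by
  rw [ae_iff]; simpa using volume_norm_eq_zero (K := K)

theorem aestronglyMeasurable_of_continuousAt {E : Type*} [TopologicalSpace E]
    [TopologicalSpace.PseudoMetrizableSpace E] {f : mixedSpace K → E}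
    (hf : ∀ v, mixedEmbedding.norm v ≠ 0 → ContinuousAt f v)
    [SecondCountableTopologyEither (mixedSpace K) E] :
    AEStronglyMeasurable f volume := by
  have ho : IsOpen {v : mixedSpace K | mixedEmbedding.norm v ≠ 0} :=
    isOpen_ne_fun (mixedEmbedding.continuous_norm K) continuous_const
  have h1 : ContinuousOn f {v : mixedSpace K | mixedEmbedding.norm v ≠ 0} :=
    fun v hv => (hf v hv).continuousWithinAt
  have h2 := h1.aestronglyMeasurable (μ := volume) ho.measurableSet
  have h3 : volume.restrict {v : mixedSpace K | mixedEmbedding.norm v ≠ 0} = volume :=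
    Measure.restrict_eq_self_of_ae_mem ae_norm_ne_zero
  rwa [h3] at h2

theorem countable_units : Countable (𝓞 K)ˣ :=
  Countable.of_equiv _ (unitsEquiv (K := K))

/-- Integration against two weights which both sum to one over unit orbits gives the same result
for functions invariant under units. -/
theorem hasSum_integral_unit {p q : mixedSpace K → ℝ} {h : mixedSpace K → ℂ}
    (hq0 : ∀ v, 0 ≤ q v)
    (hqm : AEStronglyMeasurable q volume)
    (hqs : ∀ᵐ v, HasSum (fun u : (𝓞 K)ˣ => q (mixedEmbedding K ((u : 𝓞 K) : K) * v)) 1)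
    (hhp : Integrable fun v => h v * p v) :
    HasSum (fun u : (𝓞 K)ˣ => ∫ v, h v * p v * q (mixedEmbedding K ((u : 𝓞 K) : K) * v))
      (∫ v, h v * p v) := by
  have := countable_units (K := K)
  refine hasSum_integral_of_dominated_convergence
    (bound := fun u v => ‖h v * p v‖ * q (mixedEmbedding K ((u : 𝓞 K) : K) * v)) ?_ ?_ ?_ ?_ ?_
  · intro u
    exact hhp.1.mul (Complex.continuous_ofReal.comp_aestronglyMeasurable
      (hqm.comp_measurePreserving (measurePreserving_mul (norm_mixedEmbedding_unit u))))
  · intro u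
    refine Eventually.of_forall fun v => ?_
    rw [_root_.norm_mul, Complex.norm_real, Real.norm_of_nonneg (hq0 _)]
  · filter_upwards [hqs] with v hv using hv.summable.mul_left _
  · refine hhp.norm.congr ?_
    filter_upwards [hqs] with v hv
    rw [(hv.mul_left _).tsum_eq, mul_one]
  · filter_upwards [hqs] with v hv
    simpa using (Complex.hasSum_ofReal.2 hv).mul_left (h v * p v)

theorem integral_mul_weight_eq {p q : mixedSpace K → ℝ} {h : mixedSpace K → ℂ}
    (hp0 : ∀ v, 0 ≤ p v) (hq0 : ∀ v, 0 ≤ q v)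
    (hpm : AEStronglyMeasurable p volume) (hqm : AEStronglyMeasurable q volume)
    (hps : ∀ᵐ v, HasSum (fun u : (𝓞 K)ˣ => p (mixedEmbedding K ((u : 𝓞 K) : K) * v)) 1)
    (hqs : ∀ᵐ v, HasSum (fun u : (𝓞 K)ˣ => q (mixedEmbedding K ((u : 𝓞 K) : K) * v)) 1)
    (hinv : ∀ (u : (𝓞 K)ˣ) v, mixedEmbedding.norm v ≠ 0 →
      h (mixedEmbedding K ((u : 𝓞 K) : K) * v) = h v)
    (hhp : Integrable fun v => h v * p v) (hhq : Integrable fun v => h v * q v) :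
    ∫ v, h v * p v = ∫ v, h v * q v := by
  have h1 := hasSum_integral_unit hq0 hqm hqs hhp
  have h2 := hasSum_integral_unit hp0 hpm hps hhq
  refine h1.unique ?_
  rw [← (Equiv.inv (𝓞 K)ˣ).hasSum_iff] at h2
  refine h2.congr_fun fun u => ?_
  refine Eq.trans ?_ (integral_mul_left_eq (norm_mixedEmbedding_unit u) fun v =>
    h v * q v * p (mixedEmbedding K (((u⁻¹ : (𝓞 K)ˣ) : 𝓞 K) : K) * v))
  refine integral_congr_ae ?_
  filter_upwards [ae_norm_ne_zero] with v hv
  have h3 : mixedEmbedding K (((u⁻¹ : (𝓞 K)ˣ) : 𝓞 K) : K) *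
      (mixedEmbedding K ((u : 𝓞 K) : K) * v) = v := by
    rw [← mul_assoc, ← map_mul]
    simp
  rw [h3, hinv u v hv]
  ring

end Measure

end

section

open Topology

variable {K}

namespace HeckeChar

variable (H : HeckeChar K)

theorem aestronglyMeasurable_toFun : AEStronglyMeasurable H.toFun volume :=
  aestronglyMeasurable_of_continuousAt fun v hv => (H.contDiffAt' v hv).continuousAt

theorem _root_.aestronglyMeasurable_unitWeight :
    AEStronglyMeasurable (unitWeight : mixedSpace K → ℝ) volume :=
  aestronglyMeasurable_of_continuousAt fun v hv => (contDiffAt_unitWeight hv).continuousAt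

/-- A function supported on vectors of bounded norm becomes integrable after multiplication by the
unit weight. -/
theorem _root_.integrable_mul_unitWeight {h : mixedSpace K → ℂ} (hm : AEStronglyMeasurable h volume)
    {M : ℝ} (hM : ∀ v, mixedEmbedding.norm v ≠ 0 → ‖h v‖ ≤ M) {R : ℝ}
    (hR : ∀ v, R ≤ mixedEmbedding.norm v → h v = 0) :
    Integrable fun v => h v * unitWeight v := by
  obtain ⟨B, hB, hBn⟩ := exists_norm_le_of_unitWeight_ne_zero (K := K)
  have hi : Integrable (Set.indicator (Metric.closedBall (0 : mixedSpace K)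
      (B * |R| ^ ((Module.finrank ℚ K : ℝ)⁻¹))) fun _ => |M|) volume :=
    (integrable_indicator_iff Metric.isClosed_closedBall.measurableSet).2
      (integrableOn_const (isCompact_closedBall _ _).measure_lt_top.ne)
  refine hi.mono' (hm.mul (Complex.continuous_ofReal.comp_aestronglyMeasurable
    aestronglyMeasurable_unitWeight)) ?_
  filter_upwards [ae_norm_ne_zero] with v hv
  rw [Set.indicator_apply]
  split_ifs with hb
  · rw [_root_.norm_mul, Complex.norm_real, Real.norm_of_nonneg (unitWeight_nonneg _)]
    exact (mul_le_of_le_one_right (norm_nonneg _) (unitWeight_le_one _)).trans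
      ((hM v hv).trans (le_abs_self _))
  · rw [norm_le_zero_iff]
    by_contra hc
    have h2 : unitWeight v ≠ 0 := by
      have := right_ne_zero_of_mul hc
      exact_mod_cast this
    have h4 : mixedEmbedding.norm v ≤ |R| := by
      by_contra h5
      exact left_ne_zero_of_mul hc (hR _ ((le_abs_self R).trans (not_le.1 h5).le))
    refine hb (mem_closedBall_zero_iff.2 ((hBn v hv h2).trans ?_))
    gcongr
    exact mixedEmbedding.norm_nonneg _

theorem aestronglyMeasurable_cutoff {η : ℝ → ℂ} (hη : Measurable η) :
    AEStronglyMeasurable (fun v => H.toFun v * η (mixedEmbedding.norm v)) volume :=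
  H.aestronglyMeasurable_toFun.mul
    (hη.comp (mixedEmbedding.continuous_norm K).measurable).aestronglyMeasurable

theorem integral_cutoffFun_eq_zero {v₀ : mixedSpace K} (hv₀ : mixedEmbedding.norm v₀ ≠ 0)
    (h : H.toFun v₀ ≠ 1) {η : ℝ → ℂ} (hη : Measurable η) {M : ℝ} (hM : ∀ x, ‖η x‖ ≤ M) {R : ℝ}
    (hR : ∀ x, R ≤ x → η x = 0) : ∫ v, cutoffFun H.toFun η v = 0 := by
  obtain ⟨v₁, hv₁, h₁⟩ : ∃ v₁ : mixedSpace K, mixedEmbedding.norm v₁ = 1 ∧ H.toFun v₁ ≠ 1 := by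
    have hn : Module.finrank ℚ K ≠ 0 := Module.finrank_pos.ne'
    have hpos : 0 < mixedEmbedding.norm v₀ :=
      lt_of_le_of_ne (mixedEmbedding.norm_nonneg _) hv₀.symm
    have hc : 0 < mixedEmbedding.norm v₀ ^ (-(Module.finrank ℚ K : ℝ)⁻¹) :=
      Real.rpow_pos_of_pos hpos _
    refine ⟨mixedEmbedding.norm v₀ ^ (-(Module.finrank ℚ K : ℝ)⁻¹) • v₀, ?_, ?_⟩
    · rw [mixedEmbedding.norm_smul, abs_of_pos hc, ← Real.rpow_natCast, ← Real.rpow_mul hpos.le,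
        neg_mul, inv_mul_cancel₀ (by exact_mod_cast hn), Real.rpow_neg_one, inv_mul_cancel₀ hv₀]
    · rwa [H.map_smul' _ _ hc.ne' hv₀]
  have hv₁0 : mixedEmbedding.norm v₁ ≠ 0 := by simp [hv₁]
  set f : mixedSpace K → ℂ := fun v => H.toFun v * η (mixedEmbedding.norm v) with hf
  have hfm : ∀ v, mixedEmbedding.norm v ≠ 0 → f (v₁ * v) = H.toFun v₁ * f v := fun v hv => by
    simp only [hf]
    rw [H.map_mul' _ _ hv₁0 hv, map_mul, hv₁, one_mul, mul_assoc]
  have hi : Integrable fun v => f v * unitWeight v := by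
    refine integrable_mul_unitWeight (H.aestronglyMeasurable_cutoff hη) (M := M) (R := R) ?_ ?_
    · intro v hv
      simp only [hf]
      rw [_root_.norm_mul, H.norm_toFun' v hv, one_mul]
      exact hM _
    · intro v hv
      simp [hf, hR _ hv]
  have hχ : H.toFun v₁ ≠ 0 := fun h0 => by
    have := H.norm_toFun' v₁ hv₁0
    simp [h0] at this
  have hmp := measurePreserving_mul hv₁
  have hi2 : Integrable fun v => f v * unitWeight (v₁ * v) := by
    have h2 := (hmp.integrable_comp_of_integrable hi).const_mul (H.toFun v₁)⁻¹
    refine h2.congr ?_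
    filter_upwards [ae_norm_ne_zero] with v hv
    simp only [Function.comp, hfm v hv]
    field_simp
  have e1 := integral_mul_weight_eq (p := fun v => unitWeight (v₁ * v)) (q := unitWeight) (h := f)
    (fun _ => unitWeight_nonneg _) unitWeight_nonneg
    (aestronglyMeasurable_unitWeight.comp_measurePreserving hmp)
    aestronglyMeasurable_unitWeight ?_ ?_ ?_ hi2 hi
  · have e2 := integral_mul_left_eq hv₁ fun v => f v * unitWeight v
    have e3 : ∫ v, f (v₁ * v) * unitWeight (v₁ * v) =
        H.toFun v₁ * ∫ v, f v * unitWeight (v₁ * v) := by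
      rw [← integral_const_mul]
      refine integral_congr_ae ?_
      filter_upwards [ae_norm_ne_zero] with v hv
      rw [hfm v hv, mul_assoc]
    rw [e3, e1] at e2
    have e4 : ∫ v, cutoffFun H.toFun η v = ∫ v, f v * unitWeight v := by
      refine integral_congr_ae (Eventually.of_forall fun v => ?_)
      simp only [hf, cutoffFun]; ring
    rw [e4]
    have e5 : (H.toFun v₁ - 1) * ∫ v, f v * unitWeight v = 0 := by
      rw [sub_mul, e2]; ring
    exact (mul_eq_zero.1 e5).resolve_left (sub_ne_zero.2 h₁)
  · filter_upwards [ae_norm_ne_zero] with v hv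
    refine (hasSum_unitWeight (v := v₁ * v) (by simp [hv, hv₁])).congr_fun fun u => ?_
    rw [mul_left_comm]
  · filter_upwards [ae_norm_ne_zero] with v hv using hasSum_unitWeight hv
  · intro u v hv
    simp only [hf]
    rw [H.toFun_unit_mul u hv, map_mul, norm_mixedEmbedding_unit, one_mul]

theorem leadingCoeff_eq_zero_of_toFun {v₀ : mixedSpace K} (hv₀ : mixedEmbedding.norm v₀ ≠ 0)
    (h : H.toFun v₀ ≠ 1) {η : ℝ → ℂ} (hη : Measurable η) {M : ℝ} (hM : ∀ x, ‖η x‖ ≤ M) {R : ℝ}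
    (hR : ∀ x, R ≤ x → η x = 0) : H.leadingCoeff η = 0 := by
  rw [leadingCoeff, H.integral_cutoffFun_eq_zero hv₀ h hη hM hR, zero_div, mul_zero]

theorem leadingCoeff_eq_zero_of_onIdeal (h1 : ∀ v, mixedEmbedding.norm v ≠ 0 → H.toFun v = 1)
    {I : Ideal (𝓞 K)} (hI : I ≠ ⊥) (h : H.onIdeal I ≠ 1) (η : ℝ → ℂ) : H.leadingCoeff η = 0 := by
  have hspan : ∀ a : 𝓞 K, a ≠ 0 → H.onIdeal (Ideal.span {a}) = 1 := fun a ha => by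
    rw [H.onIdeal_span' a ha, h1 _ (norm_mixedEmbedding_int_ne_zero ha)]
  have hI' := mem_nonZeroDivisors_of_ne_zero hI
  have key : ∀ C : ClassGroup (𝓞 K), H.onIdeal (classRep (ClassGroup.mk0 ⟨I, hI'⟩ * C)) =
      H.onIdeal I * H.onIdeal (classRep C) := by
    intro C
    have h := mem_nonZeroDivisors_of_ne_zero (classRep_ne_bot C)
    have h' := mem_nonZeroDivisors_of_ne_zero
      (classRep_ne_bot (ClassGroup.mk0 ⟨I, hI'⟩ * C))
    have e : ClassGroup.mk0 ⟨I * classRep C, mul_mem hI' h⟩ =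
        ClassGroup.mk0 ⟨classRep (ClassGroup.mk0 ⟨I, hI'⟩ * C), h'⟩ := by
      rw [mk0_classRep]
      conv_rhs => rw [← mk0_classRep C (h := h)]
      rw [← map_mul]; rfl
    obtain ⟨x, y, hx, hy, hxy⟩ := ClassGroup.mk0_eq_mk0_iff.1 e
    have := congrArg H.onIdeal hxy
    rw [map_mul, map_mul, map_mul, hspan x hx, hspan y hy] at this
    simpa using this.symm
  have e1 : (∑ C : ClassGroup (𝓞 K), (H.onIdeal (classRep C))⁻¹) =
      (H.onIdeal I)⁻¹ * ∑ C : ClassGroup (𝓞 K), (H.onIdeal (classRep C))⁻¹ := by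
    conv_lhs => rw [← Equiv.sum_comp (Equiv.mulLeft (ClassGroup.mk0 ⟨I, hI'⟩))]
    rw [Finset.mul_sum]
    refine Finset.sum_congr rfl fun C _ => ?_
    rw [Equiv.coe_mulLeft, key, mul_inv]
  have e2 : ((H.onIdeal I)⁻¹ - 1) * ∑ C : ClassGroup (𝓞 K), (H.onIdeal (classRep C))⁻¹ = 0 := by
    rw [sub_mul, ← e1]; ring
  rw [leadingCoeff, (mul_eq_zero.1 e2).resolve_left, zero_mul]
  rw [sub_eq_zero, inv_eq_one]
  exact h

theorem leadingCoeff_eq_zero {I : Ideal (𝓞 K)} (hI : I ≠ ⊥) (h : H.onIdeal I ≠ 1) {η : ℝ → ℂ}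
    (hη : Measurable η) {M : ℝ} (hM : ∀ x, ‖η x‖ ≤ M) {R : ℝ}
    (hR : ∀ x, R ≤ x → η x = 0) : H.leadingCoeff η = 0 := by
  by_cases h1 : ∀ v, mixedEmbedding.norm v ≠ 0 → H.toFun v = 1
  · exact H.leadingCoeff_eq_zero_of_onIdeal h1 hI h η
  · push Not at h1
    obtain ⟨v, hv, hv1⟩ := h1
    exact H.leadingCoeff_eq_zero_of_toFun hv hv1 hη hM hR

theorem leadingCoeff_ne_zero (h : ∀ I, I ≠ ⊥ → H.onIdeal I = 1) {η : ℝ → ℝ}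
    (hη : ContDiff ℝ (⊤ : ℕ∞) fun t => (η t : ℂ)) (hpos : ∀ t, 0 ≤ η t)
    (hone : ∀ t, 1 ≤ t → t ≤ 2 → η t = 1) {ε R : ℝ} (hε : 0 < ε)
    (hη0 : ∀ x ≤ ε, η x = 0) (hηR : ∀ x, R ≤ x → η x = 0) :
    H.leadingCoeff (fun t => (η t : ℂ)) ≠ 0 := by
  intro h0
  have hη0' : ∀ x ≤ ε, (fun t => (η t : ℂ)) x = 0 := fun x hx => by simp [hη0 x hx]
  have hηR' : ∀ x, R ≤ x → (fun t => (η t : ℂ)) x = 0 := fun x hx => by simp [hηR x hx]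
  obtain ⟨C, hC⟩ := H.exists_norm_smoothSum_le hη hε hη0' hηR' 1
  simp only [h0, sub_zero, pow_one] at hC
  set κ : ℝ := (2 ^ nrRealPlaces K * (2 * Real.pi) ^ nrComplexPlaces K * regulator K *
    classNumber K) / (torsionOrder K * Real.sqrt |discr K|) with hκ
  have hκ0 : 0 < κ := dedekindZeta_residue_pos K
  have hlim := Ideal.tendsto_norm_le_div_atTop K
  rw [← hκ] at hlim
  have hlim2 : Tendsto (fun s : ℝ => 2 * ((Nat.card {I : Ideal (𝓞 K) //
      (Ideal.absNorm I : ℝ) ≤ 2 * s} : ℝ) / (2 * s)) - (Nat.card {I : Ideal (𝓞 K) //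
      (Ideal.absNorm I : ℝ) ≤ s} : ℝ) / s - C * s⁻¹) atTop (𝓝 (2 * κ - κ - C * 0)) :=
    (((hlim.comp (tendsto_id.const_mul_atTop two_pos)).const_mul 2).sub hlim).sub
      (tendsto_inv_atTop_zero.const_mul C)
  have hfin : ∀ s : ℝ, {I : Ideal (𝓞 K) | (Ideal.absNorm I : ℝ) ≤ s}.Finite := fun s => by
    refine (Ideal.finite_setOf_absNorm_le ⌊s⌋₊).subset fun I hI => ?_
    exact Nat.le_floor hI
  refine absurd (le_of_tendsto hlim2 (b := 0) ?_) (by linarith)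
  filter_upwards [eventually_ge_atTop 1] with s hs
  have hs0 : 0 < s := by linarith
  have hsum := H.hasSum_smoothSum (η := fun t => (η t : ℂ)) (hη0' 0 hε.le)
    (hasCompactSupport_cutoffFun (η := fun t => (η t : ℂ)) H.toFun (hη0' 0 hε.le) hηR')
    (inv_pos.2 hs0)
  have h1 := hC s⁻¹ (inv_pos.2 hs0) (inv_le_one_of_one_le₀ hs)
  rw [smoothSum, hsum.tsum_eq] at h1
  set S := ∑ C : ClassGroup (𝓞 K), (H.onIdeal (classRep C))⁻¹ *
        ∑' l : Submodule.span ℤ (Set.range (fractionalIdealLatticeBasis K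
      (FractionalIdeal.mk0 K ⟨classRep C, mem_nonZeroDivisors_of_ne_zero (classRep_ne_bot C)⟩))),
        _ with hS
  have hre : HasSum (fun I : Ideal (𝓞 K) =>
      (H.onIdeal I * (η (s⁻¹ * Ideal.absNorm I) : ℂ)).re) S.re := Complex.hasSum_re hsum
  have hle : (∑ I ∈ (hfin (2 * s)).toFinset \ (hfin s).toFinset, (1 : ℝ)) ≤ S.re := by
    refine le_trans (Finset.sum_le_sum fun I hI => ?_) (sum_le_hasSum _ (fun I _ => ?_) hre)
    · simp only [Finset.mem_sdiff, Set.Finite.mem_toFinset, Set.mem_setOf_eq, not_le] at hI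
      have hIb : I ≠ ⊥ := fun hb => by
        subst hb; simp at hI; linarith [hI.2]
      rw [h I hIb, one_mul, Complex.ofReal_re, hone]
      · rw [inv_mul_eq_div, le_div_iff₀ hs0]; linarith [hI.2]
      · rw [inv_mul_eq_div, div_le_iff₀ hs0]; linarith [hI.1]
    · by_cases hIb : I = ⊥
      · simp [hIb, onIdeal_bot, -Submodule.bot_coe]
      · rw [h I hIb, one_mul, Complex.ofReal_re]; exact hpos _
  have hSn : s⁻¹ * S.re ≤ C * s⁻¹ := by
    refine le_trans ?_ h1
    refine le_trans (le_of_eq ?_) (Complex.re_le_norm _)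
    rw [Complex.re_ofReal_mul]
  have hsub : (hfin s).toFinset ⊆ (hfin (2 * s)).toFinset := by
    intro I hI
    simp only [Set.Finite.mem_toFinset, Set.mem_setOf_eq] at hI ⊢
    linarith
  rw [Finset.sum_const, nsmul_eq_mul, mul_one, Finset.card_sdiff_of_subset hsub,
    Nat.cast_sub (Finset.card_le_card hsub)] at hle
  have hc : ∀ s : ℝ, Nat.card {I : Ideal (𝓞 K) // (Ideal.absNorm I : ℝ) ≤ s} =
      (hfin s).toFinset.card := fun s => Nat.card_eq_card_finite_toFinset (hfin s)
  rw [hc, hc]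
  have := mul_le_mul_of_nonneg_left hle (inv_pos.2 hs0).le
  have e : 2 * (((hfin (2 * s)).toFinset.card : ℝ) / (2 * s)) - ((hfin s).toFinset.card : ℝ) / s =
      s⁻¹ * (((hfin (2 * s)).toFinset.card : ℝ) - (hfin s).toFinset.card) := by
    field_simp
  rw [e]; linarith

end HeckeChar

end

section

open Topology

section MellinAux

theorem differentiable_mellin_of_isBigO {f : ℝ → ℂ} (hf : LocallyIntegrableOn f (Set.Ioi 0))
    {R : ℝ} (hR : ∀ x, R ≤ x → f x = 0)
    (h0 : ∀ m : ℕ, ∃ C, ∀ x : ℝ, 0 < x → x ≤ 1 → ‖(x : ℂ) * f x‖ ≤ C * x ^ m) (s : ℂ) :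
    DifferentiableAt ℂ (mellin f) s ∧ MellinConvergent f s := by
  have htop : f =O[atTop] fun x : ℝ => x ^ (-(s.re + 1)) := by
    refine (isBigO_zero (E' := ℂ) (fun x : ℝ => x ^ (-(s.re + 1))) atTop).congr' ?_ EventuallyEq.rfl
    filter_upwards [eventually_ge_atTop R] with x hx using (hR x hx).symm
  have hbot : f =O[𝓝[>] 0] fun x : ℝ => x ^ (-(s.re - 1)) := by
    obtain ⟨m, hm⟩ := exists_nat_ge (-(s.re - 1) + 1)
    obtain ⟨C, hC⟩ := h0 m
    refine IsBigO.of_bound |C| ?_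
    filter_upwards [Ioc_mem_nhdsGT one_pos] with x hx
    have h1 := hC x hx.1 hx.2
    rw [_root_.norm_mul, Complex.norm_real, Real.norm_of_nonneg hx.1.le] at h1
    rw [Real.norm_of_nonneg (Real.rpow_nonneg hx.1.le _)]
    have h2 : x ^ m ≤ x ^ (-(s.re - 1) + 1) := by
      rw [← Real.rpow_natCast]
      exact Real.rpow_le_rpow_of_exponent_ge hx.1 hx.2 hm
    rw [Real.rpow_add hx.1, Real.rpow_one] at h2
    have h3 : x * ‖f x‖ ≤ x * (|C| * x ^ (-(s.re - 1))) := by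
      calc x * ‖f x‖ ≤ C * x ^ m := h1
        _ ≤ |C| * x ^ m := mul_le_mul_of_nonneg_right (le_abs_self C) (by have := hx.1; positivity)
        _ ≤ |C| * (x ^ (-(s.re - 1)) * x) := by gcongr
        _ = _ := by ring
    exact le_of_mul_le_mul_left h3 hx.1
  exact ⟨mellin_differentiableAt_of_isBigO_rpow hf htop (by linarith) hbot (by linarith),
    mellinConvergent_of_isBigO_rpow hf htop (by linarith) hbot (by linarith)⟩

theorem exists_entire_mellin {S : ℝ → ℂ} (hS : ContinuousOn S (Set.Ioi 0)) {R : ℝ}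
    (hR : ∀ x, R ≤ x → S x = 0) {c : ℂ}
    (h0 : ∀ m : ℕ, ∃ C, ∀ x : ℝ, 0 < x → x ≤ 1 → ‖x * S x - c‖ ≤ C * x ^ m) :
    ∃ A : ℂ → ℂ, Differentiable ℂ A ∧ A 1 = c ∧
      ∀ s : ℂ, 1 < s.re → A s = (s - 1) * mellin S s := by
  set g : ℝ → ℂ := (Set.Ioc 0 1).indicator fun t => (t : ℂ) ^ (-1 : ℂ) with hg
  set f : ℝ → ℂ := fun x => S x - c * g x with hf
  have hgc : ContinuousOn (fun t : ℝ => (t : ℂ) ^ (-1 : ℂ)) (Set.Ioi 0) := by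
    intro t ht
    refine ((Complex.continuous_ofReal.continuousAt).cpow continuousAt_const ?_).continuousWithinAt
    exact Complex.ofReal_mem_slitPlane.2 ht
  have hgl : LocallyIntegrableOn g (Set.Ioi 0) volume :=
    fun x hx => by
      obtain ⟨u, hu, hu'⟩ := (hgc.locallyIntegrableOn (μ := volume) measurableSet_Ioi) x hx
      exact ⟨u, hu, hu'.indicator measurableSet_Ioc⟩
  have hfl : LocallyIntegrableOn f (Set.Ioi 0) volume :=
    (hS.locallyIntegrableOn measurableSet_Ioi).sub
      (fun x hx => by
        obtain ⟨u, hu, hu'⟩ := hgl x hx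
        exact ⟨u, hu, hu'.const_mul c⟩)
  have key := differentiable_mellin_of_isBigO hfl (R := max R 2) (fun x hx => ?_) (fun m => ?_)
  · refine ⟨fun s => (s - 1) * mellin f s + c, ?_, by simp, fun s hs => ?_⟩
    · intro s
      exact ((differentiableAt_id.sub_const 1).mul (key s).1).add_const c
    · have hm := hasMellin_cpow_Ioc (-1) (s := s) (by simp; linarith)
      have hs1 : s - 1 ≠ 0 := fun h => by
        have := congrArg Complex.re h; simp at this; linarith
      have h1 : MellinConvergent (fun x => c * g x) s := by
        simpa using hm.1.const_smul c
      have h2 : mellin (fun x => c * g x) s = c * (1 / (s + -1)) := by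
        have := mellin_const_smul g s c
        simp only [smul_eq_mul] at this
        rw [this, hm.2]
      have h3 : S = fun x => f x + c * g x := by ext x; simp [hf]
      have h4 := ((hasMellin_add (key s).2 h1)).2
      rw [← h3] at h4
      rw [h4, h2, ← sub_eq_add_neg]
      field_simp
  · have h1 : 1 < x := by linarith [(le_max_right R 2).trans hx]
    simp only [hf]
    rw [hR x ((le_max_left _ _).trans hx), hg, Set.indicator_of_notMem (by simp [h1])]
    simp
  · obtain ⟨C, hC⟩ := h0 m
    refine ⟨C, fun x hx hx1 => ?_⟩
    have h2 := hC x hx hx1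
    have hx0 : (x : ℂ) ≠ 0 := by exact_mod_cast hx.ne'
    simp only [hf, hg]
    rw [Set.indicator_of_mem (by exact ⟨hx, hx1⟩), Complex.cpow_neg_one]
    convert h2 using 2
    field_simp

/-- A smooth real function supported in a compact subset of the positive half line. -/
def IsCutoff (η : ℝ → ℝ) : Prop :=
  ContDiff ℝ (⊤ : ℕ∞) η ∧ (∃ ε, 0 < ε ∧ ∀ x ≤ ε, η x = 0) ∧ ∃ R, ∀ x, R ≤ x → η x = 0

variable {η : ℝ → ℝ}

theorem IsCutoff.contDiff_ofReal (h : IsCutoff η) :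
    ContDiff ℝ (⊤ : ℕ∞) fun t => (η t : ℂ) :=
  Complex.ofRealCLM.contDiff.comp h.1

theorem IsCutoff.exists_abs_le (h : IsCutoff η) : ∃ M, 0 ≤ M ∧ ∀ x, |η x| ≤ M := by
  obtain ⟨hc, ⟨ε, hε, h0⟩, R, hR⟩ := h
  obtain ⟨M, hM⟩ := (isCompact_Icc (a := ε) (b := R)).exists_bound_of_continuousOn
    hc.continuous.continuousOn
  refine ⟨|M|, abs_nonneg _, fun x => ?_⟩
  by_cases hx : x ∈ Set.Icc ε R
  · exact (hM x hx).trans (le_abs_self _)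
  · have : η x = 0 := by
      by_cases h1 : x ≤ ε
      · exact h0 x h1
      · exact hR x (by by_contra h2; exact hx ⟨(not_le.1 h1).le, (not_le.1 h2).le⟩)
    simp [this]

theorem IsCutoff.mellin (h : IsCutoff η) (s : ℂ) :
    DifferentiableAt ℂ (mellin fun t => (η t : ℂ)) s ∧ MellinConvergent (fun t => (η t : ℂ)) s := by
  obtain ⟨M, hM, hb⟩ := h.exists_abs_le
  have hc := h.contDiff_ofReal.continuous
  obtain ⟨-, ⟨ε, hε, h0⟩, R, hR⟩ := h
  refine differentiable_mellin_of_isBigO (R := R) (hc.locallyIntegrable.locallyIntegrableOn _)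
    (fun x hx => by simp [hR x hx]) (fun m => ⟨M / ε ^ m, fun x hx hx1 => ?_⟩) s
  by_cases h1 : x ≤ ε
  · rw [h0 x h1]; simp; positivity
  · rw [not_le] at h1
    rw [_root_.norm_mul, Complex.norm_real, Complex.norm_real, Real.norm_of_nonneg hx.le,
      Real.norm_eq_abs, div_mul_eq_mul_div, le_div_iff₀ (by positivity)]
    have h2 : ε ^ m ≤ x ^ m := by gcongr
    have h3 : x * |η x| ≤ 1 * M := by gcongr; exact hb x
    calc x * |η x| * ε ^ m ≤ 1 * M * x ^ m := by gcongr
      _ = M * x ^ m := by ring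

theorem exists_isCutoff_mellin_ne_zero (s : ℂ) :
    ∃ η : ℝ → ℝ, IsCutoff η ∧ _root_.mellin (fun t => (η t : ℂ)) s ≠ 0 := by
  by_contra hcon
  push Not at hcon
  have hgc : ContinuousOn (fun t : ℝ => (t : ℂ) ^ (s - 1)) (Set.Ioi 0) := by
    intro t ht
    refine ((Complex.continuous_ofReal.continuousAt).cpow continuousAt_const ?_).continuousWithinAt
    exact Complex.ofReal_mem_slitPlane.2 ht
  have h := isOpen_Ioi.ae_eq_zero_of_integral_contDiff_smul_eq_zero
    (hgc.locallyIntegrableOn (μ := volume) measurableSet_Ioi) ?_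
  · have h2 : (volume : Measure ℝ) (Set.Ioi 0) = 0 := by
      rw [ae_iff] at h
      refine measure_mono_null (fun t ht => ?_) h
      simp only [Set.mem_setOf_eq, Classical.not_imp]
      refine ⟨ht, ?_⟩
      rw [Complex.cpow_eq_zero_iff, not_and_or]
      left
      exact_mod_cast (show t ≠ 0 from (Set.mem_Ioi.1 ht).ne')
    simp at h2
  · intro g hg hgs hgU
    have hcut : IsCutoff g := by
      have hK : IsCompact (tsupport g) := hgs
      refine ⟨hg, ?_, ?_⟩
      · obtain ⟨δ, hδ, hδ'⟩ := hK.exists_thickening_subset_open isOpen_Ioi hgU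
        refine ⟨δ / 2, by positivity, fun x hx => ?_⟩
        by_contra hne
        have hx' : x ∈ tsupport g := subset_tsupport g hne
        have h1 : (x - δ / 2) ∈ Metric.thickening δ (tsupport g) := by
          rw [Metric.mem_thickening_iff]
          refine ⟨x, hx', ?_⟩
          rw [Real.dist_eq, abs_lt]; constructor <;> linarith
        have := hδ' h1
        simp at this; linarith
      · obtain ⟨R, hR⟩ := hK.bddAbove
        refine ⟨R + 1, fun x hx => ?_⟩
        by_contra hne
        have := hR (subset_tsupport g hne)
        linarith
    rw [← hcon g hcut, _root_.mellin, ← integral_indicator measurableSet_Ioi]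
    refine integral_congr_ae (Eventually.of_forall fun x => ?_)
    simp only [Set.indicator_apply]
    split_ifs with hx
    · simp [mul_comm]
    · have : g x = 0 := by
        by_contra hne
        exact hx (hgU (subset_tsupport g hne))
      simp [this]

theorem exists_isCutoff_eq_one : ∃ η : ℝ → ℝ, IsCutoff η ∧ (∀ t, 0 ≤ η t) ∧
    ∀ t, 1 ≤ t → t ≤ 2 → η t = 1 := by
  refine ⟨fun t => Real.smoothTransition (2 * t - 1) * (1 - Real.smoothTransition (t - 2)),
    ⟨?_, ⟨1 / 2, by norm_num, fun x hx => ?_⟩, 3, fun x hx => ?_⟩, fun t => ?_, fun t h1 h2 => ?_⟩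
  · have h := Real.smoothTransition.contDiff (n := ⊤)
    exact (h.comp (f := fun t : ℝ => 2 * t - 1) (by fun_prop)).mul
      (contDiff_const.sub (h.comp (f := fun t : ℝ => t - 2) (by fun_prop)))
  · beta_reduce
    rw [Real.smoothTransition.zero_of_nonpos (by linarith), zero_mul]
  · beta_reduce
    rw [Real.smoothTransition.one_of_one_le (x := x - 2) (by linarith), sub_self, mul_zero]
  · exact mul_nonneg (Real.smoothTransition.nonneg _)
      (sub_nonneg.2 (Real.smoothTransition.le_one _))
  · beta_reduce
    rw [Real.smoothTransition.one_of_one_le (by linarith),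
      Real.smoothTransition.zero_of_nonpos (by linarith)]
    simp

/-- Quotients of entire functions which agree on a half plane and whose denominators have no common
zero glue to one entire function. -/
theorem exists_entire_of_quotients {ι : Type*} {A B : ι → ℂ → ℂ}
    (hA : ∀ i, Differentiable ℂ (A i)) (hB : ∀ i, Differentiable ℂ (B i)) {L : ℂ → ℂ}
    (hL : ∀ i s, 1 < s.re → A i s = L s * B i s) (hne : ∀ s, ∃ i, B i s ≠ 0) :
    ∃ Λ : ℂ → ℂ, Differentiable ℂ Λ ∧ (∀ s, 1 < s.re → Λ s = L s) ∧
      ∀ i s, A i s = Λ s * B i s := by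
  have hcross : ∀ i j s, A i s * B j s = A j s * B i s := by
    intro i j
    have h := AnalyticOnNhd.eq_of_eventuallyEq (z₀ := 2)
      (((hA i).mul (hB j)).differentiableOn.analyticOnNhd isOpen_univ)
      (((hA j).mul (hB i)).differentiableOn.analyticOnNhd isOpen_univ) ?_
    · intro s; exact congrFun h s
    · have h2 : {s : ℂ | 1 < s.re} ∈ 𝓝 (2 : ℂ) :=
        (isOpen_lt continuous_const Complex.continuous_re).mem_nhds (by simp)
      filter_upwards [h2] with s hs
      simp only [Pi.mul_apply]
      rw [hL i s hs, hL j s hs]; ring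
  choose i hi using hne
  have hΛ : ∀ j s, A j s = A (i s) s / B (i s) s * B j s := fun j s => by
    rw [div_mul_eq_mul_div, eq_div_iff (hi s)]; exact hcross _ _ _
  refine ⟨fun s => A (i s) s / B (i s) s, fun s => ?_, fun s hs => ?_, hΛ⟩
  · have h1 : (fun z => A (i z) z / B (i z) z) =ᶠ[𝓝 s] fun z => A (i s) z / B (i s) z := by
      have := (hB (i s)).continuous.continuousAt.eventually_ne (hi s)
      filter_upwards [this] with z hz
      rw [eq_div_iff hz]; exact (hΛ _ _).symm
    exact ((hA _ _).div (hB _ _) (hi s)).congr_of_eventuallyEq h1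
  · beta_reduce
    rw [hL _ s hs, mul_div_cancel_right₀ _ (hi s)]

end MellinAux

end

section

open Topology

section Summable

theorem countable_ideal : Countable (Ideal (𝓞 K)) := by
  have hfin : ∀ n : ℕ, Countable {I : Ideal (𝓞 K) // Ideal.absNorm I = n} := fun n =>
    (Ideal.finite_setOfPred_absNorm_eq n).countable
  exact Countable.of_equiv _ (Equiv.sigmaFiberEquiv (Ideal.absNorm (S := 𝓞 K)))

theorem summable_absNorm_rpow {σ : ℝ} (hσ : 1 < σ) :
    Summable fun I : Ideal (𝓞 K) => (Ideal.absNorm I : ℝ) ^ (-σ) := by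
  set f : ℕ → ℝ := fun n => Nat.card {I : Ideal (𝓞 K) // Ideal.absNorm I = n} with hf
  have hsum : ∀ n : ℕ, ∑ k ∈ Finset.Icc 1 n, f k = Nat.card
      {I : nonZeroDivisors (Ideal (𝓞 K)) // (Ideal.absNorm (I : Ideal (𝓞 K)) : ℝ) ≤ n} := by
    intro n
    simp only [hf, Nat.cast_le, ← Nat.cast_sum]
    congr 1
    rw [← add_left_inj 1, ← Ideal.card_norm_le_eq_card_norm_le_add_one,
      show Finset.Icc 1 n = Finset.Ioc 0 n from Finset.Icc_succ_left_eq_Ioc _ _,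
      show 1 = Nat.card {I : Ideal (𝓞 K) // Ideal.absNorm I = 0} by
        simp [Ideal.absNorm_eq_zero_iff],
      Finset.sum_Ioc_add_eq_sum_Icc (n.zero_le),
      ← Finset.card_preimage_eq_sum_card_image_eq
        (fun k _ ↦ Ideal.finite_setOfPred_absNorm_eq k)]
    simp [Set.coe_eq_subtype]
  have hO : (fun n : ℕ => ∑ k ∈ Finset.Icc 1 n, f k) =O[atTop] fun n : ℕ => (n : ℝ) ^ (1 : ℝ) := by
    have h1 := (Ideal.tendsto_norm_le_div_atTop₀ K).comp tendsto_natCast_atTop_atTop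
    have h2 := h1.isBigO_one ℝ
    refine IsBigO.congr' (f₁ := fun n : ℕ => (Nat.card {I : nonZeroDivisors (Ideal (𝓞 K)) //
      (Ideal.absNorm (I : Ideal (𝓞 K)) : ℝ) ≤ n} : ℝ) / n * n)
      (h2.mul (isBigO_refl (fun n : ℕ => (n : ℝ)) atTop)) ?_ ?_
    · filter_upwards [eventually_gt_atTop 0] with n hn
      rw [hsum, div_mul_cancel₀]
      exact_mod_cast hn.ne'
    · exact Eventually.of_forall fun n => by simp
  have hL := LSeriesSummable_of_sum_norm_bigO_and_nonneg (s := (σ : ℂ)) hO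
    (fun n => Nat.cast_nonneg _) zero_le_one (by simpa using hσ)
  have hL' := hL.norm
  rw [← (Equiv.sigmaFiberEquiv (Ideal.absNorm (S := 𝓞 K))).summable_iff]
  refine (summable_sigma_of_nonneg fun _ => Real.rpow_nonneg (Nat.cast_nonneg _) _).2 ?_
  have hfin : ∀ n : ℕ, Finite {I : Ideal (𝓞 K) // Ideal.absNorm I = n} := fun n =>
    Ideal.finite_setOfPred_absNorm_eq n
  refine ⟨fun n => ?_, hL'.congr fun n => ?_⟩
  · have := hfin n
    exact Summable.of_finite
  · have := hfin n
    have := Fintype.ofFinite {I : Ideal (𝓞 K) // Ideal.absNorm I = n}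
    have h2 : ∀ y : {I : Ideal (𝓞 K) // Ideal.absNorm I = n},
        ((fun I : Ideal (𝓞 K) => (Ideal.absNorm I : ℝ) ^ (-σ)) ∘
          Equiv.sigmaFiberEquiv (Ideal.absNorm (S := 𝓞 K))) ⟨n, y⟩ = (n : ℝ) ^ (-σ) := by
      intro y
      simp [Equiv.sigmaFiberEquiv, y.2]
    refine Eq.trans ?_ (tsum_congr h2).symm
    rw [tsum_fintype, Finset.sum_const, Finset.card_univ, nsmul_eq_mul, LSeries.norm_term_eq]
    split_ifs with hn
    · simp [hn, Real.zero_rpow (show -σ ≠ 0 by linarith)]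
    · rw [Complex.ofReal_re, Real.rpow_neg (Nat.cast_nonneg _), ← div_eq_mul_inv]
      simp [hf, Nat.card_eq_fintype_card]

end Summable

namespace HeckeChar

variable {K} (H : HeckeChar K)

/-- The L-series of a character on ideals. -/
noncomputable def L (s : ℂ) : ℂ :=
  ∑' I : Ideal (𝓞 K), H.onIdeal I * (Ideal.absNorm I : ℂ) ^ (-s)

theorem _root_.absNorm_pos {I : Ideal (𝓞 K)} (hI : I ≠ ⊥) : 0 < Ideal.absNorm I :=
  Nat.pos_of_ne_zero (by rwa [Ne, Ideal.absNorm_eq_zero_iff])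

theorem norm_term_le (I : Ideal (𝓞 K)) (s : ℂ) :
    ‖H.onIdeal I * (Ideal.absNorm I : ℂ) ^ (-s)‖ ≤ (Ideal.absNorm I : ℝ) ^ (-s.re) := by
  by_cases hI : I = ⊥
  · rw [hI, onIdeal_bot, zero_mul, norm_zero]; positivity
  · rw [_root_.norm_mul, H.norm_onIdeal' I hI, one_mul,
      Complex.norm_natCast_cpow_of_pos (absNorm_pos hI), Complex.neg_re]

theorem summable_L {s : ℂ} (hs : 1 < s.re) :
    Summable fun I : Ideal (𝓞 K) => H.onIdeal I * (Ideal.absNorm I : ℂ) ^ (-s) :=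
  (summable_absNorm_rpow K hs).of_norm_bounded fun I => H.norm_term_le I s

theorem smoothSum_eq_zero {η : ℝ → ℂ} {R : ℝ} (hηR : ∀ x, R ≤ x → η x = 0) {x : ℝ}
    (hx : max R 0 ≤ x) : H.smoothSum η x = 0 := by
  rw [smoothSum, ← tsum_zero]
  refine tsum_congr fun I => ?_
  by_cases hI : I = ⊥
  · rw [hI, onIdeal_bot, zero_mul]
  · have h1 : (1 : ℝ) ≤ Ideal.absNorm I := by exact_mod_cast absNorm_pos hI
    have h0 : 0 ≤ x := (le_max_right _ _).trans hx
    rw [hηR, mul_zero]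
    nlinarith [(le_max_left _ _).trans hx]

theorem continuousOn_smoothSum {η : ℝ → ℂ} (hη : Continuous η) {R : ℝ}
    (hηR : ∀ x, R ≤ x → η x = 0) : ContinuousOn (H.smoothSum η) (Set.Ioi 0) := by
  intro x₀ hx₀
  rw [Set.mem_Ioi] at hx₀
  have hfin : {I : Ideal (𝓞 K) | (Ideal.absNorm I : ℝ) ≤ 2 * |R| / x₀}.Finite := by
    refine (Ideal.finite_setOf_absNorm_le ⌊2 * |R| / x₀⌋₊).subset fun I hI => ?_
    exact Nat.le_floor hI
  have h1 : H.smoothSum η =ᶠ[𝓝 x₀]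
      fun x => ∑ I ∈ hfin.toFinset, H.onIdeal I * η (x * Ideal.absNorm I) := by
    filter_upwards [Ioi_mem_nhds (show x₀ / 2 < x₀ by linarith)] with x hx
    rw [Set.mem_Ioi] at hx
    rw [smoothSum]
    refine tsum_eq_sum fun I hI => ?_
    simp only [Set.Finite.mem_toFinset, Set.mem_setOf_eq, not_le] at hI
    rw [div_lt_iff₀ hx₀] at hI
    rw [hηR, mul_zero]
    have h2 : x₀ / 2 * Ideal.absNorm I ≤ x * Ideal.absNorm I := by gcongr
    linarith [le_abs_self R]
  refine ContinuousAt.continuousWithinAt ?_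
  refine ContinuousAt.congr ?_ h1.symm
  exact Continuous.continuousAt (by fun_prop)

theorem mellin_smoothSum {η : ℝ → ℝ} (hη : IsCutoff η) {s : ℂ} (hs : 1 < s.re) :
    mellin (H.smoothSum fun t => (η t : ℂ)) s = H.L s * mellin (fun t => (η t : ℂ)) s := by
  have := countable_ideal K
  set e : ℝ → ℂ := fun t => (η t : ℂ) with he
  set F : Ideal (𝓞 K) → ℝ → ℂ := fun I t =>
    (t : ℂ) ^ (s - 1) • (H.onIdeal I * e (t * Ideal.absNorm I)) with hF
  have hFe : ∀ I t, F I t = H.onIdeal I *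
      ((t : ℂ) ^ (s - 1) • e (Ideal.absNorm I * t)) := fun I t => by
    simp only [hF, smul_eq_mul, mul_comm t]; ring
  have hconv := (hη.mellin s).2
  have hFi : ∀ I, Integrable (F I) (volume.restrict (Set.Ioi 0)) := by
    intro I
    by_cases hI : I = ⊥
    · have h0 : F I = fun _ => 0 := by
        ext t; rw [hFe, hI, onIdeal_bot, zero_mul]
      rw [h0]
      exact integrable_zero _ _ _
    · have hN : (0 : ℝ) < Ideal.absNorm I := by exact_mod_cast absNorm_pos hI
      have := ((MellinConvergent.comp_mul_left (s := s) hN).2 hconv).const_mul (H.onIdeal I)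
      refine this.congr (Eventually.of_forall fun t => ?_)
      rw [hFe]
  have hnorm : ∀ I, ∫ t in Set.Ioi 0, ‖F I t‖ ≤ (Ideal.absNorm I : ℝ) ^ (-s.re) *
      ∫ t in Set.Ioi 0, t ^ (s.re - 1) * |η t| := by
    intro I
    by_cases hI : I = ⊥
    · have : ∀ t, ‖F I t‖ = 0 := fun t => by rw [hFe, hI, onIdeal_bot, zero_mul, norm_zero]
      simp only [this, integral_zero]
      refine mul_nonneg (by positivity) (setIntegral_nonneg measurableSet_Ioi fun t ht => ?_)
      rw [Set.mem_Ioi] at ht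
      positivity
    · have hN : (0 : ℝ) < Ideal.absNorm I := by exact_mod_cast absNorm_pos hI
      have h1 := integral_comp_mul_left_Ioi (fun t => t ^ (s.re - 1) * |η t|) 0 hN
      rw [mul_zero, smul_eq_mul] at h1
      have h2 : ∫ t in Set.Ioi 0, ‖F I t‖ = ∫ t in Set.Ioi 0, (Ideal.absNorm I : ℝ) ^ (-(s.re - 1)) *
          ((Ideal.absNorm I * t) ^ (s.re - 1) * |η (Ideal.absNorm I * t)|) := by
        refine setIntegral_congr_fun measurableSet_Ioi fun t ht => ?_
        rw [Set.mem_Ioi] at ht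
        simp only [hFe]
        rw [_root_.norm_mul, H.norm_onIdeal' I hI, one_mul, _root_.norm_smul,
          Complex.norm_cpow_eq_rpow_re_of_pos ht, Complex.norm_real, Real.norm_eq_abs,
          Real.mul_rpow hN.le ht.le, Real.rpow_neg hN.le]
        simp only [Complex.sub_re, Complex.one_re]
        field_simp
      rw [h2, integral_const_mul, h1, ← mul_assoc]
      have h3 : (Ideal.absNorm I : ℝ) ^ (-(s.re - 1)) * (Ideal.absNorm I : ℝ)⁻¹ =
          (Ideal.absNorm I : ℝ) ^ (-s.re) := by
        rw [← Real.rpow_neg_one, ← Real.rpow_add hN]; ring_nf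
      rw [h3]
  have hsum : Summable fun I => ∫ t in Set.Ioi 0, ‖F I t‖ :=
    ((summable_absNorm_rpow K hs).mul_right _).of_nonneg_of_le
      (fun I => integral_nonneg fun _ => norm_nonneg _) hnorm
  have h := hasSum_integral_of_summable_integral_norm hFi hsum
  have hval : ∀ I, ∫ t in Set.Ioi 0, F I t =
      H.onIdeal I * (Ideal.absNorm I : ℂ) ^ (-s) * mellin e s := by
    intro I
    by_cases hI : I = ⊥
    · simp only [hFe, hI, onIdeal_bot, zero_mul, integral_zero]
    · have hN : (0 : ℝ) < Ideal.absNorm I := by exact_mod_cast absNorm_pos hI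
      have h1 := mellin_comp_mul_left e s hN
      simp only [hFe]
      rw [integral_const_mul, mul_assoc]
      congr 1
  simp only [hval] at h
  rw [mellin, L, ← ((H.summable_L hs).hasSum.mul_right (mellin e s)).unique h |>.symm]
  refine setIntegral_congr_fun measurableSet_Ioi fun t ht => ?_
  simp only [hF, smoothSum]
  rw [tsum_const_smul'']

theorem exists_completedL : ∃ Λ : ℂ → ℂ, Differentiable ℂ Λ ∧
    (∀ s, 1 < s.re → Λ s = (s - 1) * H.L s) ∧ ∀ η : ℝ → ℝ, IsCutoff η →
      H.leadingCoeff (fun t => (η t : ℂ)) = Λ 1 * mellin (fun t => (η t : ℂ)) 1 := by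
  have h : ∀ η : {η : ℝ → ℝ // IsCutoff η}, ∃ A : ℂ → ℂ, Differentiable ℂ A ∧
      A 1 = H.leadingCoeff (fun t => (η.1 t : ℂ)) ∧
      ∀ s : ℂ, 1 < s.re → A s = (s - 1) * mellin (H.smoothSum fun t => (η.1 t : ℂ)) s := by
    rintro ⟨η, hη⟩
    have hc := hη.contDiff_ofReal
    obtain ⟨-, ⟨ε, hε, h0⟩, R, hR⟩ := hη
    have hR' : ∀ x, R ≤ x → (fun t => (η t : ℂ)) x = 0 := fun x hx => by simp [hR x hx]
    refine exists_entire_mellin (H.continuousOn_smoothSum hc.continuous hR')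
      (fun x hx => H.smoothSum_eq_zero hR' hx) fun m => ?_
    exact H.exists_norm_smoothSum_le hc hε (fun x hx => by simp [h0 x hx]) hR' m
  choose A hA hA1 hAs using h
  obtain ⟨Λ, h1, h2, h3⟩ := exists_entire_of_quotients
    (ι := {η : ℝ → ℝ // IsCutoff η}) (A := A) (B := fun η => mellin fun t => (η.1 t : ℂ))
    (L := fun s => (s - 1) * H.L s) hA (fun η s => (η.2.mellin s).1)
    (fun η s hs => by rw [hAs η s hs, H.mellin_smoothSum η.2 hs]; ring)
    (fun s => by
      obtain ⟨η, hη, hne⟩ := exists_isCutoff_mellin_ne_zero s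
      exact ⟨⟨η, hη⟩, hne⟩)
  exact ⟨Λ, h1, h2, fun η hη => by rw [← hA1 ⟨η, hη⟩, h3 ⟨η, hη⟩ 1]⟩

/-- The entire function `(s - 1) L(s)`. -/
noncomputable def completedL : ℂ → ℂ := H.exists_completedL.choose

theorem differentiable_completedL : Differentiable ℂ H.completedL :=
  H.exists_completedL.choose_spec.1

theorem completedL_eq {s : ℂ} (hs : 1 < s.re) : H.completedL s = (s - 1) * H.L s :=
  H.exists_completedL.choose_spec.2.1 s hs

theorem leadingCoeff_eq {η : ℝ → ℝ} (hη : IsCutoff η) : H.leadingCoeff (fun t => (η t : ℂ)) =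
    H.completedL 1 * mellin (fun t => (η t : ℂ)) 1 :=
  H.exists_completedL.choose_spec.2.2 η hη

theorem completedL_one_eq_zero {I : Ideal (𝓞 K)} (hI : I ≠ ⊥) (h : H.onIdeal I ≠ 1) :
    H.completedL 1 = 0 := by
  obtain ⟨η, hη, hne⟩ := exists_isCutoff_mellin_ne_zero 1
  have h1 := H.leadingCoeff_eq hη
  obtain ⟨M, -, hM⟩ := hη.exists_abs_le
  have hc := hη.contDiff_ofReal.continuous
  obtain ⟨-, -, R, hR⟩ := hη
  rw [H.leadingCoeff_eq_zero hI h hc.measurable (M := M) (fun x => by simpa using hM x) (R := R)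
    (fun x hx => by simp [hR x hx])] at h1
  exact (mul_eq_zero.1 h1.symm).resolve_right hne

theorem completedL_one_ne_zero (h : ∀ I, I ≠ ⊥ → H.onIdeal I = 1) : H.completedL 1 ≠ 0 := by
  obtain ⟨η, hη, hpos, hone⟩ := exists_isCutoff_eq_one
  intro h0
  have h1 := H.leadingCoeff_eq hη
  rw [h0, zero_mul] at h1
  obtain ⟨ε, hε, h2⟩ := hη.2.1
  obtain ⟨R, hR⟩ := hη.2.2
  exact H.leadingCoeff_ne_zero h hη.contDiff_ofReal hpos hone hε h2 hR h1

end HeckeChar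

end

section

open Topology

section DirichletSeries

variable {ι : Type*} {b : ι → ℂ} {N : ι → ℝ}

theorem log_mul_rpow_le {x : ℝ} (hx : 1 ≤ x) {ε : ℝ} (hε : 0 < ε) (σ : ℝ) :
    Real.log x * x ^ (-σ) ≤ ε⁻¹ * x ^ (-(σ - ε)) := by
  have h0 : 0 < x := by linarith
  have h1 := Real.log_le_rpow_div h0.le hε
  calc Real.log x * x ^ (-σ) ≤ x ^ ε / ε * x ^ (-σ) := by gcongr
    _ = ε⁻¹ * x ^ (-(σ - ε)) := by
      rw [show -(σ - ε) = ε + -σ by ring, Real.rpow_add h0]; ring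

theorem summable_norm_mul_log (hN : ∀ i, b i ≠ 0 → 1 ≤ N i)
    (hs : ∀ σ : ℝ, 1 < σ → Summable fun i => ‖b i‖ * N i ^ (-σ)) {σ : ℝ} (hσ : 1 < σ) :
    Summable fun i => ‖b i * (Real.log (N i) : ℂ)‖ * N i ^ (-σ) := by
  refine ((hs ((1 + σ) / 2) (by linarith)).mul_left ((σ - 1) / 2)⁻¹).of_nonneg_of_le
    (fun i => ?_) fun i => ?_
  · by_cases hb : b i = 0
    · simp [hb]
    · have := hN i hb
      positivity
  · by_cases hb : b i = 0
    · simp [hb]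
    · have h1 := hN i hb
      rw [_root_.norm_mul, Complex.norm_real, Real.norm_eq_abs, abs_of_nonneg (Real.log_nonneg h1)]
      have := log_mul_rpow_le h1 (show 0 < (σ - 1) / 2 by linarith) σ
      rw [show σ - (σ - 1) / 2 = (1 + σ) / 2 by ring] at this
      calc _ = ‖b i‖ * (Real.log (N i) * N i ^ (-σ)) := by ring
        _ ≤ ‖b i‖ * (((σ - 1) / 2)⁻¹ * N i ^ (-((1 + σ) / 2))) := by gcongr
        _ = _ := by ring

theorem norm_mul_cpow_le (hN : ∀ i, b i ≠ 0 → 1 ≤ N i) {σ : ℝ} {s : ℂ} (hs : σ ≤ s.re) (i : ι) :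
    ‖b i * (N i : ℂ) ^ (-s)‖ ≤ ‖b i‖ * N i ^ (-σ) := by
  by_cases hb : b i = 0
  · simp [hb]
  · have h1 := hN i hb
    rw [_root_.norm_mul, Complex.norm_cpow_eq_rpow_re_of_pos (by linarith), Complex.neg_re]
    gcongr

theorem summable_mul_cpow (hN : ∀ i, b i ≠ 0 → 1 ≤ N i)
    (hs : ∀ σ : ℝ, 1 < σ → Summable fun i => ‖b i‖ * N i ^ (-σ)) {s : ℂ} (h1 : 1 < s.re) :
    Summable fun i => b i * (N i : ℂ) ^ (-s) :=
  (hs s.re h1).of_norm_bounded (norm_mul_cpow_le hN le_rfl)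

theorem hasDerivAt_tsum_mul_cpow (hN : ∀ i, b i ≠ 0 → 1 ≤ N i)
    (hs : ∀ σ : ℝ, 1 < σ → Summable fun i => ‖b i‖ * N i ^ (-σ)) {s : ℂ} (h1 : 1 < s.re) :
    HasDerivAt (fun z => ∑' i, b i * (N i : ℂ) ^ (-z))
      (-∑' i, b i * (Real.log (N i) : ℂ) * (N i : ℂ) ^ (-s)) s := by
  set σ := (1 + s.re) / 2 with hσ
  have hσ1 : 1 < σ := by rw [hσ]; linarith
  set U : Set ℂ := {z | σ < z.re} with hU
  have hUo : IsOpen U := isOpen_lt continuous_const Complex.continuous_re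
  have hsU : s ∈ U := by rw [hU, Set.mem_setOf_eq, hσ]; linarith
  have hd : ∀ i z, HasDerivAt (fun z : ℂ => b i * (N i : ℂ) ^ (-z))
      (-(b i * (Real.log (N i) : ℂ) * (N i : ℂ) ^ (-z))) z := by
    intro i z
    by_cases hb : b i = 0
    · simpa [hb] using hasDerivAt_const z (0 : ℂ)
    · have h1 := hN i hb
      have h2 : (N i : ℂ) ≠ 0 := by
        rw [Ne, Complex.ofReal_eq_zero]; linarith
      have := ((hasDerivAt_neg z).const_cpow (c := (N i : ℂ)) (Or.inl h2)).const_mul (b i)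
      refine this.congr_deriv ?_
      rw [Complex.ofReal_log (by linarith)]
      ring
  have hle : ∀ i, ∀ z ∈ U, ‖b i * (N i : ℂ) ^ (-z)‖ ≤ ‖b i‖ * N i ^ (-σ) := fun i z hz =>
    norm_mul_cpow_le hN (le_of_lt hz) i
  have hF : ∀ i, DifferentiableOn ℂ (fun z : ℂ => b i * (N i : ℂ) ^ (-z)) U := fun i z _ =>
    (hd i z).differentiableAt.differentiableWithinAt
  have h2 := Complex.hasSum_deriv_of_summable_norm (hs σ hσ1) hF hUo hle hsU
  have h3 := (Complex.differentiableOn_tsum_of_summable_norm (hs σ hσ1) hF hUo hle).differentiableAt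
    (hUo.mem_nhds hsU)
  refine h3.hasDerivAt.congr_deriv ?_
  rw [← h2.tsum_eq, ← tsum_neg]
  exact tsum_congr fun i => (hd i s).deriv

theorem iteratedDeriv_tsum_mul_cpow (n : ℕ) : ∀ {b : ι → ℂ}, (∀ i, b i ≠ 0 → 1 ≤ N i) →
    (∀ σ : ℝ, 1 < σ → Summable fun i => ‖b i‖ * N i ^ (-σ)) → ∀ {s : ℂ}, 1 < s.re →
    iteratedDeriv n (fun z => ∑' i, b i * (N i : ℂ) ^ (-z)) s =
      (-1) ^ n * ∑' i, b i * (Real.log (N i) : ℂ) ^ n * (N i : ℂ) ^ (-s) := by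
  induction n with
  | zero => intro b hN hs s h1; simp
  | succ n ih =>
    intro b hN hs s h1
    rw [iteratedDeriv_succ']
    have hUo : IsOpen {z : ℂ | 1 < z.re} := isOpen_lt continuous_const Complex.continuous_re
    have hN' : ∀ i, -(b i * (Real.log (N i) : ℂ)) ≠ 0 → 1 ≤ N i := fun i h =>
      hN i fun h0 => h (by simp [h0])
    have heq : deriv (fun z => ∑' i, b i * (N i : ℂ) ^ (-z)) =ᶠ[𝓝 s]
        fun z => ∑' i, -(b i * (Real.log (N i) : ℂ)) * (N i : ℂ) ^ (-z) := by
      filter_upwards [hUo.mem_nhds h1] with z hz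
      rw [(hasDerivAt_tsum_mul_cpow hN hs hz).deriv, ← tsum_neg]
      exact tsum_congr fun i => by ring
    rw [heq.iteratedDeriv_eq, ih hN'
      (fun σ hσ => by simpa only [norm_neg] using summable_norm_mul_log hN hs hσ) h1, pow_succ,
      mul_assoc, neg_one_mul, ← tsum_neg]
    congr 1
    exact tsum_congr fun i => by ring

end DirichletSeries

end

section

open Topology

section PrimePowers

/-- Pairs `(𝔭, n)`, standing for the prime power `𝔭 ^ (n + 1)`. -/
abbrev PrimePowers := {p : Ideal (𝓞 K) // Prime p} × ℕ

variable {K}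

/-- The ideal `𝔭 ^ (n + 1)` attached to `(𝔭, n)`. -/
def PrimePowers.ideal (i : PrimePowers K) : Ideal (𝓞 K) := i.1.1 ^ (i.2 + 1)

/-- The von Mangoldt weight `log N𝔭` of `𝔭 ^ (n + 1)`. -/
noncomputable def PrimePowers.weight (i : PrimePowers K) : ℝ := Real.log (Ideal.absNorm i.1.1)

namespace PrimePowers

instance : Countable (PrimePowers K) := by
  have := countable_ideal K
  infer_instance

theorem ideal_ne_bot (i : PrimePowers K) : i.ideal ≠ ⊥ := pow_ne_zero _ i.1.2.ne_zero

theorem one_lt_absNorm (p : {p : Ideal (𝓞 K) // Prime p}) : 1 < Ideal.absNorm p.1 := by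
  have h1 := absNorm_pos p.2.ne_zero
  have h2 : Ideal.absNorm p.1 ≠ 1 := fun h => p.2.not_unit (by
    rw [Ideal.absNorm_eq_one_iff] at h
    rw [Ideal.isUnit_iff]; exact h)
  omega

theorem weight_pos (i : PrimePowers K) : 0 < i.weight :=
  Real.log_pos (by exact_mod_cast one_lt_absNorm i.1)

theorem one_le_absNorm (i : PrimePowers K) : (1 : ℝ) ≤ Ideal.absNorm i.ideal := by
  exact_mod_cast absNorm_pos i.ideal_ne_bot

theorem log_absNorm (i : PrimePowers K) :
    Real.log (Ideal.absNorm i.ideal) = (i.2 + 1) * i.weight := by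
  simp [ideal, weight]

theorem weight_le (i : PrimePowers K) : i.weight ≤ Real.log (Ideal.absNorm i.ideal) := by
  rw [log_absNorm]
  nlinarith [i.weight_pos, (Nat.cast_nonneg i.2 : (0 : ℝ) ≤ i.2)]

theorem ideal_injective : Function.Injective (ideal (K := K)) := by
  rintro ⟨⟨p, hp⟩, n⟩ ⟨⟨q, hq⟩, m⟩ h
  simp only [ideal] at h
  have h1 : p ∣ q := hp.dvd_of_dvd_pow (h ▸ dvd_pow_self p n.succ_ne_zero)
  have h2 : q ∣ p := hq.dvd_of_dvd_pow (h ▸ dvd_pow_self q m.succ_ne_zero)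
  obtain rfl := dvd_antisymm h1 h2
  have := (pow_inj_of_not_isUnit hp.not_unit hp.ne_zero).1 h
  rw [show n = m by omega]

theorem hasSum_weight_of_dvd {I : Ideal (𝓞 K)} (hI : I ≠ ⊥) :
    HasSum (fun i : PrimePowers K => if i.ideal ∣ I then i.weight else 0)
      (Real.log (Ideal.absNorm I)) := by
  set s := UniqueFactorizationMonoid.normalizedFactors I with hs
  have hprime : ∀ p ∈ s, Prime p := fun p hp =>
    UniqueFactorizationMonoid.prime_of_normalized_factor p hp
  set g : Ideal (𝓞 K) × ℕ → ℝ := fun j =>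
    if Prime j.1 ∧ j.2 + 1 ≤ s.count j.1 then Real.log (Ideal.absNorm j.1) else 0 with hg
  have h1 : HasSum g (Real.log (Ideal.absNorm I)) := by
    have h2 : ∑ j ∈ s.toFinset ×ˢ Finset.range (Multiset.card s), g j =
        Real.log (Ideal.absNorm I) := by
      rw [Finset.sum_product]
      have h3 : ∀ p ∈ s.toFinset, ∑ n ∈ Finset.range (Multiset.card s), g (p, n) =
          s.count p • Real.log (Ideal.absNorm p) := by
        intro p hp
        rw [Multiset.mem_toFinset] at hp
        simp only [hg, hprime p hp, true_and, Finset.sum_ite, Finset.sum_const_zero, add_zero,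
          Finset.sum_const]
        congr 1
        have : (Finset.range (Multiset.card s)).filter (fun n => n + 1 ≤ s.count p) =
            Finset.range (s.count p) := by
          ext n
          have := Multiset.count_le_card p s
          simp only [Finset.mem_filter, Finset.mem_range]
          omega
        rw [this, Finset.card_range]
      rw [Finset.sum_congr rfl h3, ← Finset.sum_multiset_map_count]
      have h4 : (Ideal.absNorm I : ℝ) =
          (s.map fun p => (Ideal.absNorm p : ℝ)).prod := by
        have h5 : s.prod = I := associated_iff_eq.1
          (UniqueFactorizationMonoid.prod_normalizedFactors hI)
        conv_lhs => rw [← h5]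
        rw [map_multiset_prod, Nat.cast_multiset_prod, Multiset.map_map]
        rfl
      rw [h4, Real.log_multiset_prod, Multiset.map_map]
      · rfl
      · intro x hx
        obtain ⟨p, hp, rfl⟩ := Multiset.mem_map.1 hx
        exact_mod_cast (absNorm_pos (hprime p hp).ne_zero).ne'
    rw [← h2]
    refine hasSum_sum_of_ne_finset_zero fun j hj => ?_
    simp only [hg]
    refine if_neg fun h => hj ?_
    have h3 : j.1 ∈ s := Multiset.count_pos.1 (by omega)
    have := Multiset.count_le_card j.1 s
    simp only [Finset.mem_product, Multiset.mem_toFinset, Finset.mem_range]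
    exact ⟨h3, by omega⟩
  have hinj : Function.Injective
      (fun i : PrimePowers K => ((i.1.1, i.2) : Ideal (𝓞 K) × ℕ)) := by
    rintro ⟨⟨p, hp⟩, n⟩ ⟨⟨q, hq⟩, m⟩ h
    simpa using h
  rw [← hinj.hasSum_iff] at h1
  · refine h1.congr_fun fun i => ?_
    simp only [hg, Function.comp, i.1.2, true_and]
    have : i.ideal ∣ I ↔ i.2 + 1 ≤ s.count i.1.1 := by
      rw [UniqueFactorizationMonoid.dvd_iff_normalizedFactors_le_normalizedFactors
        i.ideal_ne_bot hI, ideal, UniqueFactorizationMonoid.normalizedFactors_pow,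
        UniqueFactorizationMonoid.normalizedFactors_irreducible i.1.2.irreducible,
        Multiset.nsmul_singleton, Multiset.le_count_iff_replicate_le]
      simp [hs]
    simp only [this, weight]
  · intro j hj
    simp only [hg]
    refine if_neg fun h => hj ⟨(⟨j.1, h.1⟩, j.2), rfl⟩

end PrimePowers

end PrimePowers

end

section

open Topology

variable {K}

namespace HeckeChar

variable (H : HeckeChar K)

theorem one_le_absNorm_of_onIdeal_ne_zero (I : Ideal (𝓞 K)) (h : H.onIdeal I ≠ 0) :
    (1 : ℝ) ≤ Ideal.absNorm I := by
  have hI : I ≠ ⊥ := fun h0 => h (by rw [h0, onIdeal_bot])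
  exact_mod_cast absNorm_pos hI

theorem norm_onIdeal_le_one (I : Ideal (𝓞 K)) : ‖H.onIdeal I‖ ≤ 1 := by
  by_cases hI : I = ⊥
  · rw [hI, onIdeal_bot, norm_zero]; exact zero_le_one
  · exact (H.norm_onIdeal' I hI).le

theorem summable_norm_onIdeal {σ : ℝ} (hσ : 1 < σ) :
    Summable fun I : Ideal (𝓞 K) => ‖H.onIdeal I‖ * (Ideal.absNorm I : ℝ) ^ (-σ) :=
  (summable_absNorm_rpow K hσ).of_nonneg_of_le (fun I => by positivity) fun I =>
    mul_le_of_le_one_left (by positivity) (H.norm_onIdeal_le_one I)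

theorem hasDerivAt_L {s : ℂ} (hs : 1 < s.re) : HasDerivAt H.L
    (-∑' I, H.onIdeal I * (Real.log (Ideal.absNorm I) : ℂ) * (Ideal.absNorm I : ℂ) ^ (-s)) s := by
  have := hasDerivAt_tsum_mul_cpow (N := fun I : Ideal (𝓞 K) => (Ideal.absNorm I : ℝ))
    H.one_le_absNorm_of_onIdeal_ne_zero (fun σ hσ => H.summable_norm_onIdeal hσ) hs
  simp only [Complex.ofReal_natCast] at this
  exact this

/-- The coefficients of the logarithmic derivative of the L-series. -/
noncomputable def mangoldt (i : PrimePowers K) : ℂ := i.weight * H.onIdeal i.ideal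

theorem norm_mangoldt (i : PrimePowers K) : ‖H.mangoldt i‖ = i.weight := by
  rw [mangoldt, _root_.norm_mul, H.norm_onIdeal' _ i.ideal_ne_bot, mul_one, Complex.norm_real,
    Real.norm_eq_abs, abs_of_pos i.weight_pos]

theorem _root_.PrimePowers.summable_log {σ : ℝ} (hσ : 1 < σ) : Summable fun I : Ideal (𝓞 K) =>
    Real.log (Ideal.absNorm I) * (Ideal.absNorm I : ℝ) ^ (-σ) := by
  refine ((summable_absNorm_rpow K (σ := (1 + σ) / 2) (by linarith)).mul_left
    ((σ - 1) / 2)⁻¹).of_nonneg_of_le (fun I => ?_) fun I => ?_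
  · exact mul_nonneg (Real.log_natCast_nonneg _) (by positivity)
  · by_cases hI : I = ⊥
    · rw [hI]
      have : (0 : ℝ) < (σ - 1) / 2 := by linarith
      simp only [Ideal.absNorm_bot, Nat.cast_zero, Real.log_zero, zero_mul]
      positivity
    · have h1 : (1 : ℝ) ≤ Ideal.absNorm I := by exact_mod_cast absNorm_pos hI
      have := log_mul_rpow_le h1 (show 0 < (σ - 1) / 2 by linarith) σ
      rwa [show σ - (σ - 1) / 2 = (1 + σ) / 2 by ring] at this

theorem _root_.PrimePowers.summable_weight {σ : ℝ} (hσ : 1 < σ) : Summable fun i : PrimePowers K =>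
    i.weight * (Ideal.absNorm i.ideal : ℝ) ^ (-σ) :=
  ((PrimePowers.summable_log hσ).comp_injective PrimePowers.ideal_injective).of_nonneg_of_le
    (fun i => mul_nonneg i.weight_pos.le (by positivity))
    fun i => mul_le_mul_of_nonneg_right i.weight_le (by positivity)

theorem summable_norm_mangoldt {σ : ℝ} (hσ : 1 < σ) : Summable fun i : PrimePowers K =>
    ‖H.mangoldt i‖ * (Ideal.absNorm i.ideal : ℝ) ^ (-σ) := by
  simpa only [norm_mangoldt] using PrimePowers.summable_weight hσ

/-- The Dirichlet series of `-L'/L`. -/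
noncomputable def P (s : ℂ) : ℂ :=
  ∑' i : PrimePowers K, H.mangoldt i * ((Ideal.absNorm i.ideal : ℝ) : ℂ) ^ (-s)

theorem summable_P {s : ℂ} (hs : 1 < s.re) : Summable fun i : PrimePowers K =>
    H.mangoldt i * ((Ideal.absNorm i.ideal : ℝ) : ℂ) ^ (-s) :=
  summable_mul_cpow (fun i _ => i.one_le_absNorm) (fun _ => H.summable_norm_mangoldt) hs

theorem differentiableAt_P {s : ℂ} (hs : 1 < s.re) : DifferentiableAt ℂ H.P s :=
  (hasDerivAt_tsum_mul_cpow (fun i _ => i.one_le_absNorm)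
    (fun _ => H.summable_norm_mangoldt) hs).differentiableAt

theorem hasDerivAt_L' {s : ℂ} (hs : 1 < s.re) : HasDerivAt H.L (-(H.P s * H.L s)) s := by
  refine (H.hasDerivAt_L hs).congr_deriv ?_
  rw [neg_inj]
  have hL := H.summable_L hs
  have hP := H.summable_P hs
  set F : Ideal (𝓞 K) × PrimePowers K → ℂ := fun x => if x.2.ideal ∣ x.1 then
    x.2.weight * (H.onIdeal x.1 * (Ideal.absNorm x.1 : ℂ) ^ (-s)) else 0 with hF
  have hinj : Function.Injective
      (fun x : PrimePowers K × Ideal (𝓞 K) => ((x.1.ideal * x.2, x.1) : _ × PrimePowers K)) := by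
    rintro ⟨i, I⟩ ⟨j, J⟩ h
    simp only [Prod.mk.injEq] at h
    obtain ⟨h1, rfl⟩ := h
    rw [mul_left_cancel₀ i.ideal_ne_bot h1]
  have h1 : HasSum F (H.P s * H.L s) := by
    have h3 : HasSum (fun i : PrimePowers K =>
      H.mangoldt i * ((Ideal.absNorm i.ideal : ℝ) : ℂ) ^ (-s)) (H.P s) := hP.hasSum
    have h4 : HasSum (fun I : Ideal (𝓞 K) => H.onIdeal I * (Ideal.absNorm I : ℂ) ^ (-s))
      (H.L s) := hL.hasSum
    have h5 := summable_mul_of_summable_norm (R := ℂ) hP.norm hL.norm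
    have := HasSum.mul h3 h4 h5
    rw [← hinj.hasSum_iff]
    · refine this.congr_fun fun x => ?_
      simp only [hF, Function.comp, dvd_mul_right, if_true, map_mul, Nat.cast_mul, mangoldt]
      rw [Complex.natCast_mul_natCast_cpow, Complex.ofReal_natCast]
      ring
    · rintro ⟨I, i⟩ hx
      simp only [hF]
      refine if_neg ?_
      rintro ⟨J, rfl⟩
      exact hx ⟨(i, J), rfl⟩
  have h2 : ∀ I, HasSum (fun i => F (I, i))
      (H.onIdeal I * (Real.log (Ideal.absNorm I) : ℂ) * (Ideal.absNorm I : ℂ) ^ (-s)) := by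
    intro I
    by_cases hI : I = ⊥
    · simp only [hF, hI, onIdeal_bot, zero_mul, mul_zero, ite_self]
      exact hasSum_zero
    · have := ((Complex.hasSum_ofReal).2 (PrimePowers.hasSum_weight_of_dvd hI)).mul_right
        (H.onIdeal I * (Ideal.absNorm I : ℂ) ^ (-s))
      rw [show H.onIdeal I * (Real.log (Ideal.absNorm I) : ℂ) * (Ideal.absNorm I : ℂ) ^ (-s) =
        (Real.log (Ideal.absNorm I) : ℂ) * (H.onIdeal I * (Ideal.absNorm I : ℂ) ^ (-s)) by ring]
      refine this.congr_fun fun i => ?_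
      simp only [hF]
      split_ifs <;> simp
  exact (h1.prod_fiberwise h2).tsum_eq

end HeckeChar

end

section

open Topology

section LogDeriv

theorem exists_order_of_hasDerivAt {f Q : ℂ → ℂ} (hf : Differentiable ℂ f) (hne : ∃ s, f s ≠ 0)
    (hQ : ∀ s : ℂ, 1 < s.re → HasDerivAt f (-(Q s * f s)) s) {s₀ : ℂ} (hs₀ : 1 ≤ s₀.re) :
    ∃ m : ℕ, (f s₀ = 0 → m ≠ 0) ∧
      Tendsto (fun ε : ℝ => (ε : ℂ) * Q (s₀ + ε)) (𝓝[>] 0) (𝓝 (-(m : ℂ))) := by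
  have han : AnalyticOnNhd ℂ f Set.univ :=
    hf.differentiableOn.analyticOnNhd isOpen_univ
  have hnz : ¬∀ᶠ z in 𝓝 s₀, f z = 0 := by
    intro h
    obtain ⟨s, hs⟩ := hne
    exact hs (han.eqOn_zero_of_preconnected_of_eventuallyEq_zero isPreconnected_univ
      (Set.mem_univ s₀) h (Set.mem_univ s))
  obtain ⟨m, g, hg, hg0, hfg⟩ :=
    (han s₀ (Set.mem_univ _)).exists_eventuallyEq_pow_smul_nonzero_iff.2 hnz
  refine ⟨m, fun h hm => hg0 ?_, ?_⟩
  · have := hfg.self_of_nhds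
    rw [h, hm] at this
    simpa using this.symm
  have hcast : Tendsto (fun ε : ℝ => s₀ + (ε : ℂ)) (𝓝[>] 0) (𝓝 s₀) := by
    have : Continuous fun ε : ℝ => s₀ + (ε : ℂ) := by fun_prop
    simpa using (this.tendsto 0).mono_left nhdsWithin_le_nhds
  have hgd : ContinuousAt (deriv g) s₀ := hg.deriv.continuousAt
  have hlim : Tendsto (fun ε : ℝ => -(m : ℂ) - ε * (deriv g (s₀ + ε) / g (s₀ + ε))) (𝓝[>] 0)
      (𝓝 (-(m : ℂ))) := by
    have h1 : Tendsto (fun ε : ℝ => (ε : ℂ)) (𝓝[>] 0) (𝓝 0) := by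
      have : Continuous fun ε : ℝ => (ε : ℂ) := by fun_prop
      simpa using (this.tendsto 0).mono_left nhdsWithin_le_nhds
    have h2 := h1.mul ((hgd.tendsto.comp hcast).div (hg.continuousAt.tendsto.comp hcast) hg0)
    simpa using (tendsto_const_nhds (x := -(m : ℂ))).sub h2
  refine hlim.congr' ?_
  have hev : ∀ᶠ z in 𝓝 s₀, deriv f z = deriv (fun z => (z - s₀) ^ m • g z) z ∧
      f z = (z - s₀) ^ m • g z ∧ g z ≠ 0 ∧ DifferentiableAt ℂ g z := by
    have h1 := hfg.eventually_nhds
    filter_upwards [h1, hg.continuousAt.eventually_ne hg0, hg.eventually_analyticAt] with z h2 h3 h4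
    exact ⟨Filter.EventuallyEq.deriv_eq h2, h2.self_of_nhds, h3, h4.differentiableAt⟩
  filter_upwards [hcast.eventually hev, self_mem_nhdsWithin] with ε ⟨h1, h2, h3, h4⟩ hε
  rw [Set.mem_Ioi] at hε
  have hre : 1 < (s₀ + (ε : ℂ)).re := by
    simp only [Complex.add_re, Complex.ofReal_re]; linarith
  rw [(hQ _ hre).deriv, h2] at h1
  have hd : HasDerivAt (fun z => (z - s₀) ^ m • g z) (((m : ℂ) * ε ^ (m - 1)) * g (s₀ + ε) +
      (ε : ℂ) ^ m * deriv g (s₀ + ε)) (s₀ + ε) := by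
    have := (((hasDerivAt_id (s₀ + (ε : ℂ))).sub_const s₀).pow m).mul h4.hasDerivAt
    refine this.congr_deriv ?_
    simp
  rw [hd.deriv] at h1
  have hε0 : (ε : ℂ) ≠ 0 := by exact_mod_cast hε.ne'
  have hεm : (ε : ℂ) ^ m ≠ 0 := pow_ne_zero _ hε0
  have h5 : (m : ℂ) * (ε : ℂ) ^ (m - 1) * ε = m * ε ^ m := by
    rcases m with _ | m
    · simp
    · simp [pow_succ, mul_assoc]
  rw [add_sub_cancel_left, smul_eq_mul] at h1
  have h6 : (ε : ℂ) ^ m * ((ε : ℂ) * Q (s₀ + ε) * g (s₀ + ε)) =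
      (ε : ℂ) ^ m * (-(m : ℂ) * g (s₀ + ε) - ε * deriv g (s₀ + ε)) := by
    linear_combination (-(ε : ℂ)) * h1 - g (s₀ + ε) * h5
  have h7 := mul_left_cancel₀ hεm h6
  field_simp
  linear_combination -h7

theorem exists_entire_div {f : ℂ → ℂ} (hf : Differentiable ℂ f) {a : ℂ} (h : f a = 0) :
    ∃ g : ℂ → ℂ, Differentiable ℂ g ∧ ∀ s, f s = (s - a) * g s := by
  refine ⟨dslope f a, ?_, fun s => ?_⟩
  · rw [← differentiableOn_univ] at hf ⊢
    exact (Complex.differentiableOn_dslope univ_mem).2 hf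
  · have := sub_smul_dslope f a s
    rw [h, sub_zero, smul_eq_mul] at this
    exact this.symm

end LogDeriv

variable {K}

namespace HeckeChar

/-- The trivial Hecke character. -/
noncomputable def triv : HeckeChar K where
  toFun _ := 1
  onIdeal :=
    { toFun := fun I => if I = ⊥ then 0 else 1
      map_zero' := by simp
      map_one' := by
        rw [if_neg]; exact one_ne_zero
      map_mul' := fun I J => by
        by_cases hI : I = ⊥ <;> by_cases hJ : J = ⊥ <;> simp [hI, hJ] }
  map_mul' _ _ _ _ := by simp
  norm_toFun' _ _ := by simp
  contDiffAt' _ _ := contDiffAt_const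
  map_smul' _ _ _ _ := rfl
  norm_onIdeal' I hI := by simp [hI]
  onIdeal_span' a ha := by simp [ha]

variable (H : HeckeChar K)

/-- The square of a Hecke character. -/
noncomputable def sq : HeckeChar K where
  toFun v := H.toFun v ^ 2
  onIdeal :=
    { toFun := fun I => H.onIdeal I ^ 2
      map_zero' := by rw [map_zero, zero_pow two_ne_zero]
      map_one' := by rw [map_one, one_pow]
      map_mul' := fun I J => by rw [map_mul, mul_pow] }
  map_mul' x y hx hy := by rw [H.map_mul' x y hx hy, mul_pow]
  norm_toFun' x hx := by rw [norm_pow, H.norm_toFun' x hx, one_pow]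
  contDiffAt' x hx := (H.contDiffAt' x hx).pow 2
  map_smul' c x hc hx := by rw [H.map_smul' c x hc hx]
  norm_onIdeal' I hI := by
    change ‖H.onIdeal I ^ 2‖ = 1
    rw [norm_pow, H.norm_onIdeal' I hI, one_pow]
  onIdeal_span' a ha := by
    change H.onIdeal _ ^ 2 = _
    rw [H.onIdeal_span' a ha]

theorem onIdeal_triv {I : Ideal (𝓞 K)} (hI : I ≠ ⊥) : (triv : HeckeChar K).onIdeal I = 1 :=
  if_neg hI

theorem onIdeal_sq (I : Ideal (𝓞 K)) : H.sq.onIdeal I = H.onIdeal I ^ 2 := rfl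

theorem tendsto_L : Tendsto (fun σ : ℝ => H.L σ) atTop (𝓝 1) := by
  have hlim : ∑' I : Ideal (𝓞 K), (if I = ⊤ then (1 : ℂ) else 0) = 1 := by
    simp
  rw [← hlim]
  refine tendsto_tsum_of_dominated_convergence (summable_absNorm_rpow K one_lt_two)
    (fun I => ?_) ?_
  · by_cases hI : I = ⊥
    · simp [hI, onIdeal_bot, bot_ne_top, -Submodule.bot_coe]
    by_cases hI1 : I = ⊤
    · simp only [hI1, if_true]
      rw [← Ideal.one_eq_top, map_one, map_one]
      simp
    · rw [if_neg hI1, tendsto_zero_iff_norm_tendsto_zero]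
      have h1 : 1 < Ideal.absNorm I := by
        have := absNorm_pos hI
        have h2 : Ideal.absNorm I ≠ 1 := fun h => hI1 (Ideal.absNorm_eq_one_iff.1 h)
        omega
      have h2 : (0 : ℝ) < Ideal.absNorm I := by positivity
      refine squeeze_zero (fun _ => norm_nonneg _) (fun σ => H.norm_term_le I σ) ?_
      simp only [Complex.ofReal_re]
      have := tendsto_rpow_atTop_of_base_lt_one (Ideal.absNorm I : ℝ)⁻¹
        (by have := inv_pos.2 h2; linarith) (inv_lt_one_of_one_lt₀ (by exact_mod_cast h1))
      refine this.congr fun σ => ?_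
      rw [Real.inv_rpow h2.le, Real.rpow_neg h2.le]
  · filter_upwards [eventually_ge_atTop 2] with σ hσ I
    refine (H.norm_term_le I σ).trans ?_
    rw [Complex.ofReal_re]
    by_cases hI : I = ⊥
    · simp [hI, -Submodule.bot_coe, Real.zero_rpow (show -σ ≠ 0 by linarith)]
    · have h1 : (1 : ℝ) ≤ Ideal.absNorm I := by exact_mod_cast absNorm_pos hI
      exact Real.rpow_le_rpow_of_exponent_le h1 (by linarith)

/-- A Hecke character is trivial if it takes the value `1` on all nonzero ideals. -/
def IsTrivial : Prop := ∀ I, I ≠ ⊥ → H.onIdeal I = 1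

/-- `1` for the trivial character and `0` otherwise. -/
noncomputable def residue : ℝ := if H.IsTrivial then 1 else 0

theorem exists_core : ∃ f : ℂ → ℂ, Differentiable ℂ f ∧ (H.IsTrivial → f 1 ≠ 0) ∧
    ∀ s, 1 < s.re → f s = (if H.IsTrivial then s - 1 else 1) * H.L s := by
  by_cases h : H.IsTrivial
  · simp only [h, if_true, true_imp_iff]
    exact ⟨H.completedL, H.differentiable_completedL, H.completedL_one_ne_zero h,
      fun s => H.completedL_eq⟩
  · simp only [h, if_false, false_imp_iff, true_and, one_mul]
    have h' := h
    simp only [IsTrivial] at h'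
    push Not at h'
    obtain ⟨I, hI, hI1⟩ := h'
    obtain ⟨g, hg, hg1⟩ := exists_entire_div H.differentiable_completedL
      (H.completedL_one_eq_zero hI hI1)
    refine ⟨g, hg, fun s hs => ?_⟩
    have h1 := H.completedL_eq hs
    rw [hg1] at h1
    refine mul_left_cancel₀ ?_ h1
    intro h0
    rw [sub_eq_zero] at h0
    simp [h0] at hs

/-- The L-function, multiplied by `s - 1` for the trivial character. -/
noncomputable def core : ℂ → ℂ := H.exists_core.choose

theorem differentiable_core : Differentiable ℂ H.core := H.exists_core.choose_spec.1

theorem core_one_ne_zero (h : H.IsTrivial) : H.core 1 ≠ 0 := H.exists_core.choose_spec.2.1 h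

theorem core_eq {s : ℂ} (hs : 1 < s.re) :
    H.core s = (if H.IsTrivial then s - 1 else 1) * H.L s := H.exists_core.choose_spec.2.2 s hs

theorem hasDerivAt_core {s : ℂ} (hs : 1 < s.re) :
    HasDerivAt H.core (-((H.P s - H.residue / (s - 1)) * H.core s)) s := by
  have hs1 : s - 1 ≠ 0 := by
    intro h0
    rw [sub_eq_zero] at h0
    simp [h0] at hs
  have heq : H.core =ᶠ[𝓝 s] fun s => (if H.IsTrivial then s - 1 else 1) * H.L s := by
    filter_upwards [(isOpen_lt continuous_const Complex.continuous_re).mem_nhds hs] with z hz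
    exact H.core_eq hz
  refine HasDerivAt.congr_of_eventuallyEq ?_ heq
  rw [H.core_eq hs, residue]
  have hL := H.hasDerivAt_L' hs
  by_cases h : H.IsTrivial
  · simp only [h, if_true]
    refine (((hasDerivAt_id s).sub_const 1).mul hL).congr_deriv ?_
    simp only [id, Complex.ofReal_one]
    field_simp
    ring
  · simp only [h, if_false, one_mul]
    refine hL.congr_deriv ?_
    simp

theorem exists_core_ne_zero : ∃ s, H.core s ≠ 0 := by
  have h1 : ∀ᶠ σ : ℝ in atTop, H.L σ ≠ 0 := H.tendsto_L.eventually_ne one_ne_zero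
  obtain ⟨σ, hσ, hσ1⟩ := (h1.and (eventually_gt_atTop 1)).exists
  refine ⟨σ, ?_⟩
  rw [H.core_eq (by simpa using hσ1)]
  refine mul_ne_zero ?_ hσ
  split_ifs
  · rw [sub_ne_zero]
    exact_mod_cast hσ1.ne'
  · exact one_ne_zero

theorem exists_order {s₀ : ℂ} (hs₀ : 1 ≤ s₀.re) : ∃ m : ℕ, (H.core s₀ = 0 → m ≠ 0) ∧
    Tendsto (fun ε : ℝ => (ε : ℂ) * H.P (s₀ + ε)) (𝓝[>] 0)
      (𝓝 ((if s₀ = 1 then (H.residue : ℂ) else 0) - (m : ℂ))) := by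
  obtain ⟨m, hm, hlim⟩ := exists_order_of_hasDerivAt H.differentiable_core H.exists_core_ne_zero
    (fun s => H.hasDerivAt_core) hs₀
  refine ⟨m, hm, ?_⟩
  have h1 : Tendsto (fun ε : ℝ => (ε : ℂ) * (H.residue / (s₀ + ε - 1))) (𝓝[>] 0)
      (𝓝 (if s₀ = 1 then (H.residue : ℂ) else 0)) := by
    split_ifs with h
    · refine tendsto_const_nhds.congr' ?_
      filter_upwards [self_mem_nhdsWithin] with ε hε
      have : (ε : ℂ) ≠ 0 := by exact_mod_cast (ne_of_gt hε)
      rw [h, add_sub_cancel_left]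
      field_simp
    · have h2 : ContinuousAt (fun ε : ℝ => (ε : ℂ) * (H.residue / (s₀ + ε - 1))) 0 := by
        have : s₀ + ((0 : ℝ) : ℂ) - 1 ≠ 0 := by simpa [sub_eq_zero] using h
        fun_prop (disch := assumption)
      have h3 := h2.tendsto.mono_left (nhdsWithin_le_nhds (s := Set.Ioi 0))
      simpa using h3
  have := hlim.add h1
  refine (this.congr fun ε => by ring).trans (le_of_eq ?_)
  congr 1
  ring

end HeckeChar

end

section

open Topology

section Landau

open ComplexOrder in
theorem ne_zero_of_logDeriv_nonneg {ι : Type*} {b N : ι → ℝ} (hb : ∀ i, 0 ≤ b i)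
    (hN : ∀ i, 1 ≤ N i) (hs : ∀ σ : ℝ, 1 < σ → Summable fun i => b i * N i ^ (-σ)) {F : ℂ → ℂ}
    (hF : Differentiable ℂ F) (hd : ∀ s : ℂ, 1 < s.re →
      HasDerivAt F (-((∑' i, (b i : ℂ) * (N i : ℂ) ^ (-s)) * F s)) s) {σ : ℝ} (hσ : 1 < σ)
    (h0 : F σ ≠ 0) {y : ℝ} (hy : y ≤ σ) : F y ≠ 0 := by
  set G : ℂ → ℂ := fun s => F s / F σ with hG
  set R : ℂ → ℂ := fun s => ∑' i, (b i : ℂ) * (N i : ℂ) ^ (-s) with hR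
  have hGd : Differentiable ℂ G := hF.div_const _
  have hs' : ∀ τ : ℝ, 1 < τ → Summable fun i => ‖(b i : ℂ)‖ * N i ^ (-τ) := fun τ hτ => by
    simpa only [Complex.norm_real, Real.norm_eq_abs, abs_of_nonneg (hb _)] using hs τ hτ
  have hN' : ∀ i, (b i : ℂ) ≠ 0 → 1 ≤ N i := fun i _ => hN i
  have hUo : IsOpen {s : ℂ | 1 < s.re} := isOpen_lt continuous_const Complex.continuous_re
  have hσ' : (σ : ℂ) ∈ {s : ℂ | 1 < s.re} := by simpa using hσ
  have hRd : DifferentiableOn ℂ R {s : ℂ | 1 < s.re} := fun s hs0 =>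
    (hasDerivAt_tsum_mul_cpow hN' hs' hs0).differentiableAt.differentiableWithinAt
  have hRc : ContDiffOn ℂ ⊤ R {s : ℂ | 1 < s.re} := hRd.contDiffOn hUo
  have hRn : ∀ n : ℕ, 0 ≤ (-1) ^ n * iteratedDeriv n R σ := by
    intro n
    rw [hR, iteratedDeriv_tsum_mul_cpow n hN' hs' hσ', ← mul_assoc, ← mul_pow, neg_one_mul,
      neg_neg, one_pow, one_mul]
    refine tsum_nonneg fun i => ?_
    have h1 := hN i
    rw [← Complex.ofReal_pow, ← Complex.ofReal_neg, ← Complex.ofReal_cpow (by linarith),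
      ← Complex.ofReal_mul, ← Complex.ofReal_mul, Complex.zero_le_real]
    have := hb i
    have := Real.log_nonneg h1
    positivity
  have hGn : ∀ n : ℕ, 0 ≤ (-1) ^ n * iteratedDeriv n G σ := by
    intro n
    induction n using Nat.strong_induction_on with
    | _ n ih =>
      rcases n with _ | n
      · simp [hG, div_self h0]
      · have heq : deriv G =ᶠ[𝓝 (σ : ℂ)] fun s => -(G s * R s) := by
          filter_upwards [hUo.mem_nhds hσ'] with s hs1
          rw [((hd s hs1).div_const (F σ)).deriv]
          simp only [hG, hR]
          ring
        rw [iteratedDeriv_succ', heq.iteratedDeriv_eq, iteratedDeriv_fun_neg,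
          iteratedDeriv_fun_mul (hGd.contDiff.contDiffAt)
            ((hRc.contDiffAt (hUo.mem_nhds hσ')).of_le le_top), pow_succ, mul_neg_one, neg_mul_neg,
          Finset.mul_sum]
        refine Finset.sum_nonneg fun k hk => ?_
        have hk' : k < n + 1 := Finset.mem_range.1 hk
        have h1 : (-1 : ℂ) ^ n = (-1) ^ k * (-1) ^ (n - k) := by
          rw [← pow_add]; congr 1; omega
        rw [h1]
        have h2 := mul_nonneg (mul_nonneg (ih k hk') (hRn (n - k)))
          (show (0 : ℂ) ≤ (n.choose k : ℂ) by positivity)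
        refine h2.trans (le_of_eq ?_)
        ring
  have h1 := hGd.apply_le_of_iteratedDeriv_alternating (c := (σ : ℂ)) (z := (y : ℂ))
    (fun n _ => hGn n) (Complex.real_le_real.2 hy)
  intro h2
  simp only [hG, h2, zero_div, div_self h0] at h1
  exact absurd h1 (not_le_of_gt zero_lt_one)

end Landau

variable {K}

namespace HeckeChar

variable (H : HeckeChar K)

theorem isTrivial_triv : (triv : HeckeChar K).IsTrivial := fun _ hI => onIdeal_triv hI

theorem core_one_ne_zero_of_sq (hH : ¬H.IsTrivial) (hsq : H.sq.IsTrivial) : H.core 1 ≠ 0 := by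
  intro hcore
  have hreal : ∀ I, I ≠ ⊥ → H.onIdeal I = 1 ∨ H.onIdeal I = -1 := fun I hI =>
    eq_or_eq_neg_of_sq_eq_sq _ _ ((hsq I hI).trans (one_pow 2).symm)
  obtain ⟨B, hBd, hB⟩ := exists_entire_div H.differentiable_core hcore
  obtain ⟨p⟩ : Nonempty {p : Ideal (𝓞 K) // Prime p} := by
    have h := hH
    simp only [IsTrivial] at h
    push Not at h
    obtain ⟨I, hI, hI1⟩ := h
    have hu : ¬IsUnit I := fun hu => hI1 (by
      rw [Ideal.isUnit_iff] at hu
      rw [hu, ← Ideal.one_eq_top, map_one])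
    obtain ⟨q, hq, -⟩ := WfDvdMonoid.exists_irreducible_factor hu hI
    exact ⟨⟨q, hq.prime⟩⟩
  set n : ℝ := ((Ideal.absNorm p.1 : ℕ) : ℝ) with hn
  have hn1 : 1 < n := Nat.one_lt_cast.2 (PrimePowers.one_lt_absNorm p)
  have hn0 : 0 < n := by linarith
  have hnC : (n : ℂ) ≠ 0 := by exact_mod_cast hn0.ne'
  set E : ℂ → ℂ := fun s => 1 - (n : ℂ) ^ (-(2 * s)) with hE
  have hEd : ∀ s, HasDerivAt E (2 * Real.log n * (n : ℂ) ^ (-(2 * s))) s := by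
    intro s
    have h1 : HasDerivAt (fun s : ℂ => -(2 * s)) (-(2 * 1)) s :=
      ((hasDerivAt_id s).const_mul 2).neg
    refine ((h1.const_cpow (c := (n : ℂ)) (Or.inl hnC)).const_sub 1).congr_deriv ?_
    rw [Complex.ofReal_log hn0.le]
    ring
  set F : ℂ → ℂ := fun s => (triv (K := K)).core s * B s * E s with hF
  have hFd : Differentiable ℂ F :=
    (((triv (K := K)).differentiable_core).mul hBd).mul fun s => (hEd s).differentiableAt
  have hFeq : ∀ s : ℂ, 1 < s.re → F s = (triv (K := K)).L s * H.L s * E s := by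
    intro s hs
    have h1 := H.core_eq hs
    have h2 := (triv (K := K)).core_eq hs
    rw [if_neg hH, one_mul, hB] at h1
    rw [if_pos isTrivial_triv] at h2
    simp only [hF, h2, ← h1]
    ring
  have hEne : ∀ s : ℂ, 1 < s.re → ‖(n : ℂ) ^ (-(2 * s))‖ < 1 := by
    intro s hs
    rw [Complex.norm_cpow_eq_rpow_re_of_pos hn0]
    refine Real.rpow_lt_one_of_one_lt_of_neg hn1 ?_
    simp
    linarith
  have hE0 : ∀ s : ℂ, 1 < s.re → E s ≠ 0 := by
    intro s hs h0
    have h1 := hEne s hs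
    rw [← sub_eq_zero.1 h0, norm_one] at h1
    exact lt_irrefl _ h1
  set c : PrimePowers K → ℝ := fun i => if i.1 = p ∧ Odd i.2 then 2 * Real.log n else 0 with hc
  have hcsum : ∀ s : ℂ, 1 < s.re → HasSum
      (fun i => (c i : ℂ) * ((Ideal.absNorm i.ideal : ℝ) : ℂ) ^ (-s))
      (2 * Real.log n * (n : ℂ) ^ (-(2 * s)) / E s) := by
    intro s hs
    have hinj : Function.Injective (fun k : ℕ => ((p, 2 * k + 1) : PrimePowers K)) := by
      intro k l h
      simpa using h
    rw [← hinj.hasSum_iff]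
    · have h1 := (hasSum_geometric_of_norm_lt_one (hEne s hs)).mul_left
        (2 * Real.log n * (n : ℂ) ^ (-(2 * s)))
      rw [← div_eq_mul_inv] at h1
      refine h1.congr_fun fun k => ?_
      have h2 : c (p, 2 * k + 1) = 2 * Real.log n := if_pos ⟨rfl, by simp⟩
      have h3 : ((Ideal.absNorm (PrimePowers.ideal ((p, 2 * k + 1) : PrimePowers K)) : ℝ) : ℂ) ^
          (-s) = ((n : ℂ) ^ (-(2 * s))) ^ (k + 1) := by
        rw [← Complex.cpow_nat_mul, PrimePowers.ideal, map_pow, Complex.ofReal_natCast,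
          Nat.cast_pow, ← Complex.natCast_cpow_natCast_mul, hn, Complex.ofReal_natCast]
        congr 1
        push_cast
        ring
      simp only [Function.comp, h2, h3]
      push_cast
      ring
    · intro i hi
      rw [hc]
      beta_reduce
      rw [if_neg, Complex.ofReal_zero, zero_mul]
      rintro ⟨h1, k, h2⟩
      exact hi ⟨k, Prod.ext h1.symm h2.symm⟩
  set b : PrimePowers K → ℝ := fun i => i.weight * (1 + (H.onIdeal i.ideal).re) - c i with hb
  have hre : ∀ I, I ≠ ⊥ → ((H.onIdeal I).re : ℂ) = H.onIdeal I := by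
    intro I hI
    rcases hreal I hI with h | h <;> simp [h]
  have hbC : ∀ i, (b i : ℂ) = triv.mangoldt i + H.mangoldt i - c i := by
    intro i
    simp only [hb, mangoldt, onIdeal_triv i.ideal_ne_bot]
    push_cast
    rw [hre _ i.ideal_ne_bot]
    ring
  have hb0 : ∀ i, 0 ≤ b i := by
    intro i
    have hw := i.weight_pos
    simp only [hb, hc]
    split_ifs with h
    · have h1 : H.onIdeal i.ideal = 1 := by
        rw [PrimePowers.ideal, map_pow]
        have h3 : Even (i.2 + 1) := h.2.add_one
        obtain ⟨k, hk⟩ := h3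
        rw [hk, ← two_mul, pow_mul]
        have h4 := hsq _ i.1.2.ne_zero
        rw [onIdeal_sq] at h4
        rw [h4, one_pow]
      have h2 : i.weight = Real.log n := by rw [PrimePowers.weight, h.1]
      rw [h1, h2]
      norm_num
      linarith
    · rcases hreal _ i.ideal_ne_bot with h1 | h1 <;> rw [h1] <;> norm_num
      exact hw.le
  have hR : ∀ s : ℂ, 1 < s.re → HasSum
      (fun i => (b i : ℂ) * ((Ideal.absNorm i.ideal : ℝ) : ℂ) ^ (-s))
      ((triv (K := K)).P s + H.P s - 2 * Real.log n * (n : ℂ) ^ (-(2 * s)) / E s) := by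
    intro s hs
    have h1 : HasSum (fun i => triv.mangoldt i * ((Ideal.absNorm i.ideal : ℝ) : ℂ) ^ (-s))
      ((triv (K := K)).P s) := ((triv (K := K)).summable_P hs).hasSum
    have h2 : HasSum (fun i => H.mangoldt i * ((Ideal.absNorm i.ideal : ℝ) : ℂ) ^ (-s))
      (H.P s) := (H.summable_P hs).hasSum
    refine ((h1.add h2).sub (hcsum s hs)).congr_fun fun i => ?_
    rw [hbC]
    ring
  obtain ⟨σ, ⟨hσ0, hσ2⟩, hσ1⟩ := ((((triv (K := K)).tendsto_L.eventually_ne one_ne_zero).and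
    (H.tendsto_L.eventually_ne one_ne_zero)).and (eventually_gt_atTop 1)).exists
  have hσ : 1 < (σ : ℂ).re := by simpa using hσ1
  refine ne_zero_of_logDeriv_nonneg (y := 0) hb0 (fun i : PrimePowers K => i.one_le_absNorm)
    (fun τ hτ => ?_) hFd (fun s hs => ?_) hσ1 ?_ (by linarith) ?_
  · refine ((PrimePowers.summable_weight hτ).mul_left 2).of_nonneg_of_le
      (fun i => mul_nonneg (hb0 i) (by positivity)) fun i => ?_
    rw [← mul_assoc]
    refine mul_le_mul_of_nonneg_right ?_ (by positivity)
    have hw := i.weight_pos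
    have h1 : (H.onIdeal i.ideal).re ≤ 1 := (Complex.re_le_norm _).trans (H.norm_onIdeal_le_one _)
    have h2 : 0 ≤ c i := by
      simp only [hc]
      have := Real.log_nonneg hn1.le
      split_ifs <;> positivity
    simp only [hb]
    nlinarith
  · rw [(hR s hs).tsum_eq]
    have heq : F =ᶠ[𝓝 s] fun s => (triv (K := K)).L s * H.L s * E s := by
      filter_upwards [(isOpen_lt continuous_const Complex.continuous_re).mem_nhds hs] with z hz
      exact hFeq z hz
    refine HasDerivAt.congr_of_eventuallyEq ?_ heq
    rw [hFeq s hs]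
    refine ((((triv (K := K)).hasDerivAt_L' hs).mul (H.hasDerivAt_L' hs)).mul (hEd s)).congr_deriv ?_
    have := hE0 s hs
    simp only [Pi.mul_apply]
    field_simp
    ring
  · rw [hFeq _ hσ]
    exact mul_ne_zero (mul_ne_zero hσ0 hσ2) (hE0 _ hσ)
  · simp [hF, hE]

theorem three_four_one {σ : ℝ} (hσ : 1 < σ) (t : ℝ) :
    0 ≤ (3 * (triv (K := K)).P σ + 4 * H.P (σ + t * Complex.I) +
      H.sq.P (σ + 2 * t * Complex.I) : ℂ).re := by
  have h0 : 1 < ((σ : ℂ)).re := by simpa using hσ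
  have h1 : 1 < ((σ : ℂ) + t * Complex.I).re := by simpa using hσ
  have h2 : 1 < ((σ : ℂ) + 2 * t * Complex.I).re := by simpa using hσ
  have hsum := (((((triv (K := K)).summable_P h0).hasSum.mul_left 3).add
    ((H.summable_P h1).hasSum.mul_left 4)).add (H.sq.summable_P h2).hasSum)
  have hre := (Complex.hasSum_re hsum)
  refine hre.nonneg fun i => ?_
  set n : ℝ := ((Ideal.absNorm i.ideal : ℕ) : ℝ) with hn
  have hn1 : 1 ≤ n := i.one_le_absNorm
  have hn0 : 0 < n := by linarith
  have hnC : (n : ℂ) ≠ 0 := by exact_mod_cast hn0.ne'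
  set z : ℂ := H.onIdeal i.ideal * (n : ℂ) ^ (-(t * Complex.I)) with hz
  have hz1 : ‖z‖ = 1 := by
    rw [hz, _root_.norm_mul, H.norm_onIdeal' _ i.ideal_ne_bot, Complex.norm_cpow_eq_rpow_re_of_pos hn0]
    simp
  have e1 : (n : ℂ) ^ (-((σ : ℂ) + t * Complex.I)) = (n ^ (-σ) : ℝ) * (n : ℂ) ^ (-(t * Complex.I)) := by
    rw [neg_add, Complex.cpow_add _ _ hnC, Complex.ofReal_cpow hn0.le]
    simp
  have e2 : (n : ℂ) ^ (-((σ : ℂ) + 2 * t * Complex.I)) =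
      (n ^ (-σ) : ℝ) * ((n : ℂ) ^ (-(t * Complex.I))) ^ 2 := by
    rw [neg_add, Complex.cpow_add _ _ hnC, Complex.ofReal_cpow hn0.le, ← Complex.cpow_nat_mul]
    simp only [Complex.ofReal_neg]
    congr 2
    push_cast
    ring
  have e0 : (n : ℂ) ^ (-(σ : ℂ)) = (n ^ (-σ) : ℝ) := by
    rw [Complex.ofReal_cpow hn0.le]
    simp
  have h3 : (3 * (triv.mangoldt i * (n : ℂ) ^ (-(σ : ℂ))) +
      4 * (H.mangoldt i * (n : ℂ) ^ (-((σ : ℂ) + t * Complex.I))) +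
      H.sq.mangoldt i * (n : ℂ) ^ (-((σ : ℂ) + 2 * t * Complex.I)) : ℂ) =
      ((i.weight * n ^ (-σ) : ℝ) : ℂ) * (3 + 4 * z + z ^ 2) := by
    rw [e0, e1, e2]
    simp only [mangoldt, onIdeal_triv i.ideal_ne_bot, onIdeal_sq, hz]
    push_cast
    ring
  have h4 : z.re ^ 2 + z.im ^ 2 = 1 := by
    have := Complex.sq_norm z
    rw [hz1, Complex.normSq_apply] at this
    linarith
  rw [h3, Complex.re_ofReal_mul]
  have h5 : (3 + 4 * z + z ^ 2 : ℂ).re = 2 * (1 + z.re) ^ 2 := by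
    simp only [pow_two, Complex.add_re, Complex.mul_re]
    norm_num
    nlinarith
  rw [h5]
  have := i.weight_pos
  positivity

theorem order_inequality {t : ℝ} {m₀ m₁ m₂ : ℝ}
    (h₀ : Tendsto (fun ε : ℝ => (ε : ℂ) * (triv (K := K)).P (1 + ε)) (𝓝[>] 0) (𝓝 m₀))
    (h₁ : Tendsto (fun ε : ℝ => (ε : ℂ) * H.P (1 + t * Complex.I + ε)) (𝓝[>] 0) (𝓝 m₁))
    (h₂ : Tendsto (fun ε : ℝ => (ε : ℂ) * H.sq.P (1 + 2 * t * Complex.I + ε)) (𝓝[>] 0) (𝓝 m₂)) :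
    0 ≤ 3 * m₀ + 4 * m₁ + m₂ := by
  have h := ((h₀.const_mul 3).add (h₁.const_mul 4)).add h₂
  have hre := (Complex.continuous_re.tendsto _).comp h
  have hval : (3 * (m₀ : ℂ) + 4 * m₁ + m₂).re = 3 * m₀ + 4 * m₁ + m₂ := by
    simp
  rw [hval] at hre
  refine ge_of_tendsto hre ?_
  filter_upwards [self_mem_nhdsWithin] with ε hε
  rw [Set.mem_Ioi] at hε
  have := H.three_four_one (σ := 1 + ε) (by linarith) t
  have h3 := mul_nonneg hε.le this
  rw [← Complex.re_ofReal_mul] at h3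
  refine h3.trans (le_of_eq ?_)
  simp only [Function.comp]
  congr 1
  push_cast
  rw [show (1 : ℂ) + ε + t * Complex.I = 1 + t * Complex.I + ε by ring,
    show (1 : ℂ) + ε + 2 * t * Complex.I = 1 + 2 * t * Complex.I + ε by ring]
  ring

theorem core_ne_zero {s : ℂ} (hs : 1 ≤ s.re) : H.core s ≠ 0 := by
  intro h0
  obtain ⟨m, hm, hlim⟩ := H.exists_order hs
  have hm := hm h0
  have hm1 : (1 : ℝ) ≤ m := by exact_mod_cast Nat.one_le_iff_ne_zero.2 hm
  rcases hs.lt_or_eq with hs1 | hs1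
  · have hcast : Tendsto (fun ε : ℝ => (ε : ℂ) * H.P (s + ε)) (𝓝[>] 0) (𝓝 0) := by
      have h1 : ContinuousAt (fun ε : ℝ => (ε : ℂ) * H.P (s + ε)) 0 := by
        have h2 : ContinuousAt H.P (s + ((0 : ℝ) : ℂ)) := by
          rw [Complex.ofReal_zero, add_zero]
          exact (H.differentiableAt_P hs1).continuousAt
        have h3 : ContinuousAt (fun ε : ℝ => s + (ε : ℂ)) 0 := by fun_prop
        exact (Complex.continuous_ofReal.continuousAt).mul
          (ContinuousAt.comp (f := fun ε : ℝ => s + (ε : ℂ)) (x := 0) h2 h3)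
      simpa using h1.tendsto.mono_left (nhdsWithin_le_nhds (s := Set.Ioi 0))
    have hne : s ≠ 1 := fun h => by simp [h] at hs1
    rw [if_neg hne, zero_sub] at hlim
    have := tendsto_nhds_unique hlim hcast
    rw [neg_eq_zero, Nat.cast_eq_zero] at this
    exact hm this
  · set t := s.im with ht
    have hst : s = 1 + t * Complex.I := by
      apply Complex.ext <;> simp [← hs1, ht]
    obtain ⟨m₀, -, hlim₀⟩ := (triv (K := K)).exists_order (s₀ := 1) (by simp)
    obtain ⟨m₂, -, hlim₂⟩ := H.sq.exists_order (s₀ := 1 + 2 * t * Complex.I) (by simp)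
    have hr0 : (triv (K := K)).residue = 1 := if_pos isTrivial_triv
    have hr1 : H.residue ≤ 1 := by rw [residue]; split_ifs <;> norm_num
    rw [if_pos rfl, hr0] at hlim₀
    have hineq := H.order_inequality (t := t) (m₀ := 1 - m₀)
      (m₁ := (if s = 1 then H.residue else 0) - m)
      (m₂ := (if 1 + 2 * t * Complex.I = 1 then H.sq.residue else 0) - m₂)
      (by simpa using hlim₀)
      (by rw [← hst]; convert hlim using 2; push_cast; split_ifs <;> simp)
      (by convert hlim₂ using 2; push_cast; split_ifs <;> simp)
    have hm0 : (0 : ℝ) ≤ m₀ := Nat.cast_nonneg _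
    have hm2 : (0 : ℝ) ≤ m₂ := Nat.cast_nonneg _
    by_cases hs2 : s = 1
    · have hH : ¬H.IsTrivial := fun h => H.core_one_ne_zero h (hs2 ▸ h0)
      have hr : H.residue = 0 := if_neg hH
      by_cases hsq : H.sq.IsTrivial
      · exact H.core_one_ne_zero_of_sq hH hsq (hs2 ▸ h0)
      · have hrs : H.sq.residue = 0 := if_neg hsq
        rw [if_pos hs2, hr, hrs, ite_self] at hineq
        linarith
    · have ht0 : t ≠ 0 := fun h => hs2 (by rw [hst, h]; simp)
      have : ¬(1 + 2 * (t : ℂ) * Complex.I = 1) := by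
        simp [ht0]
      rw [if_neg hs2, if_neg this] at hineq
      linarith

end HeckeChar

end

section

open Topology

variable {K}

namespace HeckeChar

variable (H : HeckeChar K)

/-- The regular part of `-L'/L`. -/
noncomputable def regularPart (s : ℂ) : ℂ := -(deriv H.core s / H.core s)

theorem continuousOn_regularPart : ContinuousOn H.regularPart {s | 1 ≤ s.re} := fun s hs =>
  ((H.differentiable_core.contDiff (n := 1)).continuous_deriv le_rfl |>.continuousAt.div
    H.differentiable_core.continuous.continuousAt (H.core_ne_zero hs)).neg.continuousWithinAt

theorem P_eq {s : ℂ} (hs : 1 < s.re) : H.P s = H.residue / (s - 1) + H.regularPart s := by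
  have h := H.core_ne_zero hs.le
  rw [regularPart, (H.hasDerivAt_core hs).deriv]
  field_simp
  ring

theorem hasSum_conj_P {s : ℂ} (hs : 1 < s.re) : HasSum (fun i : PrimePowers K =>
    starRingEnd ℂ (H.mangoldt i) * ((Ideal.absNorm i.ideal : ℝ) : ℂ) ^ (-s))
      (starRingEnd ℂ (H.P (starRingEnd ℂ s))) := by
  have h1 : HasSum (fun i : PrimePowers K =>
      H.mangoldt i * ((Ideal.absNorm i.ideal : ℝ) : ℂ) ^ (-(starRingEnd ℂ s)))
      (H.P (starRingEnd ℂ s)) := (H.summable_P (by simpa using hs)).hasSum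
  refine ((Complex.hasSum_conj'.2 h1)).congr_fun fun i => ?_
  have h2 : (((Ideal.absNorm i.ideal : ℕ) : ℝ) : ℂ).arg ≠ Real.pi := by
    rw [Complex.arg_ofReal_of_nonneg (Nat.cast_nonneg _)]
    exact Real.pi_pos.ne
  rw [map_mul, ← map_neg, Complex.cpow_conj _ _ h2, Complex.conj_ofReal, Complex.conj_conj]

theorem finite_absNorm_le (X : ℝ) :
    {i : PrimePowers K | (Ideal.absNorm i.ideal : ℝ) ≤ X}.Finite := by
  have h := (Ideal.finite_setOf_absNorm_le (S := 𝓞 K) ⌊X⌋₊).preimage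
    (PrimePowers.ideal_injective.injOn (s := Set.univ).mono (Set.subset_univ _))
  exact h.subset fun i hi => Nat.le_floor hi

theorem tendsto_sum_weight : Tendsto (fun X : ℝ => (∑' i : PrimePowers K,
    if (Ideal.absNorm i.ideal : ℝ) ≤ X then i.weight else 0) / X) atTop (𝓝 1) := by
  refine tendsto_sum_le_div_of_dirichletSeries (fun i : PrimePowers K => i.weight_pos.le)
    (fun i => i.one_le_absNorm) (fun σ hσ => PrimePowers.summable_weight hσ)
    (G := (triv (K := K)).regularPart) triv.continuousOn_regularPart fun s hs => ?_
  have := (triv (K := K)).P_eq hs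
  rw [residue, if_pos isTrivial_triv, Complex.ofReal_one] at this
  rw [← this, P]
  refine tsum_congr fun i => ?_
  rw [mangoldt, onIdeal_triv i.ideal_ne_bot, mul_one]

theorem tendsto_sum_re (hH : ¬H.IsTrivial) {c : ℂ} (hc : ‖c‖ = 1) :
    Tendsto (fun X : ℝ => (∑' i : PrimePowers K,
      if (Ideal.absNorm i.ideal : ℝ) ≤ X then (c * H.mangoldt i).re else 0) / X) atTop (𝓝 0) := by
  set a : PrimePowers K → ℝ := fun i => i.weight + (c * H.mangoldt i).re with ha
  have hnorm : ∀ i, |(c * H.mangoldt i).re| ≤ i.weight := fun i => by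
    refine (Complex.abs_re_le_norm _).trans ?_
    rw [_root_.norm_mul, hc, one_mul, norm_mangoldt]
  have ha0 : ∀ i, 0 ≤ a i := fun i => by
    have := neg_abs_le (c * H.mangoldt i).re
    have := hnorm i
    simp only [ha]; linarith
  have hmap : Set.MapsTo (starRingEnd ℂ) {s : ℂ | 1 ≤ s.re} {s : ℂ | 1 ≤ s.re} := fun s hs => by
    simpa using hs
  have hT := tendsto_sum_le_div_of_dirichletSeries ha0 (fun i => i.one_le_absNorm)
    (fun σ hσ => ((PrimePowers.summable_weight hσ).mul_left 2).of_nonneg_of_le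
      (fun i => mul_nonneg (ha0 i) (by positivity)) fun i => by
        rw [← mul_assoc]
        refine mul_le_mul_of_nonneg_right ?_ (by positivity)
        have := le_abs_self (c * H.mangoldt i).re
        have := hnorm i
        simp only [ha]; linarith)
    (G := fun s => (triv (K := K)).regularPart s + (c * H.regularPart s +
      starRingEnd ℂ c * starRingEnd ℂ (H.regularPart (starRingEnd ℂ s))) / 2)
    (triv.continuousOn_regularPart.add (((continuousOn_const.mul H.continuousOn_regularPart).add
      (continuousOn_const.mul (Complex.continuous_conj.comp_continuousOn
        (H.continuousOn_regularPart.comp Complex.continuous_conj.continuousOn hmap)))).div_const 2))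
    fun s hs => by
      have hs' : 1 < (starRingEnd ℂ s).re := by simpa using hs
      have h0 : HasSum (fun i : PrimePowers K =>
        (triv (K := K)).mangoldt i * ((Ideal.absNorm i.ideal : ℝ) : ℂ) ^ (-s))
        ((triv (K := K)).P s) := ((triv (K := K)).summable_P hs).hasSum
      have h1 : HasSum (fun i : PrimePowers K =>
        H.mangoldt i * ((Ideal.absNorm i.ideal : ℝ) : ℂ) ^ (-s)) (H.P s) :=
        (H.summable_P hs).hasSum
      have h2 := h0.add (((h1.mul_left c).add
        ((H.hasSum_conj_P hs).mul_left (starRingEnd ℂ c))).div_const 2)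
      rw [(triv (K := K)).P_eq hs, H.P_eq hs, H.P_eq hs', residue, residue, if_neg hH,
        if_pos isTrivial_triv] at h2
      refine (HasSum.tsum_eq (h2.congr_fun fun i => ?_)).trans ?_
      · have h3 := Complex.add_conj (c * H.mangoldt i)
        rw [map_mul] at h3
        simp only [ha]
        push_cast
        have h4 : (triv (K := K)).mangoldt i = i.weight := by
          rw [mangoldt, onIdeal_triv i.ideal_ne_bot, mul_one]
        rw [h4]
        push_cast at h3
        linear_combination (-((Ideal.absNorm i.ideal : ℝ) : ℂ) ^ (-s) / 2) * h3
      · simp only [Complex.ofReal_one, Complex.ofReal_zero, zero_div, zero_add]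
        ring
  have h := hT.sub (tendsto_sum_weight (K := K))
  rw [sub_self] at h
  refine h.congr fun X => ?_
  rw [← sub_div]
  congr 1
  have hfin := finite_absNorm_le (K := K) X
  have hs : ∀ f : PrimePowers K → ℝ,
      Summable fun i => if (Ideal.absNorm i.ideal : ℝ) ≤ X then f i else 0 := fun f =>
    summable_of_finite_support (hfin.subset fun i hi => by
      by_contra h
      exact hi (if_neg h))
  rw [← (hs _).tsum_sub (hs _)]
  refine tsum_congr fun i => ?_
  split_ifs <;> simp [ha]

/-- The prime ideal theorem for Hecke characters. -/
theorem tendsto_sum_mangoldt : Tendsto (fun X : ℝ => (∑' i : PrimePowers K,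
    if (Ideal.absNorm i.ideal : ℝ) ≤ X then H.mangoldt i else 0) / X) atTop
      (𝓝 (H.residue : ℂ)) := by
  have hfin := fun X => finite_absNorm_le (K := K) X
  have hs : ∀ X : ℝ,
      Summable fun i => if (Ideal.absNorm i.ideal : ℝ) ≤ X then H.mangoldt i else 0 := fun X =>
    summable_of_finite_support ((hfin X).subset fun i hi => by
      by_contra h
      exact hi (if_neg h))
  by_cases hH : H.IsTrivial
  · rw [residue, if_pos hH]
    have h := (Complex.continuous_ofReal.tendsto _).comp (tendsto_sum_weight (K := K))
    refine h.congr fun X => ?_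
    simp only [Function.comp]
    rw [Complex.ofReal_div, Complex.ofReal_tsum]
    congr 1
    refine tsum_congr fun i => ?_
    rw [mangoldt, hH _ i.ideal_ne_bot, mul_one]
    split_ifs <;> simp
  · rw [residue, if_neg hH]
    have h1 := (Complex.continuous_ofReal.tendsto _).comp
      (H.tendsto_sum_re hH (c := 1) (by simp))
    have h2 := (Complex.continuous_ofReal.tendsto _).comp
      (H.tendsto_sum_re hH (c := -Complex.I) (by simp))
    have h3 := h1.add (h2.mul_const Complex.I)
    rw [Complex.ofReal_zero, zero_mul, add_zero] at h3
    rw [Complex.ofReal_zero]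
    refine h3.congr fun X => ?_
    simp only [Function.comp]
    set S := ∑' i : PrimePowers K, if (Ideal.absNorm i.ideal : ℝ) ≤ X then H.mangoldt i else 0
      with hS
    have e1 : (∑' i : PrimePowers K,
        if (Ideal.absNorm i.ideal : ℝ) ≤ X then (1 * H.mangoldt i).re else 0) = S.re := by
      rw [hS, Complex.re_tsum (hs X)]
      refine tsum_congr fun i => ?_
      split_ifs <;> simp
    have e2 : (∑' i : PrimePowers K,
        if (Ideal.absNorm i.ideal : ℝ) ≤ X then (-Complex.I * H.mangoldt i).re else 0) = S.im := by
      rw [hS, Complex.im_tsum (hs X)]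
      refine tsum_congr fun i => ?_
      split_ifs <;> simp
    rw [e1, e2]
    push_cast
    conv_rhs => rw [← Complex.re_add_im S]
    ring

end HeckeChar

end

section

open Topology

/-- A smooth unitary character of the norm-nonzero part of the mixed space, trivial on positive
scalars. -/
structure IsUnitaryChar (f : mixedSpace K → ℂ) : Prop where
  map_mul : ∀ x y, mixedEmbedding.norm x ≠ 0 → mixedEmbedding.norm y ≠ 0 → f (x * y) = f x * f y
  norm_eq : ∀ x, mixedEmbedding.norm x ≠ 0 → ‖f x‖ = 1
  contDiffAt : ∀ x, mixedEmbedding.norm x ≠ 0 → ContDiffAt ℝ (⊤ : ℕ∞) f x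
  map_smul : ∀ (c : ℝ) x, 0 < c → mixedEmbedding.norm x ≠ 0 → f (c • x) = f x

/-- A unitary character which is trivial on units of the ring of integers. -/
structure IsArchChar (f : mixedSpace K → ℂ) : Prop extends IsUnitaryChar K f where
  map_unit : ∀ u : (𝓞 K)ˣ, f (mixedEmbedding K ((u : 𝓞 K) : K)) = 1

variable {K}

namespace IsUnitaryChar

variable {f g : mixedSpace K → ℂ}

theorem one : IsUnitaryChar K fun _ => 1 where
  map_mul _ _ _ _ := by simp
  norm_eq _ _ := by simp
  contDiffAt _ _ := contDiffAt_const
  map_smul _ _ _ _ := rfl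

theorem mul (hf : IsUnitaryChar K f) (hg : IsUnitaryChar K g) :
    IsUnitaryChar K fun v => f v * g v where
  map_mul x y hx hy := by
    rw [hf.map_mul x y hx hy, hg.map_mul x y hx hy]; ring
  norm_eq x hx := by rw [_root_.norm_mul, hf.norm_eq x hx, hg.norm_eq x hx, one_mul]
  contDiffAt x hx := (hf.contDiffAt x hx).mul (hg.contDiffAt x hx)
  map_smul c x hc hx := by rw [hf.map_smul c x hc hx, hg.map_smul c x hc hx]

theorem conj (hf : IsUnitaryChar K f) : IsUnitaryChar K fun v => starRingEnd ℂ (f v) where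
  map_mul x y hx hy := by rw [hf.map_mul x y hx hy, _root_.map_mul]
  norm_eq x hx := by rw [RCLike.norm_conj, hf.norm_eq x hx]
  contDiffAt x hx := Complex.conjCLE.contDiff.contDiffAt.comp x (hf.contDiffAt x hx)
  map_smul c x hc hx := by rw [hf.map_smul c x hc hx]

theorem pow (hf : IsUnitaryChar K f) (n : ℕ) : IsUnitaryChar K fun v => f v ^ n := by
  induction n with
  | zero => simpa using one
  | succ n ih => simpa only [pow_succ] using ih.mul hf

theorem ne_zero (hf : IsUnitaryChar K f) {x : mixedSpace K} (hx : mixedEmbedding.norm x ≠ 0) :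
    f x ≠ 0 := by
  rw [← norm_ne_zero_iff, hf.norm_eq x hx]; exact one_ne_zero

theorem map_one (hf : IsUnitaryChar K f) : f 1 = 1 := by
  have h1 : mixedEmbedding.norm (1 : mixedSpace K) ≠ 0 := by simp
  have h := hf.map_mul 1 1 h1 h1
  rw [one_mul] at h
  exact (mul_eq_left₀ (hf.ne_zero h1)).1 h.symm

theorem conj_mul_self (hf : IsUnitaryChar K f) {x : mixedSpace K}
    (hx : mixedEmbedding.norm x ≠ 0) : starRingEnd ℂ (f x) * f x = 1 := by
  rw [mul_comm, Complex.mul_conj, Complex.normSq_eq_norm_sq, hf.norm_eq x hx]; simp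

theorem exp_unitCoord (c : Fin (rank K) → ℝ) : IsUnitaryChar K fun v =>
    Complex.exp ((∑ j, c j * unitCoord v j : ℝ) * Complex.I) where
  map_mul x y hx hy := by
    rw [← Complex.exp_add, unitCoord_mul hx hy, ← add_mul, ← Complex.ofReal_add,
      ← Finset.sum_add_distrib]
    simp [mul_add]
  norm_eq x _ := Complex.norm_exp_ofReal_mul_I _
  contDiffAt x hx := by
    have h : ContDiffAt ℝ (⊤ : ℕ∞) (fun v : mixedSpace K => ∑ j, c j * unitCoord v j) x :=
      ContDiffAt.sum fun j _ => contDiffAt_const.mul (contDiffAt_unitCoord hx j)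
    have h2 := Complex.ofRealCLM.contDiff.contDiffAt.comp x h
    exact (Complex.contDiff_exp (𝕜 := ℝ)).contDiffAt.comp x (h2.mul contDiffAt_const)
  map_smul c x hc hx := by rw [unitCoord_smul hx hc.ne']

theorem eq_one_of_fundSystem (hf : IsUnitaryChar K f)
    (ht : ∀ ζ : torsion K, f (mixedEmbedding K (((ζ : (𝓞 K)ˣ) : 𝓞 K) : K)) = 1)
    (h : ∀ i, f (mixedEmbedding K (((fundSystem K i : (𝓞 K)ˣ) : 𝓞 K) : K)) = 1) (u : (𝓞 K)ˣ) :
    f (mixedEmbedding K ((u : 𝓞 K) : K)) = 1 := by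
  let F : (𝓞 K)ˣ →* ℂ :=
    { toFun u := f (mixedEmbedding K ((u : 𝓞 K) : K))
      map_one' := by simpa using hf.map_one
      map_mul' u v := by
        rw [← hf.map_mul _ _ (by simp [norm_mixedEmbedding_unit])
          (by simp [norm_mixedEmbedding_unit])]
        simp }
  obtain ⟨⟨ζ, n⟩, rfl, -⟩ := exist_unique_eq_mul_prod K u
  change F _ = 1
  have hF : ∀ i, F (fundSystem K i) = 1 := h
  have hu : ∀ i, F.toHomUnits (fundSystem K i) = 1 := fun i => Units.ext (hF i)
  have h2 : F.toHomUnits (∏ i, fundSystem K i ^ n i) = 1 := by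
    rw [map_prod]
    exact Finset.prod_eq_one fun i _ => by rw [map_zpow, hu, one_zpow]
  rw [_root_.map_mul, show F ζ = 1 from ht ζ, one_mul]
  exact congrArg Units.val h2

/-- Twisting by logarithmic coordinates makes a character trivial on torsion trivial on all
units. -/
theorem exists_twist (hf : IsUnitaryChar K f)
    (ht : ∀ ζ : torsion K, f (mixedEmbedding K (((ζ : (𝓞 K)ˣ) : 𝓞 K) : K)) = 1) :
    ∃ g, IsArchChar K g ∧ ∀ v, unitCoord v = 0 → g v = f v := by
  set c : Fin (rank K) → ℝ := fun j =>
    -Complex.arg (f (mixedEmbedding K (((fundSystem K j : (𝓞 K)ˣ) : 𝓞 K) : K))) with hc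
  have hg := hf.mul (exp_unitCoord c)
  refine ⟨_, ⟨hg, hg.eq_one_of_fundSystem (fun ζ => ?_) fun i => ?_⟩, fun v hv => by simp [hv]⟩
  · beta_reduce
    rw [ht, unitCoord_torsion]; simp
  · beta_reduce
    rw [unitCoord_fundSystem]
    have h1 := Complex.norm_mul_exp_arg_mul_I
      (f (mixedEmbedding K (((fundSystem K i : (𝓞 K)ˣ) : 𝓞 K) : K)))
    rw [hf.norm_eq _ (by simp [norm_mixedEmbedding_unit]), Complex.ofReal_one, one_mul] at h1
    rw [← h1, ← Complex.exp_add]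
    simp [hc, Pi.single_apply]

end IsUnitaryChar

namespace IsArchChar

variable {f g : mixedSpace K → ℂ}

theorem one : IsArchChar K fun _ => 1 := ⟨IsUnitaryChar.one, fun _ => rfl⟩

theorem mul (hf : IsArchChar K f) (hg : IsArchChar K g) : IsArchChar K fun v => f v * g v :=
  ⟨hf.toIsUnitaryChar.mul hg.toIsUnitaryChar, fun u => by simp [hf.map_unit, hg.map_unit]⟩

theorem conj (hf : IsArchChar K f) : IsArchChar K fun v => starRingEnd ℂ (f v) :=
  ⟨hf.toIsUnitaryChar.conj, fun u => by simp [hf.map_unit]⟩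

theorem map_unit_mul (hf : IsArchChar K f) (u : (𝓞 K)ˣ) {v : mixedSpace K}
    (hv : mixedEmbedding.norm v ≠ 0) : f (mixedEmbedding K ((u : 𝓞 K) : K) * v) = f v := by
  rw [hf.map_mul _ _ (by simp [norm_mixedEmbedding_unit]) hv, hf.map_unit, one_mul]

theorem map_real_smul (hf : IsArchChar K f) {c : ℝ} (hc : c ≠ 0) {v : mixedSpace K}
    (hv : mixedEmbedding.norm v ≠ 0) : f (c • v) = f v := by
  rcases lt_or_gt_of_ne hc with h | h
  · have h1 : c • v = mixedEmbedding K (((-1 : (𝓞 K)ˣ) : 𝓞 K) : K) * ((-c) • v) := by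
      simp
    rw [h1, hf.map_unit_mul _ (by
      rw [mixedEmbedding.norm_smul]
      exact mul_ne_zero (pow_ne_zero _ (abs_ne_zero.2 (neg_ne_zero.2 hc))) hv),
      hf.map_smul _ _ (by linarith) hv]
  · exact hf.map_smul c v h hv

theorem exp_unitCoord (j : Fin (rank K)) : IsArchChar K fun v =>
    Complex.exp ((2 * Real.pi * unitCoord v j : ℝ) * Complex.I) := by
  have h := IsUnitaryChar.exp_unitCoord (K := K) (Pi.single j (2 * Real.pi))
  simp only [Pi.single_apply, ite_mul, zero_mul, Finset.sum_ite_eq', Finset.mem_univ,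
    if_true] at h
  refine ⟨h, fun u => ?_⟩
  obtain ⟨⟨ζ, n⟩, rfl, -⟩ := exist_unique_eq_mul_prod K u
  rw [unitCoord_unit]
  have := Complex.exp_int_mul_two_pi_mul_I (n j)
  rw [← this]
  congr 1
  push_cast
  ring

end IsArchChar

end

section

open Topology

variable {K}

/-- The coordinate of the mixed space at an infinite place, as a complex number. -/
noncomputable def coordHom (w : InfinitePlace K) : mixedSpace K →+* ℂ :=
  if h : IsReal w then
    (Complex.ofRealHom.comp (Pi.evalRingHom _ ⟨w, h⟩)).comp (RingHom.fst _ _)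
  else
    (Pi.evalRingHom _ ⟨w, not_isReal_iff_isComplex.1 h⟩).comp (RingHom.snd _ _)

theorem coordHom_of_isReal {w : InfinitePlace K} (h : IsReal w) (v : mixedSpace K) :
    coordHom w v = (v.1 ⟨w, h⟩ : ℂ) := by
  simp [coordHom, h]

theorem coordHom_of_isComplex {w : InfinitePlace K} (h : IsComplex w) (v : mixedSpace K) :
    coordHom w v = v.2 ⟨w, h⟩ := by
  simp [coordHom, not_isReal_iff_isComplex.2 h]

theorem norm_coordHom (w : InfinitePlace K) (v : mixedSpace K) :
    ‖coordHom w v‖ = normAtPlace w v := by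
  rcases isReal_or_isComplex w with h | h
  · rw [coordHom_of_isReal h, normAtPlace_apply_of_isReal h, Complex.norm_real]
  · rw [coordHom_of_isComplex h, normAtPlace_apply_of_isComplex h]

theorem coordHom_smul (w : InfinitePlace K) (c : ℝ) (v : mixedSpace K) :
    coordHom w (c • v) = c * coordHom w v := by
  rcases isReal_or_isComplex w with h | h
  · simp [coordHom_of_isReal h]
  · simp [coordHom_of_isComplex h]

theorem contDiff_coordHom (w : InfinitePlace K) :
    ContDiff ℝ (⊤ : ℕ∞) (coordHom w : mixedSpace K → ℂ) := by
  let L : mixedSpace K →ₗ[ℝ] ℂ :=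
    { toFun := coordHom w
      map_add' := map_add _
      map_smul' := fun c v => by simp [coordHom_smul] }
  exact L.toContinuousLinearMap.contDiff

theorem eq_of_coordHom_eq {v v' : mixedSpace K} (h : ∀ w, coordHom w v = coordHom w v') :
    v = v' := by
  ext w
  · have := h w.1
    rw [coordHom_of_isReal w.2, coordHom_of_isReal w.2] at this
    exact_mod_cast this
  · have := h w.1
    rwa [coordHom_of_isComplex w.2, coordHom_of_isComplex w.2] at this

/-- The unitary part of the coordinate at an infinite place. -/
noncomputable def signAt (w : InfinitePlace K) (v : mixedSpace K) : ℂ :=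
  coordHom w v * ((normAtPlace w v : ℝ) : ℂ)⁻¹

theorem isUnitaryChar_signAt (w : InfinitePlace K) : IsUnitaryChar K (signAt w) where
  map_mul x y _ _ := by
    simp only [signAt, map_mul, Complex.ofReal_mul, mul_inv]; ring
  norm_eq x hx := by
    rw [signAt, _root_.norm_mul, norm_coordHom, norm_inv, Complex.norm_real, Real.norm_eq_abs,
      abs_of_nonneg (normAtPlace_nonneg _ _)]
    exact mul_inv_cancel₀ (mixedEmbedding.norm_ne_zero_iff.1 hx w)
  contDiffAt x hx := by
    have h0 := mixedEmbedding.norm_ne_zero_iff.1 hx w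
    have h := Complex.ofRealCLM.contDiff.contDiffAt.comp x (contDiffAt_normAtPlace h0)
    exact (contDiff_coordHom w).contDiffAt.mul (h.inv (by simpa using h0))
  map_smul c x hc hx := by
    have hc' : (c : ℂ) ≠ 0 := by exact_mod_cast hc.ne'
    rw [signAt, signAt, coordHom_smul, normAtPlace_smul, abs_of_pos hc]
    push_cast
    field_simp

theorem signAt_eq {w : InfinitePlace K} {v : mixedSpace K} (h : normAtPlace w v = 1) :
    signAt w v = coordHom w v := by
  simp [signAt, h]

theorem normAtPlace_torsion (w : InfinitePlace K) (ζ : torsion K) :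
    normAtPlace w (mixedEmbedding K (((ζ : (𝓞 K)ˣ) : 𝓞 K) : K)) = 1 := by
  rw [normAtPlace_apply]
  exact (mem_torsion K).1 ζ.2 w

/-- The coordinate at an infinite place on the torsion units. -/
noncomputable def torsionHom (w : InfinitePlace K) : torsion K →* ℂ :=
  (((coordHom w).comp (mixedEmbedding K)).comp (algebraMap (𝓞 K) K) : 𝓞 K →* ℂ).comp
    ((Units.coeHom (𝓞 K)).comp (torsion K).subtype)

theorem torsionHom_apply (w : InfinitePlace K) (ζ : torsion K) :
    torsionHom w ζ = coordHom w (mixedEmbedding K (((ζ : (𝓞 K)ˣ) : 𝓞 K) : K)) := rfl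

theorem signAt_torsion (w : InfinitePlace K) (ζ : torsion K) :
    signAt w (mixedEmbedding K (((ζ : (𝓞 K)ˣ) : 𝓞 K) : K)) = torsionHom w ζ :=
  signAt_eq (normAtPlace_torsion w ζ)

theorem torsionHom_pow_torsionOrder (w : InfinitePlace K) (ζ : torsion K) :
    torsionHom w ζ ^ torsionOrder K = 1 := by
  rw [← map_pow, torsionOrder, pow_card_eq_one', map_one]

theorem exists_torsionHom_eq (w : InfinitePlace K) {z : ℂ} (hz : z ^ torsionOrder K = 1) :
    ∃ ζ : torsion K, torsionHom w ζ = z := by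
  have h := map_complexEmbedding_torsion K ((coordHom w).comp (mixedEmbedding K))
  have hz0 : z ≠ 0 := by
    rintro rfl
    rw [zero_pow (torsionOrder_ne_zero K)] at hz
    exact zero_ne_one hz
  have hm : Units.mk0 z hz0 ∈ rootsOfUnity (torsionOrder K) ℂ := by
    rw [mem_rootsOfUnity]; ext; simpa using hz
  rw [← h] at hm
  obtain ⟨ζ, hζ, hζ'⟩ := hm
  exact ⟨⟨ζ, hζ⟩, congrArg Units.val hζ'⟩

theorem exists_torsionHom_eq_pow (w w' : InfinitePlace K) :
    ∃ k : ℕ, ∀ ζ : torsion K, torsionHom w' ζ = torsionHom w ζ ^ k := by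
  obtain ⟨g, hg⟩ := IsCyclic.exists_generator (α := torsion K)
  have hinj : Function.Injective (torsionHom w) := by
    intro a b hab
    exact Subtype.ext (Units.ext (RingOfIntegers.ext
      (((coordHom w).comp (mixedEmbedding K)).injective hab)))
  have hord : orderOf g = torsionOrder K := orderOf_eq_card_of_forall_mem_zpowers hg
  have hp : IsPrimitiveRoot (torsionHom w g) (torsionOrder K) := by
    rw [← hord]
    exact (IsPrimitiveRoot.orderOf g).map_of_injective hinj
  obtain ⟨k, -, hk⟩ := hp.eq_pow_of_pow_eq_one (torsionHom_pow_torsionOrder w' g)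
  refine ⟨k, fun ζ => ?_⟩
  have : (torsionHom w').toHomUnits = (torsionHom w).toHomUnits ^ k := by
    refine MonoidHom.ext fun x => ?_
    obtain ⟨m, rfl⟩ := Subgroup.mem_zpowers_iff.1 (hg x)
    have h1 : (torsionHom w').toHomUnits g = (torsionHom w).toHomUnits g ^ k :=
      Units.ext hk.symm
    rw [map_zpow, MonoidHom.pow_apply, map_zpow, h1, ← zpow_natCast, ← zpow_natCast, zpow_comm]
  exact congrArg Units.val (DFunLike.congr_fun this ζ)

theorem normAtPlace_eq_one {v : mixedSpace K} (hv : mixedEmbedding.norm v = 1)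
    (ht : unitCoord v = 0) (w : InfinitePlace K) : normAtPlace w v = 1 := by
  have hv0 : mixedEmbedding.norm v ≠ 0 := by simp [hv]
  have hpos : ∀ w, 0 < normAtPlace w v := fun w =>
    lt_of_le_of_ne (normAtPlace_nonneg _ _) (mixedEmbedding.norm_ne_zero_iff.1 hv0 w).symm
  have hl : logMap v = 0 := by
    have h := ((basisUnitLattice K).ofZLatticeBasis ℝ (unitLattice K)).sum_repr (logMap v)
    rw [← h]
    refine Finset.sum_eq_zero fun j _ => ?_
    have : ((basisUnitLattice K).ofZLatticeBasis ℝ (unitLattice K)).repr (logMap v) j = 0 :=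
      congrFun ht j
    rw [this, zero_smul]
  have hm : ∀ w : InfinitePlace K, (mult w : ℝ) ≠ 0 := fun w => by simp
  have h1 : ∀ w, w ≠ dirichletUnitTheorem.w₀ → Real.log (normAtPlace w v) = 0 := fun w hw => by
    have h := congrFun hl ⟨w, hw⟩
    rw [logMap_apply_of_norm_eq_one hv, Pi.zero_apply] at h
    exact (mul_eq_zero.1 h).resolve_left (hm w)
  have h2 := sum_mult_mul_log_normAtPlace hv0
  rw [hv, Real.log_one, zero_mul] at h2
  simp only [sub_zero] at h2
  rw [Finset.sum_eq_single dirichletUnitTheorem.w₀ (fun w _ hw => by rw [h1 w hw, mul_zero])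
    (by simp)] at h2
  have h3 := (mul_eq_zero.1 h2).resolve_left (hm _)
  have h4 : Real.log (normAtPlace w v) = 0 := by
    by_cases hw : w = dirichletUnitTheorem.w₀
    · rw [hw, h3]
    · exact h1 w hw
  exact Real.eq_one_of_pos_of_log_eq_zero (hpos w) h4

/-- Norm-one vectors killed by all characters trivial on units are units. -/
theorem exists_unit_of_forall_isArchChar {v : mixedSpace K} (hv : mixedEmbedding.norm v = 1)
    (h : ∀ f, IsArchChar K f → f v = 1) :
    ∃ u : (𝓞 K)ˣ, v = mixedEmbedding K ((u : 𝓞 K) : K) := by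
  have hInt : ∀ j, ∃ n : ℤ, unitCoord v j = n := fun j => by
    have h1 := h _ (IsArchChar.exp_unitCoord j)
    rw [Complex.exp_eq_one_iff] at h1
    obtain ⟨n, hn⟩ := h1
    refine ⟨n, ?_⟩
    have h2 : ((2 * Real.pi * unitCoord v j : ℝ) : ℂ) = ((n * (2 * Real.pi) : ℝ) : ℂ) := by
      apply mul_right_cancel₀ Complex.I_ne_zero
      rw [hn]; push_cast; ring
    have h3 : 2 * Real.pi * unitCoord v j = n * (2 * Real.pi) := by exact_mod_cast h2
    have := Real.pi_pos
    field_simp at h3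
    linarith
  choose n hn using hInt
  set u₁ : (𝓞 K)ˣ := ((1 : torsion K) : (𝓞 K)ˣ) * ∏ i, fundSystem K i ^ (-n i) with hu₁
  set x := mixedEmbedding K ((u₁ : 𝓞 K) : K) * v with hx
  have hx1 : mixedEmbedding.norm x = 1 := by rw [hx, norm_unit_mul, hv]
  have hx0 : mixedEmbedding.norm x ≠ 0 := by simp [hx1]
  have hxt : unitCoord x = 0 := by
    rw [hx, unitCoord_mul (by simp [norm_mixedEmbedding_unit]) (by simp [hv]), hu₁, unitCoord_unit]
    ext j
    simp [hn]
  have hxf : ∀ f, IsArchChar K f → f x = 1 := fun f hf => by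
    rw [hx, hf.map_unit_mul _ (by simp [hv]), h f hf]
  have hxn := normAtPlace_eq_one hx1 hxt
  have key : ∀ f, IsUnitaryChar K f →
      (∀ ζ : torsion K, f (mixedEmbedding K (((ζ : (𝓞 K)ˣ) : 𝓞 K) : K)) = 1) → f x = 1 := by
    intro f hf ht
    obtain ⟨g, hg, hgf⟩ := hf.exists_twist ht
    rw [← hgf x hxt, hxf g hg]
  set w₀ : InfinitePlace K := dirichletUnitTheorem.w₀
  have h1 := key _ ((isUnitaryChar_signAt w₀).pow (torsionOrder K)) fun ζ => by
    rw [signAt_torsion, torsionHom_pow_torsionOrder]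
  rw [signAt_eq (hxn w₀)] at h1
  obtain ⟨ζ, hζ⟩ := exists_torsionHom_eq w₀ h1
  have h2 : x = mixedEmbedding K (((ζ : (𝓞 K)ˣ) : 𝓞 K) : K) := by
    refine eq_of_coordHom_eq fun w => ?_
    obtain ⟨k, hk⟩ := exists_torsionHom_eq_pow w₀ w
    have h3 := key _ ((isUnitaryChar_signAt w).conj.mul ((isUnitaryChar_signAt w₀).pow k))
      fun ζ' => by
        rw [signAt_torsion w₀, ← hk ζ', ← signAt_torsion w]
        exact (isUnitaryChar_signAt w).conj_mul_self (by simp [norm_mixedEmbedding_unit])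
    have h4 := (isUnitaryChar_signAt w).conj_mul_self hx0
    have h5 := mul_left_cancel₀ (left_ne_zero_of_mul_eq_one h4) (h4.trans h3.symm)
    rw [signAt_eq (hxn w), signAt_eq (hxn w₀), ← hζ, ← hk ζ] at h5
    rw [h5, torsionHom_apply]
  refine ⟨u₁⁻¹ * ζ, ?_⟩
  have h6 : v = mixedEmbedding K (((u₁⁻¹ : (𝓞 K)ˣ) : 𝓞 K) : K) * x := by
    rw [hx, ← mul_assoc, ← map_mul, ← map_mul, Units.inv_mul, map_one, map_one, one_mul]
  rw [h6, h2, ← map_mul, ← map_mul, Units.val_mul]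

end

section

open Topology

variable {K}

variable (K) in
/-- A compact set of representatives for the norm-one hypersurface modulo units. -/
def fundamentalCompact : Set (mixedSpace K) :=
  {v | mixedEmbedding.norm v = 1 ∧ ∀ j, unitCoord v j ∈ Set.Icc (0 : ℝ) 1}

theorem isCompact_fundamentalCompact : IsCompact (fundamentalCompact K) := by
  refine Metric.isCompact_of_isClosed_isBounded ?_ ?_
  · have h1 : IsClosed {v : mixedSpace K | mixedEmbedding.norm v = 1} :=
      isClosed_eq (mixedEmbedding.continuous_norm K) continuous_const
    have h2 : ContinuousOn (unitCoord : mixedSpace K → _) {v | mixedEmbedding.norm v = 1} := by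
      refine continuousOn_pi.2 fun j v hv => ?_
      have hv1 : mixedEmbedding.norm v = 1 := hv
      exact (contDiffAt_unitCoord (by simp [hv1]) j).continuousAt.continuousWithinAt
    have h3 := h2.preimage_isClosed_of_isClosed h1
      (isClosed_set_pi (i := Set.univ) (s := fun _ => Set.Icc (0 : ℝ) 1) fun _ _ => isClosed_Icc)
    have h4 : fundamentalCompact K = {v : mixedSpace K | mixedEmbedding.norm v = 1} ∩
        unitCoord ⁻¹' Set.univ.pi fun _ => Set.Icc (0 : ℝ) 1 := by
      ext v
      simp [fundamentalCompact, Set.mem_pi, Pi.le_def, forall_and]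
    rwa [h4]
  · obtain ⟨B, hB, h⟩ := exists_normAtPlace_le (K := K) 1
    refine (Metric.isBounded_closedBall (x := (0 : mixedSpace K)) (r := B)).subset ?_
    rintro v ⟨hv, ht⟩
    rw [mem_closedBall_zero_iff, norm_eq_sup'_normAtPlace]
    refine Finset.sup'_le _ _ fun w _ => ?_
    have := h v (by simp [hv]) (fun j => abs_le.2 ⟨by linarith [(ht j).1], (ht j).2⟩) w
    rwa [hv, Real.one_rpow, mul_one] at this

theorem exists_smul_mem_fundamentalCompact {v : mixedSpace K} (hv : mixedEmbedding.norm v ≠ 0) :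
    ∃ (c : ℝ) (u : (𝓞 K)ˣ), 0 < c ∧
      c • (mixedEmbedding K ((u : 𝓞 K) : K) * v) ∈ fundamentalCompact K := by
  have hn : Module.finrank ℚ K ≠ 0 := Module.finrank_pos.ne'
  have hpos : 0 < mixedEmbedding.norm v := lt_of_le_of_ne (mixedEmbedding.norm_nonneg _) hv.symm
  have hc : 0 < mixedEmbedding.norm v ^ (-(Module.finrank ℚ K : ℝ)⁻¹) :=
    Real.rpow_pos_of_pos hpos _
  set u : (𝓞 K)ˣ := ((1 : torsion K) : (𝓞 K)ˣ) * ∏ i, fundSystem K i ^ (-⌊unitCoord v i⌋) with hu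
  refine ⟨_, u, hc, ?_, fun j => ?_⟩
  · rw [mixedEmbedding.norm_smul, norm_unit_mul, abs_of_pos hc, ← Real.rpow_natCast,
      ← Real.rpow_mul hpos.le,
      neg_mul, inv_mul_cancel₀ (by exact_mod_cast hn), Real.rpow_neg_one, inv_mul_cancel₀ hv]
  · rw [unitCoord_smul (by rwa [norm_unit_mul]) hc.ne',
      unitCoord_mul (by simp [norm_mixedEmbedding_unit]) hv, hu, unitCoord_unit]
    have h1 := Int.floor_le (unitCoord v j)
    have h2 := Int.lt_floor_add_one (unitCoord v j)
    simp only [Pi.add_apply, Int.cast_neg, Set.mem_Icc]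
    constructor <;> linarith

variable (K) in
/-- The linear span of the characters trivial on units. -/
noncomputable def archSpan : Submodule ℂ (mixedSpace K → ℂ) :=
  Submodule.span ℂ {f | IsArchChar K f}

theorem archSpan_mul {f g : mixedSpace K → ℂ} (hf : f ∈ archSpan K) (hg : g ∈ archSpan K) :
    f * g ∈ archSpan K := by
  have h := Submodule.mul_mem_mul hf hg
  rw [archSpan, Submodule.span_mul_span] at h
  refine Submodule.span_mono ?_ h
  rintro _ ⟨a, ha, b, hb, rfl⟩
  exact ha.mul hb

theorem archSpan_star {f : mixedSpace K → ℂ} (hf : f ∈ archSpan K) : star f ∈ archSpan K := by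
  induction hf using Submodule.span_induction with
  | mem f hf => exact Submodule.subset_span hf.conj
  | zero => rw [star_zero]; exact Submodule.zero_mem _
  | add f g _ _ hf hg => rw [star_add]; exact Submodule.add_mem _ hf hg
  | smul c f _ hf => rw [star_smul]; exact Submodule.smul_mem _ _ hf

theorem archSpan_invariant {f : mixedSpace K → ℂ} (hf : f ∈ archSpan K) {c : ℝ} (hc : 0 < c)
    (u : (𝓞 K)ˣ) {v : mixedSpace K} (hv : mixedEmbedding.norm v ≠ 0) :
    f (c • (mixedEmbedding K ((u : 𝓞 K) : K) * v)) = f v := by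
  induction hf using Submodule.span_induction with
  | mem f hf =>
    have hf' : IsArchChar K f := hf
    rw [hf'.map_smul _ _ hc (by rwa [norm_unit_mul]), hf'.map_unit_mul u hv]
  | zero => rfl
  | add f g _ _ hf hg => rw [Pi.add_apply, hf, hg, Pi.add_apply]
  | smul c f _ hf => rw [Pi.smul_apply, hf, Pi.smul_apply]

variable (K) in
/-- Points of the compact set of representatives not distinguished by characters. -/
def archSetoid : Setoid (fundamentalCompact K) where
  r v v' := ∀ f, IsArchChar K f → f v = f v'
  iseqv := ⟨fun _ _ _ => rfl, fun h f hf => (h f hf).symm, fun h h' f hf =>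
    (h f hf).trans (h' f hf)⟩

variable (K) in
/-- The quotient of the compact set of representatives on which characters separate points. -/
abbrev ArchQuotient := Quotient (archSetoid K)

variable (K) in
/-- The algebra of functions on the quotient spanned by characters. -/
noncomputable def archAlgebra : StarSubalgebra ℂ C(ArchQuotient K, ℂ) where
  carrier := {g | ∃ f ∈ archSpan K, ∀ v : fundamentalCompact K, g (Quotient.mk _ v) = f v}
  mul_mem' := by
    rintro a b ⟨f, hf, hf'⟩ ⟨g, hg, hg'⟩
    exact ⟨f * g, archSpan_mul hf hg, fun v => by simp [hf', hg']⟩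
  add_mem' := by
    rintro a b ⟨f, hf, hf'⟩ ⟨g, hg, hg'⟩
    exact ⟨f + g, Submodule.add_mem _ hf hg, fun v => by simp [hf', hg']⟩
  algebraMap_mem' c := ⟨c • fun _ => 1, Submodule.smul_mem _ _
    (Submodule.subset_span IsArchChar.one), fun v => by simp [Algebra.algebraMap_eq_smul_one]⟩
  star_mem' := by
    rintro a ⟨f, hf, hf'⟩
    exact ⟨star f, archSpan_star hf, fun v => by simp [hf']⟩

theorem exists_mem_archSpan_approx {φ : mixedSpace K → ℂ}
    (hcont : ContinuousOn φ {v : mixedSpace K | mixedEmbedding.norm v ≠ 0})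
    (hunit : ∀ (u : (𝓞 K)ˣ) (v : mixedSpace K),
      φ (mixedEmbedding K (((u : 𝓞 K) : K)) * v) = φ v)
    (hscal : ∀ c : ℝ, c ≠ 0 → ∀ v : mixedSpace K, φ (c • v) = φ v) {ε : ℝ} (hε : 0 < ε) :
    ∃ f ∈ archSpan K, ∀ v, mixedEmbedding.norm v ≠ 0 → ‖φ v - f v‖ ≤ ε := by
  have hC0 : ∀ v : fundamentalCompact K, mixedEmbedding.norm (v : mixedSpace K) ≠ 0 := fun v => by
    simp [v.2.1]
  have hcompact : CompactSpace (fundamentalCompact K) :=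
    isCompact_iff_compactSpace.1 isCompact_fundamentalCompact
  have hQ : CompactSpace (ArchQuotient K) := Quotient.compactSpace
  have hsep : (archAlgebra K).SeparatesPoints := by
    intro q q' hq
    induction q using Quotient.inductionOn with | _ v => ?_
    induction q' using Quotient.inductionOn with | _ v' => ?_
    have h : ¬ ∀ f, IsArchChar K f → f v = f v' := fun h => hq (Quotient.sound h)
    push Not at h
    obtain ⟨f, hf, hne⟩ := h
    have hfc : Continuous fun v : fundamentalCompact K => f v :=
      continuous_iff_continuousAt.2 fun v =>
        (hf.contDiffAt v (hC0 v)).continuousAt.comp continuous_subtype_val.continuousAt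
    let F : C(ArchQuotient K, ℂ) :=
      ⟨Quotient.lift (fun v => f v) fun a b (hab : ∀ f, IsArchChar K f → f a = f b) => hab f hf,
        hfc.quotient_lift _⟩
    exact ⟨F, ⟨F, ⟨f, Submodule.subset_span hf, fun v => rfl⟩, rfl⟩, hne⟩
  have hφC : Continuous fun v : fundamentalCompact K => φ v := by
    have : ContinuousOn φ (fundamentalCompact K) := hcont.mono fun v hv => hC0 ⟨v, hv⟩
    exact continuousOn_iff_continuous_restrict.1 this
  have hφs : ∀ a b : fundamentalCompact K, (∀ f, IsArchChar K f → f a = f b) → φ a = φ b := by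
    intro a b hab
    obtain ⟨w, hw⟩ := exists_mul_eq_one (hC0 b)
    have hw1 : mixedEmbedding.norm w = 1 := by
      have := congrArg mixedEmbedding.norm hw
      rwa [map_mul, b.2.1, one_mul, map_one] at this
    have hw0 : mixedEmbedding.norm w ≠ 0 := by simp [hw1]
    obtain ⟨u, hu⟩ := exists_unit_of_forall_isArchChar (v := (a : mixedSpace K) * w)
      (by rw [map_mul, a.2.1, hw1, one_mul]) fun f hf => by
        rw [hf.map_mul _ _ (hC0 a) hw0, hab f hf, ← hf.map_mul _ _ (hC0 b) hw0, hw, hf.map_one]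
    have : (a : mixedSpace K) = mixedEmbedding K ((u : 𝓞 K) : K) * b := by
      rw [← hu, mul_assoc, mul_comm w, hw, mul_one]
    rw [this, hunit]
  let Φ : C(ArchQuotient K, ℂ) := ⟨Quotient.lift (fun v => φ v) hφs, hφC.quotient_lift _⟩
  have htop := ContinuousMap.starSubalgebra_topologicalClosure_eq_top_of_separatesPoints
    (archAlgebra K) hsep
  have hmem : Φ ∈ (archAlgebra K).topologicalClosure := by rw [htop]; trivial
  have hmem' : Φ ∈ closure (archAlgebra K : Set C(ArchQuotient K, ℂ)) := hmem
  obtain ⟨g, ⟨f, hf, hgf⟩, hg⟩ := Metric.mem_closure_iff.1 hmem' ε hε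
  refine ⟨f, hf, fun v hv => ?_⟩
  obtain ⟨c, u, hc, hcv⟩ := exists_smul_mem_fundamentalCompact hv
  have h1 := ContinuousMap.dist_apply_le_dist (f := Φ) (g := g)
    (Quotient.mk (archSetoid K) ⟨_, hcv⟩)
  rw [hgf] at h1
  have h2 : Φ (Quotient.mk (archSetoid K) ⟨_, hcv⟩) = φ v := by
    change φ _ = φ v
    rw [hscal c hc.ne', hunit]
  rw [h2, archSpan_invariant hf hc u hv, dist_eq_norm] at h1
  exact h1.trans hg.le

end

section

open Topology nonZeroDivisors

section CircleExtension

/-- The circle is divisible. -/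
noncomputable instance divisibleByAdditiveCircle : DivisibleBy (Additive Circle) ℤ :=
  divisibleByOfSMulRightSurj _ _ fun {n} hn z => by
    obtain ⟨t, ht⟩ := Circle.exp_surjective z.toMul
    refine ⟨Additive.ofMul (Circle.exp (t / n)), ?_⟩
    apply Additive.toMul.injective
    change Circle.exp (t / n) ^ n = z.toMul
    rw [← ht]
    ext
    rw [Circle.coe_zpow, Circle.coe_exp, Circle.coe_exp, ← Complex.exp_int_mul]
    congr 1
    push_cast
    have : (n : ℂ) ≠ 0 := by exact_mod_cast hn
    field_simp

/-- Unitary characters extend from a quotient of a subgroup of a commutative group. -/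
theorem exists_circle_extension {A G : Type*} [CommGroup A] [CommGroup G] (p : A →* G)
    (θ : A →* Circle) (h : ∀ a, p a = 1 → θ a = 1) : ∃ ψ : G →* Circle, ∀ a, ψ (p a) = θ a := by
  let q : A ⧸ p.ker →* G := QuotientGroup.kerLift p
  let t : A ⧸ p.ker →* Circle := QuotientGroup.lift p.ker θ fun a ha => h a ha
  obtain ⟨ψ, hψ⟩ := (Module.Baer.of_divisible (Additive Circle)).extension_property_addMonoidHom
    q.toAdditive (QuotientGroup.kerLift_injective p) t.toAdditive
  refine ⟨MonoidHom.toAdditive.symm ψ, fun a => ?_⟩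
  exact DFunLike.congr_fun hψ (Additive.ofMul (QuotientGroup.mk a))

end CircleExtension

variable {K}

theorem exists_unit_of_toPrincipalIdeal_eq_one {x : Kˣ} (hx : toPrincipalIdeal (𝓞 K) K x = 1) :
    ∃ u : (𝓞 K)ˣ, ((u : 𝓞 K) : K) = x := by
  rw [toPrincipalIdeal_eq_iff, Units.val_one] at hx
  have h1 : (x : K) ∈ (1 : FractionalIdeal (𝓞 K)⁰ K) := by
    rw [← hx]; exact FractionalIdeal.mem_spanSingleton_self _ _
  have h2 : (1 : K) ∈ FractionalIdeal.spanSingleton (𝓞 K)⁰ (x : K) := by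
    rw [hx]; exact FractionalIdeal.one_mem_one _
  obtain ⟨a, ha⟩ := (FractionalIdeal.mem_one_iff _).1 h1
  obtain ⟨b, hb⟩ := (FractionalIdeal.mem_spanSingleton _).1 h2
  have hab : a * b = 1 := by
    apply RingOfIntegers.ext
    rw [Algebra.smul_def, ← ha] at hb
    rw [mul_comm]
    simpa using hb
  exact ⟨⟨a, b, hab, by rw [mul_comm, hab]⟩, ha⟩

/-- A character trivial on units extends to a Hecke character. -/
theorem IsArchChar.exists_heckeChar {f : mixedSpace K → ℂ} (hf : IsArchChar K f) :
    ∃ H : HeckeChar K, H.toFun = f := by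
  have hK : ∀ x : Kˣ, mixedEmbedding.norm (mixedEmbedding K (x : K)) ≠ 0 := fun x => by
    rw [Ne, norm_eq_zero_iff' ⟨_, rfl⟩, map_eq_zero]
    exact x.ne_zero
  let θ : Kˣ →* Circle :=
    { toFun x := ⟨f (mixedEmbedding K (x : K)), by
        exact mem_sphere_zero_iff_norm.2 (hf.norm_eq _ (hK x))⟩
      map_one' := by
        ext; simpa using hf.map_one
      map_mul' x y := by
        ext
        change f (mixedEmbedding K ((x : K) * (y : K))) = _
        rw [map_mul]
        exact hf.map_mul _ _ (hK x) (hK y) }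
  obtain ⟨ψ, hψ⟩ := exists_circle_extension (toPrincipalIdeal (𝓞 K) K) θ fun x hx => by
    obtain ⟨u, hu⟩ := exists_unit_of_toPrincipalIdeal_eq_one hx
    ext
    change f (mixedEmbedding K (x : K)) = 1
    rw [← hu, hf.map_unit]
  refine ⟨{
    toFun := f
    onIdeal :=
      { toFun I := if h : I = ⊥ then 0 else
          (ψ (FractionalIdeal.mk0 K ⟨I, mem_nonZeroDivisors_of_ne_zero h⟩) : ℂ)
        map_zero' := by simp
        map_one' := by
          rw [dif_neg (by simp)]
          have : (⟨1, mem_nonZeroDivisors_of_ne_zero (by simp)⟩ : (Ideal (𝓞 K))⁰) = 1 := rfl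
          rw [this, map_one, map_one, Circle.coe_one]
        map_mul' I J := by
          by_cases hI : I = ⊥
          · simp [hI]
          by_cases hJ : J = ⊥
          · simp [hJ]
          have hIJ : I * J ≠ ⊥ := mul_ne_zero hI hJ
          rw [dif_neg hI, dif_neg hJ, dif_neg hIJ, ← Circle.coe_mul, ← map_mul, ← map_mul]
          rfl }
    map_mul' := hf.map_mul
    norm_toFun' := hf.norm_eq
    contDiffAt' := hf.contDiffAt
    map_smul' := fun c x hc hx => hf.map_real_smul hc hx
    norm_onIdeal' := fun I hI => by
      change ‖dite _ _ _‖ = 1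
      rw [dif_neg hI, Circle.norm_coe]
    onIdeal_span' := fun a ha => ?_ }, rfl⟩
  have ha' : Ideal.span {a} ≠ ⊥ := by simpa using ha
  have haK : (a : K) ≠ 0 := by simpa using ha
  change dite _ _ _ = _
  rw [dif_neg ha']
  have : FractionalIdeal.mk0 K ⟨Ideal.span {a}, mem_nonZeroDivisors_of_ne_zero ha'⟩ =
      toPrincipalIdeal (𝓞 K) K (Units.mk0 (a : K) haK) := by
    ext1
    rw [FractionalIdeal.coe_mk0, coe_toPrincipalIdeal, FractionalIdeal.coeIdeal_span_singleton]
    rfl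
  rw [this, hψ]
  rfl

namespace HeckeChar

variable (H : HeckeChar K)

/-- A character of the class group evaluated at an ideal. -/
noncomputable def classChar (κ : AddChar (Additive (ClassGroup (𝓞 K))) ℂ) :
    Ideal (𝓞 K) →*₀ ℂ where
  toFun I := if h : I = ⊥ then 0 else
    κ (Additive.ofMul (ClassGroup.mk0 ⟨I, mem_nonZeroDivisors_of_ne_zero h⟩))
  map_zero' := by simp
  map_one' := by
    rw [dif_neg (by simp)]
    have : (⟨1, mem_nonZeroDivisors_of_ne_zero (by simp)⟩ : (Ideal (𝓞 K))⁰) = 1 := rfl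
    rw [this, map_one, ofMul_one, AddChar.map_zero_eq_one]
  map_mul' I J := by
    by_cases hI : I = ⊥
    · simp [hI]
    by_cases hJ : J = ⊥
    · simp [hJ]
    have hIJ : I * J ≠ ⊥ := mul_ne_zero hI hJ
    rw [dif_neg hI, dif_neg hJ, dif_neg hIJ, ← AddChar.map_add_eq_mul, ← ofMul_mul, ← map_mul]
    rfl

theorem classChar_apply (κ : AddChar (Additive (ClassGroup (𝓞 K))) ℂ) {I : Ideal (𝓞 K)}
    (h : I ≠ ⊥) : classChar κ I =
      κ (Additive.ofMul (ClassGroup.mk0 ⟨I, mem_nonZeroDivisors_of_ne_zero h⟩)) :=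
  dif_neg h

/-- Twisting a Hecke character by a character of the class group. -/
noncomputable def twist (κ : AddChar (Additive (ClassGroup (𝓞 K))) ℂ) : HeckeChar K where
  toFun := H.toFun
  onIdeal := H.onIdeal * classChar κ
  map_mul' := H.map_mul'
  norm_toFun' := H.norm_toFun'
  contDiffAt' := H.contDiffAt'
  map_smul' := H.map_smul'
  norm_onIdeal' I hI := by
    change ‖H.onIdeal I * classChar κ I‖ = 1
    rw [_root_.norm_mul, H.norm_onIdeal' I hI, classChar_apply κ hI,
      AddChar.norm_apply, one_mul]
  onIdeal_span' a ha := by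
    have h : Ideal.span {a} ≠ ⊥ := by simpa using ha
    have h2 : ClassGroup.mk0 ⟨Ideal.span {a}, mem_nonZeroDivisors_of_ne_zero h⟩ = 1 :=
      (ClassGroup.mk0_eq_one_iff _).2 ⟨a, rfl⟩
    change H.onIdeal (Ideal.span {a}) * classChar κ (Ideal.span {a}) = _
    rw [classChar_apply κ h, h2, ofMul_one,
      AddChar.map_zero_eq_one, mul_one, H.onIdeal_span' a ha]

theorem onIdeal_twist (κ : AddChar (Additive (ClassGroup (𝓞 K))) ℂ) (I : Ideal (𝓞 K)) :
    (H.twist κ).onIdeal I = H.onIdeal I * classChar κ I := rfl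

theorem sum_classChar {I : Ideal (𝓞 K)} (h : I ≠ ⊥) :
    ∑ κ, classChar κ I = if Submodule.IsPrincipal I then (classNumber K : ℂ) else 0 := by
  simp only [classChar_apply _ h]
  rw [AddChar.sum_apply_eq_ite]
  have h2 := ClassGroup.mk0_eq_one_iff (mem_nonZeroDivisors_of_ne_zero h)
  have h3 : Fintype.card (Additive (ClassGroup (𝓞 K))) = classNumber K :=
    Fintype.card_congr Additive.toMul
  rw [h3]
  refine if_congr ?_ rfl rfl
  rw [ofMul_eq_zero, h2]

theorem not_isTrivial_of_toFun {v : mixedSpace K} (hv : mixedEmbedding.norm v ≠ 0)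
    (h : H.toFun v ≠ 1) : ¬ H.IsTrivial := by
  intro hH
  obtain ⟨η, hη, hpos, hone⟩ := exists_isCutoff_eq_one
  obtain ⟨M, -, hM⟩ := hη.exists_abs_le
  have hc := hη.contDiff_ofReal.continuous
  obtain ⟨R, hR⟩ := hη.2.2
  obtain ⟨ε, hε, h2⟩ := hη.2.1
  exact H.leadingCoeff_ne_zero hH hη.contDiff_ofReal hpos hone hε h2 hR
    (H.leadingCoeff_eq_zero_of_toFun hv h hc.measurable (M := M) (fun x => by simpa using hM x)
      (R := R) fun x hx => by simp [hR x hx])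

theorem isTrivial_twist_triv_iff (κ : AddChar (Additive (ClassGroup (𝓞 K))) ℂ) :
    ((triv (K := K)).twist κ).IsTrivial ↔ κ = 1 := by
  constructor
  · intro h
    ext c
    obtain ⟨⟨I, hI⟩, hc⟩ := ClassGroup.mk0_surjective c.toMul
    have hI' : I ≠ ⊥ := nonZeroDivisors.ne_zero hI
    have := h I hI'
    rw [onIdeal_twist, onIdeal_triv hI', one_mul, classChar_apply κ hI', hc] at this
    simpa using this
  · rintro rfl I hI
    rw [onIdeal_twist, onIdeal_triv hI, classChar_apply _ hI]
    simp

/-- The prime ideal theorem for Hecke characters restricted to principal prime powers. -/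
theorem tendsto_sum_principal : Tendsto (fun X : ℝ => (∑' i : PrimePowers K,
    if (Ideal.absNorm i.ideal : ℝ) ≤ X then
      (if Submodule.IsPrincipal i.ideal then H.mangoldt i else 0) else 0) / X) atTop
      (𝓝 ((∑ κ, ((H.twist κ).residue : ℂ)) / classNumber K)) := by
  have h0 : (classNumber K : ℂ) ≠ 0 := by exact_mod_cast classNumber_ne_zero K
  have h := (tendsto_finsetSum Finset.univ fun κ _ =>
    (H.twist κ).tendsto_sum_mangoldt).div_const (classNumber K : ℂ)
  refine h.congr fun X => ?_
  rw [← Finset.sum_div, div_right_comm]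
  congr 1
  have hs : ∀ H : HeckeChar K,
      Summable fun i => if (Ideal.absNorm i.ideal : ℝ) ≤ X then H.mangoldt i else 0 := fun H =>
    summable_of_finite_support ((finite_absNorm_le (K := K) X).subset fun i hi => by
      by_contra h
      exact hi (if_neg h))
  rw [← Summable.tsum_finsetSum fun κ _ => hs _, div_eq_iff h0, ← tsum_mul_right]
  refine tsum_congr fun i => ?_
  split_ifs with h1 h2
  · have h3 := sum_classChar i.ideal_ne_bot
    rw [if_pos h2] at h3
    rw [← h3, Finset.mul_sum]
    refine Finset.sum_congr rfl fun κ _ => ?_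
    rw [mangoldt, mangoldt, onIdeal_twist, mul_assoc]
  · have h3 := sum_classChar i.ideal_ne_bot
    rw [if_neg h2] at h3
    rw [zero_mul, ← mul_zero ((i.weight : ℂ) * H.onIdeal i.ideal), ← h3, Finset.mul_sum]
    refine Finset.sum_congr rfl fun κ _ => ?_
    rw [mangoldt, onIdeal_twist, mul_assoc]
  · simp

theorem tendsto_sum_principal_of_toFun {v : mixedSpace K} (hv : mixedEmbedding.norm v ≠ 0)
    (h : H.toFun v ≠ 1) : Tendsto (fun X : ℝ => (∑' i : PrimePowers K,
    if (Ideal.absNorm i.ideal : ℝ) ≤ X then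
      (if Submodule.IsPrincipal i.ideal then H.mangoldt i else 0) else 0) / X) atTop
      (𝓝 0) := by
  convert H.tendsto_sum_principal using 2
  rw [Finset.sum_eq_zero, zero_div]
  intro κ _
  rw [residue, if_neg ((H.twist κ).not_isTrivial_of_toFun hv h), Complex.ofReal_zero]

theorem tendsto_sum_principal_triv : Tendsto (fun X : ℝ => (∑' i : PrimePowers K,
    if (Ideal.absNorm i.ideal : ℝ) ≤ X then
      (if Submodule.IsPrincipal i.ideal then (triv (K := K)).mangoldt i else 0) else 0) / X) atTop
      (𝓝 (1 / classNumber K)) := by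
  convert (triv (K := K)).tendsto_sum_principal using 3
  rw [Finset.sum_eq_single 1]
  · rw [residue, if_pos ((isTrivial_twist_triv_iff 1).2 rfl), Complex.ofReal_one]
  · intro κ _ hκ
    rw [residue, if_neg (mt (isTrivial_twist_triv_iff κ).1 hκ), Complex.ofReal_zero]
  · simp

end HeckeChar

end

section

open Topology

variable {K}

namespace PrimePowers

theorem rpow_absNorm (i : PrimePowers K) (s : ℝ) :
    (Ideal.absNorm i.ideal : ℝ) ^ s = (Ideal.absNorm i.1.1 : ℝ) ^ (s * (i.2 + 1)) := by
  rw [ideal, map_pow, Nat.cast_pow, ← Real.rpow_natCast, ← Real.rpow_mul (Nat.cast_nonneg _)]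
  push_cast
  rw [mul_comm]

/-- The proper prime powers contribute a convergent series already at the exponent `3 / 4`. -/
theorem summable_weight_higher : Summable fun i : PrimePowers K =>
    if i.2 = 0 then 0 else i.weight * (Ideal.absNorm i.ideal : ℝ) ^ (-(3 / 4) : ℝ) := by
  have hinj : Function.Injective (fun p => ((p, 0) : PrimePowers K)) := fun p q h => by
    simpa using h
  have h1 := (summable_weight (K := K) (σ := 3 / 2) (by norm_num)).comp_injective hinj
  have hr : (2 : ℝ) ^ (-(3 / 4) : ℝ) < 1 := Real.rpow_lt_one_of_one_lt_of_neg (by norm_num)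
    (by norm_num)
  have h2 := (summable_geometric_of_lt_one (by positivity) hr).mul_left ((2 : ℝ) ^ (3 / 4 : ℝ))
  refine (h1.mul_of_nonneg h2 (fun p => mul_nonneg (weight_pos _).le (by positivity))
    (fun l => by positivity)).of_nonneg_of_le (fun i => ?_) fun i => ?_
  · split_ifs
    · exact le_rfl
    · exact mul_nonneg (weight_pos _).le (by positivity)
  · obtain ⟨p, l⟩ := i
    have h3 : (2 : ℝ) ≤ Ideal.absNorm p.1 := by exact_mod_cast one_lt_absNorm p
    have h4 : weight (p, l) = weight (p, 0) := rfl
    have hw := weight_pos (p, 0)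
    simp only [Function.comp]
    split_ifs with hl
    · positivity
    rw [h4, mul_assoc, rpow_absNorm, rpow_absNorm]
    refine mul_le_mul_of_nonneg_left ?_ hw.le
    have h5 : (1 : ℝ) ≤ l := by exact_mod_cast Nat.one_le_iff_ne_zero.2 hl
    have h6 : (2 : ℝ) ^ (3 / 4 : ℝ) * ((2 : ℝ) ^ (-(3 / 4) : ℝ)) ^ l =
        (2 : ℝ) ^ (-(3 / 4 * ((l : ℝ) - 1)) : ℝ) := by
      rw [← Real.rpow_natCast, ← Real.rpow_mul (by norm_num), ← Real.rpow_add (by norm_num)]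
      congr 1; ring
    have h7 : (Ideal.absNorm p.1 : ℝ) ^ (-(3 / 4) * ((l : ℝ) + 1)) =
        (Ideal.absNorm p.1 : ℝ) ^ (-(3 / 2) * (((0 : ℕ) : ℝ) + 1)) *
          (Ideal.absNorm p.1 : ℝ) ^ (-(3 / 4 * ((l : ℝ) - 1)) : ℝ) := by
      rw [← Real.rpow_add (by linarith)]
      congr 1; push_cast; ring
    rw [h6]
    change (Ideal.absNorm p.1 : ℝ) ^ (-(3 / 4) * ((l : ℝ) + 1)) ≤ _
    rw [h7]
    refine mul_le_mul_of_nonneg_left ?_ (by positivity)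
    exact Real.rpow_le_rpow_of_nonpos (by norm_num) h3 (by linarith)

/-- Bounded weights on proper prime powers contribute a negligible amount. -/
theorem tendsto_sum_higher {f : PrimePowers K → ℂ} {M : ℝ} (hf : ∀ i, ‖f i‖ ≤ M * i.weight)
    (h0 : ∀ i, i.2 = 0 → f i = 0) :
    Tendsto (fun X : ℝ => (∑' i : PrimePowers K,
      if (Ideal.absNorm i.ideal : ℝ) ≤ X then f i else 0) / X) atTop (𝓝 0) := by
  set C := ∑' i : PrimePowers K,
    if i.2 = 0 then 0 else i.weight * (Ideal.absNorm i.ideal : ℝ) ^ (-(3 / 4) : ℝ) with hC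
  have hsum := summable_weight_higher (K := K)
  have hlim : Tendsto (fun X : ℝ => |M| * C * X ^ (-(1 / 4) : ℝ)) atTop (𝓝 0) := by
    simpa using (tendsto_rpow_neg_atTop (y := 1 / 4) (by norm_num)).const_mul (|M| * C)
  refine squeeze_zero_norm' ?_ hlim
  filter_upwards [eventually_gt_atTop 0] with X hX
  have hterm : ∀ i : PrimePowers K, ‖if (Ideal.absNorm i.ideal : ℝ) ≤ X then f i else 0‖ ≤
      |M| * X ^ (3 / 4 : ℝ) * (if i.2 = 0 then 0 else
        i.weight * (Ideal.absNorm i.ideal : ℝ) ^ (-(3 / 4) : ℝ)) := by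
    intro i
    have hw := i.weight_pos
    have hN := i.one_le_absNorm
    by_cases hi : i.2 = 0
    · simp [h0 i hi, hi]
    rw [if_neg hi]
    split_ifs with h
    · have h1 : (Ideal.absNorm i.ideal : ℝ) ^ (3 / 4 : ℝ) ≤ X ^ (3 / 4 : ℝ) :=
        Real.rpow_le_rpow (by linarith) h (by norm_num)
      have h2 : (Ideal.absNorm i.ideal : ℝ) ^ (3 / 4 : ℝ) *
          (Ideal.absNorm i.ideal : ℝ) ^ (-(3 / 4) : ℝ) = 1 := by
        rw [← Real.rpow_add (by linarith)]; norm_num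
      calc ‖f i‖ ≤ |M| * i.weight :=
            (hf i).trans (mul_le_mul_of_nonneg_right (le_abs_self M) hw.le)
        _ = |M| * i.weight * ((Ideal.absNorm i.ideal : ℝ) ^ (3 / 4 : ℝ) *
            (Ideal.absNorm i.ideal : ℝ) ^ (-(3 / 4) : ℝ)) := by rw [h2, mul_one]
        _ ≤ |M| * i.weight * (X ^ (3 / 4 : ℝ) *
            (Ideal.absNorm i.ideal : ℝ) ^ (-(3 / 4) : ℝ)) := by gcongr
        _ = _ := by ring
    · rw [norm_zero]; positivity
  have h3 := tsum_of_norm_bounded (hsum.mul_left (|M| * X ^ (3 / 4 : ℝ))).hasSum hterm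
  rw [tsum_mul_left] at h3
  rw [norm_div, Complex.norm_real, Real.norm_eq_abs, abs_of_pos hX, div_le_iff₀ hX]
  refine h3.trans (le_of_eq ?_)
  have h4 : X ^ (3 / 4 : ℝ) = X ^ (-(1 / 4) : ℝ) * X := by
    rw [← Real.rpow_add_one hX.ne']; norm_num
  rw [h4]; ring

end PrimePowers

theorem summable_ite_absNorm_le (f : PrimePowers K → ℂ) (X : ℝ) :
    Summable fun i : PrimePowers K => if (Ideal.absNorm i.ideal : ℝ) ≤ X then f i else 0 :=
  summable_of_finite_support ((HeckeChar.finite_absNorm_le (K := K) X).subset fun i hi => by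
    by_contra h
    exact hi (if_neg h))

theorem norm_generator_ne_zero {I : Ideal (𝓞 K)} (hI : I ≠ ⊥) (h : Submodule.IsPrincipal I) :
    mixedEmbedding.norm (mixedEmbedding K ((h.generator : 𝓞 K) : K)) ≠ 0 := by
  rw [Ne, norm_eq_zero_iff' ⟨_, rfl⟩, map_eq_zero]
  have := (Submodule.IsPrincipal.eq_bot_iff_generator_eq_zero I).not.1 hI
  simpa using this

theorem HeckeChar.phiIdeal_toFun (H : HeckeChar K) {I : Ideal (𝓞 K)} (hI : I ≠ ⊥) :
    phiIdeal K H.toFun I = if Submodule.IsPrincipal I then H.onIdeal I else 0 := by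
  unfold phiIdeal
  split_ifs with h
  · have h1 : h.generator ≠ 0 := (Submodule.IsPrincipal.eq_bot_iff_generator_eq_zero I).not.1 hI
    have h2 := H.onIdeal_span' _ h1
    rw [← h2, Ideal.span_singleton_generator]
  · rfl

/-- The sum over principal prime ideals attached to a weight function. -/
noncomputable def primeSum (φ : mixedSpace K → ℂ) (X : ℝ) : ℂ :=
  ∑' i : PrimePowers K,
    if (Ideal.absNorm i.ideal : ℝ) ≤ X then phiIdeal K φ i.1.1 * (i.weight : ℂ) else 0

theorem HeckeChar.tendsto_primeSum (H : HeckeChar K) {c : ℂ}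
    (h : Tendsto (fun X : ℝ => (∑' i : PrimePowers K,
    if (Ideal.absNorm i.ideal : ℝ) ≤ X then
      (if Submodule.IsPrincipal i.ideal then H.mangoldt i else 0) else 0) / X) atTop (𝓝 c)) :
    Tendsto (fun X : ℝ => primeSum H.toFun X / X) atTop (𝓝 c) := by
  have h1 := PrimePowers.tendsto_sum_higher (K := K) (M := 2)
    (f := fun i => phiIdeal K H.toFun i.1.1 * (i.weight : ℂ) -
      (if Submodule.IsPrincipal i.ideal then H.mangoldt i else 0)) (fun i => ?_) fun i hi => ?_
  · have h2 := h.add h1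
    rw [add_zero] at h2
    refine h2.congr fun X => ?_
    rw [← add_div, primeSum, ← (summable_ite_absNorm_le _ X).tsum_add (summable_ite_absNorm_le _ X)]
    congr 1
    refine tsum_congr fun i => ?_
    split_ifs <;> ring
  · have hw := i.weight_pos
    have h3 : ‖phiIdeal K H.toFun i.1.1 * (i.weight : ℂ)‖ ≤ i.weight := by
      rw [H.phiIdeal_toFun i.1.2.ne_zero, _root_.norm_mul, Complex.norm_real, Real.norm_eq_abs,
        abs_of_pos hw]
      refine mul_le_of_le_one_left hw.le ?_
      split_ifs
      · exact H.norm_onIdeal_le_one _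
      · simp
    have h4 : ‖if Submodule.IsPrincipal i.ideal then H.mangoldt i else 0‖ ≤ i.weight := by
      split_ifs
      · exact (H.norm_mangoldt i).le
      · simpa using hw.le
    linarith [norm_sub_le (phiIdeal K H.toFun i.1.1 * (i.weight : ℂ))
      (if Submodule.IsPrincipal i.ideal then H.mangoldt i else 0)]
  · have h3 : i.ideal = i.1.1 := by rw [PrimePowers.ideal, hi, zero_add, pow_one]
    beta_reduce
    rw [H.phiIdeal_toFun i.1.2.ne_zero, HeckeChar.mangoldt, h3]
    split_ifs <;> ring

end

section

open Topology

/-- Radial projection onto the norm-one hypersurface. -/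
noncomputable def radialProj (v : mixedSpace K) : mixedSpace K :=
  (mixedEmbedding.norm v ^ (-(1 : ℝ) / (Module.finrank ℚ K))) • v

variable {K}

theorem measurable_radialProj : Measurable (radialProj K) :=
  (((mixedEmbedding.continuous_norm K).measurable).pow_const _).smul measurable_id

theorem norm_radialProj {v : mixedSpace K} (hv : mixedEmbedding.norm v ≠ 0) :
    mixedEmbedding.norm (radialProj K v) = 1 := by
  have hn : (Module.finrank ℚ K : ℝ) ≠ 0 := by exact_mod_cast Module.finrank_pos.ne'
  have hpos : 0 < mixedEmbedding.norm v := lt_of_le_of_ne (mixedEmbedding.norm_nonneg _) hv.symm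
  rw [radialProj, mixedEmbedding.norm_smul, abs_of_pos (by positivity), ← Real.rpow_natCast,
    ← Real.rpow_mul hpos.le, div_mul_cancel₀ _ hn, Real.rpow_neg_one, inv_mul_cancel₀ hv]

theorem radialProj_unit_mul (u : (𝓞 K)ˣ) (v : mixedSpace K) :
    radialProj K (mixedEmbedding K ((u : 𝓞 K) : K) * v) =
      mixedEmbedding K ((u : 𝓞 K) : K) * radialProj K v := by
  rw [radialProj, radialProj, norm_unit_mul, mul_smul_comm]

theorem radialProj_invariant {f : mixedSpace K → ℂ} (hf : IsUnitaryChar K f) {v : mixedSpace K}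
    (hv : mixedEmbedding.norm v ≠ 0) : f (radialProj K v) = f v := by
  have hpos : 0 < mixedEmbedding.norm v := lt_of_le_of_ne (mixedEmbedding.norm_nonneg _) hv.symm
  exact hf.map_smul _ _ (by positivity) hv

variable (K) in
/-- The region `0 < ‖v‖ ≤ 1`. -/
def normBall : Set (mixedSpace K) :=
  {v : mixedSpace K | 0 < mixedEmbedding.norm v ∧ mixedEmbedding.norm v ≤ 1}

theorem measurableSet_normBall : MeasurableSet (normBall K) :=
  (measurableSet_lt measurable_const (mixedEmbedding.continuous_norm K).measurable).inter
    (measurableSet_le (mixedEmbedding.continuous_norm K).measurable measurable_const)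

theorem coneMeasure_eq : coneMeasure K = Measure.map (radialProj K)
    (((Module.finrank ℚ K : ℝ≥0∞)) • (volume.restrict (normBall K))) := rfl

theorem ae_of_ae_coneMeasure {p : mixedSpace K → Prop} (h : ∀ᵐ y ∂(coneMeasure K), p y) :
    ∀ᵐ v : mixedSpace K, v ∈ normBall K → p (radialProj K v) := by
  rw [coneMeasure_eq] at h
  have h1 := ae_of_ae_map measurable_radialProj.aemeasurable h
  rw [Measure.ae_ennreal_smul_measure_iff (by exact_mod_cast Module.finrank_pos.ne')] at h1
  exact (ae_restrict_iff' measurableSet_normBall).1 h1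

/-- A fundamental domain for the action of the units on the norm-one hypersurface, up to null
sets. -/
structure IsUnitDomain (F : Set (mixedSpace K)) : Prop where
  measurableSet : MeasurableSet F
  subset : F ⊆ {v : mixedSpace K | mixedEmbedding.norm v = 1}
  cover : coneMeasure K ({v : mixedSpace K | mixedEmbedding.norm v = 1} \
      ⋃ u : (𝓞 K)ˣ, (fun v => mixedEmbedding K (((u : 𝓞 K) : K)) * v) '' F) = 0
  disj : ∀ u u' : (𝓞 K)ˣ, u ≠ u' →
      coneMeasure K (((fun v => mixedEmbedding K (((u : 𝓞 K) : K)) * v) '' F) ∩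
        ((fun v => mixedEmbedding K (((u' : 𝓞 K) : K)) * v) '' F)) = 0
  ne_top : coneMeasure K F ≠ ⊤

theorem unit_mul_inv_unit_mul (u : (𝓞 K)ˣ) (v : mixedSpace K) :
    mixedEmbedding K ((u : 𝓞 K) : K) * (mixedEmbedding K (((u⁻¹ : (𝓞 K)ˣ) : 𝓞 K) : K) * v) = v := by
  rw [← mul_assoc, ← map_mul, ← map_mul, Units.mul_inv, map_one, map_one, one_mul]

theorem mem_unit_image {F : Set (mixedSpace K)} {u : (𝓞 K)ˣ} {v : mixedSpace K} :
    v ∈ (fun v => mixedEmbedding K ((u : 𝓞 K) : K) * v) '' F ↔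
      mixedEmbedding K (((u⁻¹ : (𝓞 K)ˣ) : 𝓞 K) : K) * v ∈ F := by
  constructor
  · rintro ⟨w, hw, rfl⟩
    have := unit_mul_inv_unit_mul u⁻¹ w
    rw [inv_inv] at this
    rwa [this]
  · exact fun h => ⟨_, h, unit_mul_inv_unit_mul u v⟩

namespace IsUnitDomain

variable {F : Set (mixedSpace K)}

/-- The weight given by the fundamental domain on the region `0 < ‖v‖ ≤ 1`, and by the smooth weight
elsewhere. -/
noncomputable def weight (F : Set (mixedSpace K)) (v : mixedSpace K) : ℝ :=
  if v ∈ normBall K then (if radialProj K v ∈ F then 1 else 0) else unitWeight v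

theorem unit_mul_mem_normBall (u : (𝓞 K)ˣ) (v : mixedSpace K) :
    mixedEmbedding K ((u : 𝓞 K) : K) * v ∈ normBall K ↔ v ∈ normBall K := by
  simp only [normBall, Set.mem_setOf_eq, norm_unit_mul]

theorem hasSum_weight (hF : IsUnitDomain F) :
    ∀ᵐ v, HasSum (fun u : (𝓞 K)ˣ => weight F (mixedEmbedding K ((u : 𝓞 K) : K) * v)) 1 := by
  have := countable_units (K := K)
  have h1 : ∀ᵐ y ∂(coneMeasure K), mixedEmbedding.norm y = 1 →
      y ∈ ⋃ u : (𝓞 K)ˣ, (fun v => mixedEmbedding K (((u : 𝓞 K) : K)) * v) '' F := by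
    rw [ae_iff, ← hF.cover]
    congr 1
    ext y
    simp only [Set.mem_setOf_eq, Set.mem_diff, Classical.not_imp]
  have h2 : ∀ᵐ y ∂(coneMeasure K), ∀ u u' : (𝓞 K)ˣ, u ≠ u' →
      ¬ (y ∈ ((fun v => mixedEmbedding K (((u : 𝓞 K) : K)) * v) '' F) ∧
        y ∈ ((fun v => mixedEmbedding K (((u' : 𝓞 K) : K)) * v) '' F)) := by
    rw [ae_all_iff]
    intro u
    rw [ae_all_iff]
    intro u'
    by_cases hu : u = u'
    · simp [hu]
    · simp only [Ne, hu, not_false_eq_true, forall_true_left]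
      rw [ae_iff, ← hF.disj u u' hu]
      congr 1
      ext y
      simp only [Set.mem_setOf_eq, Set.mem_inter_iff, not_not]
  filter_upwards [ae_of_ae_coneMeasure h1, ae_of_ae_coneMeasure h2, ae_norm_ne_zero]
    with v hv1 hv2 hv
  by_cases hb : v ∈ normBall K
  · obtain ⟨u₀, hu₀⟩ := Set.mem_iUnion.1 (hv1 hb (norm_radialProj hv))
    have h3 : ∀ u : (𝓞 K)ˣ, weight F (mixedEmbedding K ((u : 𝓞 K) : K) * v) =
        if u = u₀⁻¹ then 1 else 0 := by
      intro u
      rw [weight, if_pos ((unit_mul_mem_normBall u v).2 hb), radialProj_unit_mul]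
      refine if_congr ⟨fun h => ?_, ?_⟩ rfl rfl
      · by_contra hne
        refine hv2 hb u⁻¹ u₀ (fun h => hne (by rw [← h, inv_inv])) ⟨?_, hu₀⟩
        rw [mem_unit_image, inv_inv]; exact h
      · rintro rfl
        exact mem_unit_image.1 hu₀
    simp only [h3]
    exact hasSum_ite_eq _ _
  · simp only [weight, unit_mul_mem_normBall, hb, if_false]
    exact hasSum_unitWeight hv

theorem weight_nonneg (v : mixedSpace K) : 0 ≤ weight F v := by
  unfold weight
  split_ifs
  · exact zero_le_one
  · exact le_rfl
  · exact unitWeight_nonneg v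

theorem aestronglyMeasurable_weight (hF : IsUnitDomain F) : AEStronglyMeasurable (weight F) volume := by
  have h1 : MeasurableSet (radialProj K ⁻¹' F) := measurable_radialProj hF.measurableSet
  have h2 : Measurable fun v : mixedSpace K => if radialProj K v ∈ F then (1 : ℝ) else 0 :=
    Measurable.ite h1 measurable_const measurable_const
  obtain ⟨g, hg, hge⟩ := aestronglyMeasurable_unitWeight (K := K)
  refine ⟨fun v => if v ∈ normBall K then (if radialProj K v ∈ F then 1 else 0) else g v,
    (Measurable.ite measurableSet_normBall h2 hg.measurable).stronglyMeasurable, ?_⟩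
  filter_upwards [hge] with v hv
  rw [weight, hv]

theorem continuousOn_aestronglyMeasurable (hF : IsUnitDomain F) {f : mixedSpace K → ℂ} {ν : Measure (mixedSpace K)}
    (hf : ContinuousOn f {v : mixedSpace K | mixedEmbedding.norm v ≠ 0}) :
    AEStronglyMeasurable f (ν.restrict F) :=
  (hf.mono fun v hv => by
    have := hF.subset hv
    simp only [Set.mem_setOf_eq] at this ⊢
    rw [this]; exact one_ne_zero).aestronglyMeasurable hF.measurableSet

theorem integral_eq (hF : IsUnitDomain F) {f : mixedSpace K → ℂ} (hf : IsUnitaryChar K f) :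
    ∫ v in F, f v ∂(coneMeasure K) = (Module.finrank ℚ K : ℂ) *
      ∫ v, (if mixedEmbedding.norm v ≤ 1 then f v else 0) * (weight F v : ℂ) := by
  have hc : ContinuousOn f {v : mixedSpace K | mixedEmbedding.norm v ≠ 0} :=
    fun v hv => (hf.contDiffAt v hv).continuousAt.continuousWithinAt
  have h1 := hF.continuousOn_aestronglyMeasurable hc (ν := coneMeasure K)
  rw [coneMeasure_eq] at h1
  rw [← integral_indicator hF.measurableSet, coneMeasure_eq, integral_map
    measurable_radialProj.aemeasurable
    ((aestronglyMeasurable_indicator_iff hF.measurableSet).2 h1), integral_smul_measure,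
    ← integral_indicator measurableSet_normBall]
  simp only [ENNReal.toReal_natCast, Complex.real_smul, Complex.ofReal_natCast]
  congr 1
  refine integral_congr_ae ?_
  filter_upwards [ae_norm_ne_zero] with v hv
  have hpos : 0 < mixedEmbedding.norm v := lt_of_le_of_ne (mixedEmbedding.norm_nonneg _) hv.symm
  by_cases hb : mixedEmbedding.norm v ≤ 1
  · have hb' : v ∈ normBall K := ⟨hpos, hb⟩
    rw [Set.indicator_of_mem hb', if_pos hb, weight, if_pos hb', Set.indicator_apply,
      radialProj_invariant hf hv]
    split_ifs <;> simp
  · rw [Set.indicator_of_notMem (fun h => hb h.2), if_neg hb, zero_mul]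

theorem integrable_mul_weight (hF : IsUnitDomain F) {f : mixedSpace K → ℂ} (hf : IsUnitaryChar K f) :
    Integrable fun v => (if mixedEmbedding.norm v ≤ 1 then f v else 0) * (weight F v : ℂ) := by
  have hfm : AEStronglyMeasurable f volume :=
    aestronglyMeasurable_of_continuousAt fun v hv => (hf.contDiffAt v hv).continuousAt
  have hS : MeasurableSet {v : mixedSpace K | mixedEmbedding.norm v ≤ 1} :=
    measurableSet_le (mixedEmbedding.continuous_norm K).measurable measurable_const
  have hT : MeasurableSet (normBall K ∩ radialProj K ⁻¹' F) :=
    measurableSet_normBall.inter (measurable_radialProj hF.measurableSet)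
  have hfin : volume (normBall K ∩ radialProj K ⁻¹' F) ≠ ⊤ := by
    have h := hF.ne_top
    rw [coneMeasure_eq, Measure.map_apply measurable_radialProj hF.measurableSet,
      Measure.smul_apply, smul_eq_mul, Measure.restrict_apply (measurable_radialProj
      hF.measurableSet), Set.inter_comm] at h
    refine (ENNReal.lt_top_of_mul_ne_top_right h ?_).ne
    exact_mod_cast Module.finrank_pos.ne'
  have hInt : Integrable (Set.indicator (normBall K ∩ radialProj K ⁻¹' F) fun _ => (1 : ℝ)) :=
    (integrable_indicator_iff hT).2 (integrableOn_const hfin)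
  refine hInt.mono' ?_ ?_
  · refine AEStronglyMeasurable.mul ?_
      (Complex.continuous_ofReal.comp_aestronglyMeasurable hF.aestronglyMeasurable_weight)
    exact (hfm.indicator hS).congr (ae_of_all _ fun v => by
      simp only [Set.indicator_apply, Set.mem_setOf_eq])
  · filter_upwards [ae_norm_ne_zero] with v hv
    have hpos : 0 < mixedEmbedding.norm v := lt_of_le_of_ne (mixedEmbedding.norm_nonneg _) hv.symm
    by_cases hb : mixedEmbedding.norm v ≤ 1
    · have hb' : v ∈ normBall K := ⟨hpos, hb⟩
      rw [if_pos hb, _root_.norm_mul, hf.norm_eq v hv, one_mul, weight, if_pos hb',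
        Set.indicator_apply]
      by_cases h : radialProj K v ∈ F
      · rw [if_pos h, if_pos ⟨hb', h⟩]; simp
      · rw [if_neg h, if_neg fun h' => h h'.2]; simp
    · rw [if_neg hb, zero_mul, norm_zero]
      exact Set.indicator_nonneg (fun _ _ => zero_le_one) _

theorem integral_eq_zero (hF : IsUnitDomain F) {f : mixedSpace K → ℂ} (hf : IsArchChar K f) {v₀ : mixedSpace K}
    (hv₀ : mixedEmbedding.norm v₀ ≠ 0) (h : f v₀ ≠ 1) :
    ∫ v in F, f v ∂(coneMeasure K) = 0 := by
  obtain ⟨H, rfl⟩ := hf.exists_heckeChar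
  have hS : MeasurableSet {v : mixedSpace K | mixedEmbedding.norm v ≤ 1} :=
    measurableSet_le (mixedEmbedding.continuous_norm K).measurable measurable_const
  have hfm : AEStronglyMeasurable H.toFun volume :=
    aestronglyMeasurable_of_continuousAt fun v hv => (hf.contDiffAt v hv).continuousAt
  have hInt : Integrable fun v =>
      (if mixedEmbedding.norm v ≤ 1 then H.toFun v else 0) * (unitWeight v : ℂ) := by
    refine integrable_mul_unitWeight (M := 1) (R := 2) ?_ (fun v hv => ?_) fun v hv => ?_
    · exact (hfm.indicator hS).congr (ae_of_all _ fun v => by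
        simp only [Set.indicator_apply, Set.mem_setOf_eq])
    · split_ifs
      · exact (hf.norm_eq v hv).le
      · simp
    · exact if_neg (by linarith)
  rw [hF.integral_eq hf.toIsUnitaryChar, integral_mul_weight_eq weight_nonneg unitWeight_nonneg
    hF.aestronglyMeasurable_weight aestronglyMeasurable_unitWeight hF.hasSum_weight ?_ ?_
    (hF.integrable_mul_weight hf.toIsUnitaryChar) hInt]
  · have h1 := H.integral_cutoffFun_eq_zero hv₀ h (η := fun x => if x ≤ 1 then 1 else 0)
      (Measurable.ite measurableSet_Iic measurable_const measurable_const) (M := 1)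
      (fun x => by split_ifs <;> simp) (R := 2) fun x hx => if_neg (by linarith)
    refine mul_eq_zero_of_right _ (Eq.trans (integral_congr_ae (ae_of_all _ fun v => ?_)) h1)
    simp only [cutoffFun]
    split_ifs <;> simp
  · filter_upwards [ae_norm_ne_zero] with v hv
    exact hasSum_unitWeight hv
  · intro u v hv
    rw [norm_unit_mul, hf.map_unit_mul u hv]

end IsUnitDomain

end

section

open Topology

variable {K}

theorem phiIdeal_add (f g : mixedSpace K → ℂ) (I : Ideal (𝓞 K)) :
    phiIdeal K (f + g) I = phiIdeal K f I + phiIdeal K g I := by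
  unfold phiIdeal; split_ifs <;> simp

theorem phiIdeal_smul (c : ℂ) (f : mixedSpace K → ℂ) (I : Ideal (𝓞 K)) :
    phiIdeal K (c • f) I = c * phiIdeal K f I := by
  unfold phiIdeal; split_ifs <;> simp

theorem phiIdeal_congr {f g : mixedSpace K → ℂ}
    (h : ∀ v, mixedEmbedding.norm v ≠ 0 → f v = g v) {I : Ideal (𝓞 K)} (hI : I ≠ ⊥) :
    phiIdeal K f I = phiIdeal K g I := by
  unfold phiIdeal
  split_ifs with hp
  · exact h _ (norm_generator_ne_zero hI hp)
  · rfl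

theorem norm_phiIdeal_le {f : mixedSpace K → ℂ} {M : ℝ} (hM : 0 ≤ M)
    (h : ∀ v, mixedEmbedding.norm v ≠ 0 → ‖f v‖ ≤ M) {I : Ideal (𝓞 K)} (hI : I ≠ ⊥) :
    ‖phiIdeal K f I‖ ≤ M := by
  unfold phiIdeal
  split_ifs with hp
  · exact h _ (norm_generator_ne_zero hI hp)
  · simpa using hM

theorem primeSum_add (f g : mixedSpace K → ℂ) (X : ℝ) :
    primeSum (f + g) X = primeSum f X + primeSum g X := by
  simp only [primeSum]
  rw [← (summable_ite_absNorm_le _ X).tsum_add (summable_ite_absNorm_le _ X)]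
  refine tsum_congr fun i => ?_
  rw [phiIdeal_add]
  split_ifs <;> ring

theorem primeSum_smul (c : ℂ) (f : mixedSpace K → ℂ) (X : ℝ) :
    primeSum (c • f) X = c * primeSum f X := by
  simp only [primeSum]
  rw [← tsum_mul_left]
  refine tsum_congr fun i => ?_
  rw [phiIdeal_smul]
  split_ifs <;> ring

theorem primeSum_congr {f g : mixedSpace K → ℂ}
    (h : ∀ v, mixedEmbedding.norm v ≠ 0 → f v = g v) (X : ℝ) : primeSum f X = primeSum g X := by
  simp only [primeSum]
  refine tsum_congr fun i => ?_
  rw [phiIdeal_congr h i.1.2.ne_zero]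

theorem norm_primeSum_le {f : mixedSpace K → ℂ} {M : ℝ} (hM : 0 ≤ M)
    (h : ∀ v, mixedEmbedding.norm v ≠ 0 → ‖f v‖ ≤ M) (X : ℝ) :
    ‖primeSum f X‖ ≤ M * ∑' i : PrimePowers K,
      if (Ideal.absNorm i.ideal : ℝ) ≤ X then i.weight else 0 := by
  have hs : Summable fun i : PrimePowers K =>
      if (Ideal.absNorm i.ideal : ℝ) ≤ X then i.weight else 0 :=
    summable_of_finite_support ((HeckeChar.finite_absNorm_le (K := K) X).subset fun i hi => by
      by_contra h
      exact hi (if_neg h))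
  rw [← tsum_mul_left]
  refine tsum_of_norm_bounded (hs.mul_left M).hasSum fun i => ?_
  split_ifs
  · rw [_root_.norm_mul, Complex.norm_real, Real.norm_of_nonneg i.weight_pos.le]
    exact mul_le_mul_of_nonneg_right (norm_phiIdeal_le hM h i.1.2.ne_zero) i.weight_pos.le
  · simp

theorem primeSum_eq_finsum (φ : mixedSpace K → ℂ) (X : ℝ) :
    ∑ᶠ p ∈ {p : Ideal (𝓞 K) × ℕ | p.1.IsPrime ∧ p.1 ≠ ⊥ ∧
            Submodule.IsPrincipal p.1 ∧ 1 ≤ p.2 ∧ (Ideal.absNorm p.1 : ℝ) ^ p.2 ≤ X},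
          phiIdeal K φ p.1 * (Real.log (Ideal.absNorm p.1) : ℂ) = primeSum φ X := by
  symm
  have hN : ∀ i : PrimePowers K,
      (Ideal.absNorm i.ideal : ℝ) = (Ideal.absNorm i.1.1 : ℝ) ^ (i.2 + 1) := fun i => by
    rw [PrimePowers.ideal, map_pow, Nat.cast_pow]
  rw [primeSum, tsum_eq_finsum ((HeckeChar.finite_absNorm_le (K := K) X).subset fun i hi => by
    by_contra h
    exact hi (if_neg h))]
  have h1 : ∀ i : PrimePowers K,
      (if (Ideal.absNorm i.ideal : ℝ) ≤ X then phiIdeal K φ i.1.1 * (i.weight : ℂ) else 0) =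
      Set.indicator {i : PrimePowers K | (Ideal.absNorm i.ideal : ℝ) ≤ X ∧
        Submodule.IsPrincipal i.1.1} (fun i => phiIdeal K φ i.1.1 * (i.weight : ℂ)) i := by
    intro i
    rw [Set.indicator_apply]
    by_cases hp : Submodule.IsPrincipal i.1.1
    · simp [hp]
    · simp [hp, phiIdeal]
  rw [finsum_congr h1, ← finsum_mem_def]
  refine finsum_mem_eq_of_bijOn (fun i => (i.1.1, i.2 + 1)) ⟨?_, ?_, ?_⟩ fun i _ => rfl
  · rintro i ⟨hi, hp⟩
    refine ⟨(Ideal.prime_iff_isPrime i.1.2.ne_zero).1 i.1.2, i.1.2.ne_zero, hp, by simp, ?_⟩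
    rw [← hN]; exact hi
  · rintro ⟨⟨p, hp⟩, n⟩ _ ⟨⟨q, hq⟩, m⟩ _ h
    simpa using h
  · rintro ⟨p, n⟩ ⟨h1, h2, h3, h4, h5⟩
    simp only at h1 h2 h3 h4 h5
    obtain ⟨m, rfl⟩ : ∃ m, n = m + 1 := ⟨n - 1, by omega⟩
    refine ⟨(⟨p, (Ideal.prime_iff_isPrime h2).2 h1⟩, m), ⟨?_, h3⟩, rfl⟩
    rw [hN]; exact h5

theorem IsUnitDomain.integrableOn_of_bound {F : Set (mixedSpace K)} (hF : IsUnitDomain F)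
    {f : mixedSpace K → ℂ} (hf : AEStronglyMeasurable f ((coneMeasure K).restrict F)) {M : ℝ}
    (hM : ∀ᵐ v ∂((coneMeasure K).restrict F), ‖f v‖ ≤ M) : IntegrableOn f F (coneMeasure K) := by
  have : IsFiniteMeasure ((coneMeasure K).restrict F) :=
    ⟨by rw [Measure.restrict_apply_univ]; exact hF.ne_top.lt_top⟩
  exact Integrable.of_bound hf M hM

/-- Equidistribution holds for a function if it is integrable on the fundamental domain and its sums
over principal primes have the expected mean value. -/
def IsEquidistributed (F : Set (mixedSpace K)) (f : mixedSpace K → ℂ) : Prop :=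
  IntegrableOn f F (coneMeasure K) ∧ Tendsto (fun X : ℝ => primeSum f X / X) atTop
    (𝓝 ((((coneMeasure K).real F * classNumber K : ℝ) : ℂ)⁻¹ * ∫ v in F, f v ∂(coneMeasure K)))

theorem IsArchChar.isEquidistributed {F : Set (mixedSpace K)} (hF : IsUnitDomain F)
    (hF0 : coneMeasure K F ≠ 0) {f : mixedSpace K → ℂ} (hf : IsArchChar K f) :
    IsEquidistributed F f := by
  have hne : ∀ v ∈ F, mixedEmbedding.norm v ≠ 0 := fun v hv => by
    have := hF.subset hv
    simp only [Set.mem_setOf_eq] at this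
    rw [this]; exact one_ne_zero
  have hm := hF.continuousOn_aestronglyMeasurable (ν := coneMeasure K)
    (fun v hv => (hf.contDiffAt v hv).continuousAt.continuousWithinAt)
  constructor
  · exact hF.integrableOn_of_bound hm (M := 1)
      ((ae_restrict_iff' hF.measurableSet).2 (ae_of_all _ fun v hv => (hf.norm_eq v (hne v hv)).le))
  by_cases h : ∃ v, mixedEmbedding.norm v ≠ 0 ∧ f v ≠ 1
  · obtain ⟨v₀, hv₀, h⟩ := h
    rw [hF.integral_eq_zero hf hv₀ h, mul_zero]
    obtain ⟨H, rfl⟩ := hf.exists_heckeChar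
    exact H.tendsto_primeSum (H.tendsto_sum_principal_of_toFun hv₀ h)
  · push Not at h
    have hF1 : (coneMeasure K).real F ≠ 0 := (ENNReal.toReal_ne_zero.2 ⟨hF0, hF.ne_top⟩)
    have h1 : ∫ v in F, f v ∂(coneMeasure K) = (coneMeasure K).real F := by
      rw [setIntegral_congr_fun hF.measurableSet (g := fun _ => (1 : ℂ))
        (fun v hv => h v (hne v hv))]
      simp
    have h2 : (((coneMeasure K).real F * classNumber K : ℝ) : ℂ)⁻¹ *
        ∫ v in F, f v ∂(coneMeasure K) = 1 / classNumber K := by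
      have : (((coneMeasure K).real F : ℝ) : ℂ) ≠ 0 := by exact_mod_cast hF1
      rw [h1]
      push_cast
      field_simp
    rw [h2]
    refine ((HeckeChar.triv (K := K)).tendsto_primeSum
      HeckeChar.tendsto_sum_principal_triv).congr fun X => ?_
    congr 1
    exact primeSum_congr (fun v hv => (h v hv).symm) X

theorem isEquidistributed_of_mem_archSpan {F : Set (mixedSpace K)} (hF : IsUnitDomain F)
    (hF0 : coneMeasure K F ≠ 0) {f : mixedSpace K → ℂ} (hf : f ∈ archSpan K) :
    IsEquidistributed F f := by
  induction hf using Submodule.span_induction with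
  | mem f hf => exact hf.isEquidistributed hF hF0
  | zero =>
    refine ⟨integrableOn_zero, ?_⟩
    have : ∀ X, primeSum (0 : mixedSpace K → ℂ) X = 0 := fun X => by
      simpa using primeSum_smul (K := K) 0 0 X
    simp [this]
  | add f g _ _ hf hg =>
    refine ⟨hf.1.add hg.1, ?_⟩
    simp only [Pi.add_apply]
    rw [integral_add hf.1 hg.1, mul_add]
    refine (hf.2.add hg.2).congr fun X => ?_
    rw [primeSum_add, add_div]
  | smul c f _ hf =>
    refine ⟨hf.1.smul c, ?_⟩
    simp only [Pi.smul_apply, smul_eq_mul]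
    rw [integral_const_mul, mul_left_comm]
    refine (hf.2.const_mul c).congr fun X => ?_
    rw [primeSum_smul, mul_div_assoc]

theorem isEquidistributed_of_continuousOn {F : Set (mixedSpace K)} (hF : IsUnitDomain F)
    (hF0 : coneMeasure K F ≠ 0) {φ : mixedSpace K → ℂ}
    (hcont : ContinuousOn φ {v : mixedSpace K | mixedEmbedding.norm v ≠ 0})
    (hunit : ∀ (u : (𝓞 K)ˣ) (v : mixedSpace K),
      φ (mixedEmbedding K (((u : 𝓞 K) : K)) * v) = φ v)
    (hscal : ∀ c : ℝ, c ≠ 0 → ∀ v : mixedSpace K, φ (c • v) = φ v) :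
    IsEquidistributed F φ := by
  have hne : ∀ v ∈ F, mixedEmbedding.norm v ≠ 0 := fun v hv => by
    have := hF.subset hv
    simp only [Set.mem_setOf_eq] at this
    rw [this]; exact one_ne_zero
  have hm := hF.continuousOn_aestronglyMeasurable (ν := coneMeasure K) hcont
  have hF1 : 0 < (coneMeasure K).real F := ENNReal.toReal_pos hF0 hF.ne_top
  have hdiff : ∀ {f : mixedSpace K → ℂ} {δ : ℝ}, IntegrableOn f F (coneMeasure K) →
      (∀ v, mixedEmbedding.norm v ≠ 0 → ‖φ v - f v‖ ≤ δ) →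
      IntegrableOn (φ - f) F (coneMeasure K) := fun hf h =>
    hF.integrableOn_of_bound (hm.sub hf.1)
      ((ae_restrict_iff' hF.measurableSet).2 (ae_of_all _ fun v hv => h v (hne v hv)))
  have hInt : IntegrableOn φ F (coneMeasure K) := by
    obtain ⟨f, hf, hfφ⟩ := exists_mem_archSpan_approx hcont hunit hscal one_pos
    have h1 := (isEquidistributed_of_mem_archSpan hF hF0 hf).1
    simpa using (hdiff h1 hfφ).add h1
  refine ⟨hInt, ?_⟩
  rw [Metric.tendsto_nhds]
  intro ε hε
  obtain ⟨f, hf, hfφ⟩ := exists_mem_archSpan_approx hcont hunit hscal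
    (show 0 < ε / 5 by linarith)
  obtain ⟨h1, h2⟩ := isEquidistributed_of_mem_archSpan hF hF0 hf
  rw [Metric.tendsto_nhds] at h2
  have h3 := (HeckeChar.tendsto_sum_weight (K := K)).eventually (eventually_lt_nhds one_lt_two)
  filter_upwards [h2 (ε / 5) (by linarith), h3, eventually_gt_atTop 0] with X hX1 hX2 hX
  have hsub : primeSum φ X = primeSum (φ - f) X + primeSum f X := by
    rw [← primeSum_add, sub_add_cancel]
  have hI : ‖∫ v in F, f v ∂(coneMeasure K) - ∫ v in F, φ v ∂(coneMeasure K)‖ ≤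
      ε / 5 * (coneMeasure K).real F := by
    rw [← integral_sub h1 hInt]
    refine norm_setIntegral_le_of_norm_le_const hF.ne_top.lt_top fun v hv => ?_
    rw [norm_sub_rev]; exact hfφ v (hne v hv)
  set J := ∫ v in F, φ v ∂(coneMeasure K)
  set J' := ∫ v in F, f v ∂(coneMeasure K)
  set κ : ℝ := (coneMeasure K).real F * classNumber K with hκ
  have hh : (1 : ℝ) ≤ classNumber K := by
    exact_mod_cast Nat.one_le_iff_ne_zero.2 (classNumber_ne_zero K)
  have hκ0 : 0 < κ := by positivity
  have e1 : ‖primeSum (φ - f) X / X‖ ≤ 2 * (ε / 5) := by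
    have h := norm_primeSum_le (f := φ - f) (M := ε / 5) (by linarith) (fun v hv => hfφ v hv) X
    rw [norm_div, Complex.norm_real, Real.norm_of_nonneg hX.le]
    calc _ ≤ _ := div_le_div_of_nonneg_right h hX.le
      _ = ε / 5 * _ := mul_div_assoc _ _ _
      _ ≤ ε / 5 * 2 := mul_le_mul_of_nonneg_left hX2.le (by linarith)
      _ = _ := mul_comm _ _
  have e2 : ‖(κ : ℂ)⁻¹ * (J' - J)‖ ≤ ε / 5 := by
    rw [_root_.norm_mul, norm_inv, Complex.norm_real, Real.norm_of_nonneg hκ0.le,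
      inv_mul_le_iff₀ hκ0]
    refine hI.trans ?_
    rw [mul_comm]
    refine mul_le_mul_of_nonneg_right ?_ (by linarith)
    rw [hκ]; exact le_mul_of_one_le_right hF1.le hh
  rw [dist_eq_norm] at hX1 ⊢
  have e3 : primeSum φ X / X - (κ : ℂ)⁻¹ * J = primeSum (φ - f) X / X +
      (primeSum f X / X - (κ : ℂ)⁻¹ * J') + (κ : ℂ)⁻¹ * (J' - J) := by
    rw [hsub]; ring
  rw [e3]
  refine (norm_add₃_le).trans_lt ?_
  linarith

end

/-- Weighted prime ideal theorem for principal primes: let `φ` be continuous on `V^×`,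
invariant under multiplication by units of `𝓞 K` and by nonzero real scalars.  Let `μ` be the
natural measure on the norm-one hypersurface `I` (a positive multiple of the cone measure),
normalized so that a fundamental domain `F` for the action of the units on `I` has mass the
regulator `R_K`.  Then
`Σ_{N(𝔭^l) ≤ X, 𝔭 principal} φ(𝔭) log N𝔭 = (X/(R_K h_K)) ∫_{I/𝓞_K^×} φ dμ + o(X)`. -/
theorem weighted_prime_ideal_theorem
    (φ : mixedSpace K → ℂ)
    (hcont : ContinuousOn φ {v : mixedSpace K | mixedEmbedding.norm v ≠ 0})
    (hunit : ∀ (u : (𝓞 K)ˣ) (v : mixedSpace K),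
      φ (mixedEmbedding K (((u : 𝓞 K) : K)) * v) = φ v)
    (hscal : ∀ c : ℝ, c ≠ 0 → ∀ v : mixedSpace K, φ (c • v) = φ v)
    (F : Set (mixedSpace K)) (hFmeas : MeasurableSet F)
    (hFsub : F ⊆ {v : mixedSpace K | mixedEmbedding.norm v = 1})
    (hFcover : coneMeasure K ({v : mixedSpace K | mixedEmbedding.norm v = 1} \
      ⋃ u : (𝓞 K)ˣ, (fun v => mixedEmbedding K (((u : 𝓞 K) : K)) * v) '' F) = 0)
    (hFdisj : ∀ u u' : (𝓞 K)ˣ, u ≠ u' →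
      coneMeasure K (((fun v => mixedEmbedding K (((u : 𝓞 K) : K)) * v) '' F) ∩
        ((fun v => mixedEmbedding K (((u' : 𝓞 K) : K)) * v) '' F)) = 0)
    (μ : Measure (mixedSpace K))
    (hμ : ∃ c : ℝ≥0∞, 0 < c ∧ c ≠ ⊤ ∧ μ = c • coneMeasure K)
    (hμF : μ F = ENNReal.ofReal (regulator K)) :
    (fun X : ℝ =>
        (∑ᶠ p ∈ {p : Ideal (𝓞 K) × ℕ | p.1.IsPrime ∧ p.1 ≠ ⊥ ∧
            Submodule.IsPrincipal p.1 ∧ 1 ≤ p.2 ∧ (Ideal.absNorm p.1 : ℝ) ^ p.2 ≤ X},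
          phiIdeal K φ p.1 * (Real.log (Ideal.absNorm p.1) : ℂ)) -
        ((X / (regulator K * classNumber K) : ℝ) : ℂ) * ∫ v in F, φ v ∂μ) =o[atTop]
      (fun X : ℝ => X) := by
  obtain ⟨c, hc0, hct, rfl⟩ := hμ
  have hR : 0 < regulator K := regulator_pos K
  rw [Measure.smul_apply, smul_eq_mul] at hμF
  have hF0 : coneMeasure K F ≠ 0 := by
    intro h
    rw [h, mul_zero] at hμF
    exact (ENNReal.ofReal_pos.2 hR).ne hμF
  have hFt : coneMeasure K F ≠ ⊤ :=
    (ENNReal.lt_top_of_mul_ne_top_right (by rw [hμF]; exact ENNReal.ofReal_ne_top) hc0.ne').ne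
  have hreg : c.toReal * (coneMeasure K).real F = regulator K := by
    rw [Measure.real, ← ENNReal.toReal_mul, hμF, ENNReal.toReal_ofReal hR.le]
  have hc : (c.toReal : ℂ) ≠ 0 := by
    exact_mod_cast (ENNReal.toReal_pos hc0.ne' hct).ne'
  have key := (isEquidistributed_of_continuousOn ⟨hFmeas, hFsub, hFcover, hFdisj, hFt⟩ hF0 hcont
    hunit hscal).2
  have hconst : ((regulator K * classNumber K : ℝ) : ℂ)⁻¹ * ∫ v in F, φ v ∂(c • coneMeasure K) =
      (((coneMeasure K).real F * classNumber K : ℝ) : ℂ)⁻¹ * ∫ v in F, φ v ∂(coneMeasure K) := by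
    rw [Measure.restrict_smul, integral_smul_measure, Complex.real_smul, ← hreg]
    push_cast
    rw [mul_assoc (c.toReal : ℂ), mul_inv, mul_right_comm, ← mul_assoc, inv_mul_cancel₀ hc, one_mul,
      mul_comm]
  rw [← hconst, ← tendsto_sub_nhds_zero_iff] at key
  have h1 := ((isLittleO_one_iff ℝ).2 key).mul_isBigO
    (IsBigO.of_norm_right (g' := fun X : ℝ => X) (f := fun X : ℝ => (X : ℂ)) (l := atTop)
      (IsBigO.of_bound 1 (Eventually.of_forall fun X => by simp)))
  simp only [one_mul] at h1
  refine h1.congr' ?_ EventuallyEq.rfl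
  refine (eventually_gt_atTop 0).mono fun X hX => ?_
  have hX' : (X : ℂ) ≠ 0 := by exact_mod_cast hX.ne'
  beta_reduce
  rw [primeSum_eq_finsum, sub_mul, div_mul_cancel₀ _ hX']
  push_cast
  ring
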